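/- arXiv:1905.03492 — 4 statements merged into one kernel-verified Lean document; each statement's English description precedes it below -/
import Mathlib

section
/- Let A be a finite-dimensional selfinjective algebra, I an ideal of A, and e an idempotent with r_A(I) = Ie. Then the map B = A/I → eAe/eIe sending a + I to eae + eIe is a well-defined K-algebra isomorphism. -/
/-- The right annihilator of a subset of a ring. -/
def rAnn {A : Type*} [Ring A] (S : Set A) : Set A := {a : A | ∀ x ∈ S, x * a = 0}

/-- The right annihilator of the two-sided ideal generated by a left ideal `M`. -/
def annRight {A : Type*} [Ring A] (M : Ideal A) : Ideal A where
  carrier := {a | ∀ x ∈ M, ∀ b, x * b * a = 0}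
  add_mem' h h' x hx b := by rw [mul_add, h x hx b, h' x hx b, add_zero]
  zero_mem' x _ b := mul_zero _
  smul_mem' c a h x hx b := by
    rw [smul_eq_mul, ← mul_assoc, mul_assoc x b c, h x hx (b * c)]

section annRight

variable {A : Type*} [Ring A] {M N : Ideal A}

theorem mem_annRight {a : A} : a ∈ annRight M ↔ ∀ x ∈ M, ∀ b, x * b * a = 0 := Iff.rfl

theorem mul_eq_zero_of_mem_annRight {x a : A} (hx : x ∈ M) (ha : a ∈ annRight M) :
    x * a = 0 := by
  simpa using ha x hx 1

instance annRight_isTwoSided : (annRight M).IsTwoSided where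
  mul_mem_of_left b ha x hx c := by rw [← mul_assoc, ha x hx c, zero_mul]

theorem annRight_anti (h : M ≤ N) : annRight N ≤ annRight M :=
  fun _ ha x hx => ha x (h hx)

/-- Over a right self-injective ring, a finitely generated left ideal `M` contains every element
that annihilates the right annihilator of `M`. -/
theorem mem_of_fg_of_forall_mul_eq_zero [Module.Injective Aᵐᵒᵖ A] (hM : M.FG) {x : A}
    (hx : ∀ y, (∀ m ∈ M, m * y = 0) → x * y = 0) : x ∈ M := by
  obtain ⟨n, a, ha⟩ := Submodule.fg_iff_exists_fin_generating_family.mp hM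
  have haM (i : Fin n) : a i ∈ M := ha ▸ Submodule.subset_span ⟨i, rfl⟩
  let φ : A →ₗ[Aᵐᵒᵖ] (Fin n → A) := LinearMap.pi fun i => LinearMap.mulLeft Aᵐᵒᵖ (a i)
  have hker : LinearMap.ker φ ≤ LinearMap.ker (LinearMap.mulLeft Aᵐᵒᵖ x) := by
    intro y hy
    refine hx y fun m hm => ?_
    rw [← ha] at hm
    induction hm using Submodule.span_induction with
    | mem m hm =>
      obtain ⟨i, rfl⟩ := hm
      exact congrFun hy i
    | zero => exact zero_mul y
    | add m m' _ _ h h' => rw [add_mul, h, h', add_zero]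
    | smul c m _ h => rw [smul_eq_mul, mul_assoc, h, mul_zero]
  obtain ⟨h, hh⟩ := Module.Injective.out ((LinearMap.ker φ).liftQ φ le_rfl)
    (LinearMap.ker_eq_bot.mp (Submodule.ker_liftQ_eq_bot' _ φ rfl))
    ((LinearMap.ker φ).liftQ _ hker)
  have hx1 : h a = x := by
    have key := hh (Submodule.Quotient.mk 1)
    rw [Submodule.liftQ_apply, Submodule.liftQ_apply, LinearMap.mulLeft_apply, mul_one] at key
    rw [← key]
    congr 1
    ext i
    exact (mul_one (a i)).symm
  have hsum : a = ∑ i, MulOpposite.op (a i) • Pi.single i (1 : A) := by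
    ext j
    simp [Finset.sum_apply, Pi.single_apply]
  rw [← hx1, hsum, map_sum]
  refine M.sum_mem fun i _ => ?_
  rw [map_smul]
  exact M.mul_mem_left _ (haM i)

theorem le_of_annRight_le [IsNoetherianRing A] [Module.Injective Aᵐᵒᵖ A] [N.IsTwoSided]
    (h : annRight N ≤ annRight M) : M ≤ N := by
  intro x hx
  refine mem_of_fg_of_forall_mul_eq_zero (IsNoetherian.noetherian N) fun y hy => ?_
  exact mul_eq_zero_of_mem_annRight hx
    (h fun z hz b => hy _ (Ideal.mul_mem_right b N hz))

/-- Over a left Noetherian, right self-injective ring, a two-sided ideal contained in its double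
right annihilator is equal to it. -/
theorem annRight_annRight_le [IsNoetherianRing A] [Module.Injective Aᵐᵒᵖ A] [M.IsTwoSided]
    (h : M ≤ annRight (annRight M)) : annRight (annRight M) ≤ M := by
  let Ψ : Ideal A → Ideal A := fun L => annRight (annRight L)
  have hmono : Monotone Ψ := fun _ _ hL => annRight_anti (annRight_anti hL)
  obtain ⟨n, hn⟩ := monotone_stabilizes_iff_noetherian.mpr ‹IsNoetherianRing A›
    ⟨fun n => Ψ^[n] M, hmono.monotone_iterate_of_le_map h⟩
  have hle : Ψ^[n + 1] M ≤ Ψ^[n] M := (hn (n + 1) n.le_succ).ge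
  clear hn
  induction n with
  | zero => exact hle
  | succ n ih =>
    apply ih
    have : (Ψ^[n] M).IsTwoSided := by
      cases n with
      | zero => assumption
      | succ n => rw [Function.iterate_succ_apply']; exact annRight_isTwoSided
    simp only [Function.iterate_succ_apply'] at hle ⊢
    exact le_of_annRight_le (le_of_annRight_le hle)

/-- If the right annihilator of a two-sided ideal `I` is `Ie` for an idempotent `e`, then `1 - e`
lies in `I`. -/
theorem one_sub_mem_of_rAnn_eq [IsNoetherianRing A] [Module.Injective Aᵐᵒᵖ A]
    (I : Ideal A) [I.IsTwoSided] {e : A} (he : IsIdempotentElem e)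
    (hann : rAnn (I : Set A) = (fun x => x * e) '' (I : Set A)) : 1 - e ∈ I := by
  have hr {y : A} (hy : ∀ x ∈ I, x * y = 0) : y * (1 - e) = 0 := by
    obtain ⟨z, -, rfl⟩ : y ∈ (fun x => x * e) '' (I : Set A) := hann ▸ hy
    simp only [mul_assoc, he.mul_one_sub_self, mul_zero]
  have hI {x y : A} (hx : x ∈ I) (hy : y ∈ I) : x * y * e = 0 := by
    have : y * e ∈ rAnn (I : Set A) := hann ▸ ⟨y, hy, rfl⟩
    rw [mul_assoc, this x hx]
  have hg : 1 - e ∈ annRight (annRight (I * I)) := by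
    intro z hz b
    have hzb : z * b ∈ annRight (I * I) := Ideal.mul_mem_right b _ hz
    have h1 : z * b * (1 - e) * (1 - e) = 0 := hr fun y hy => by
      rw [← mul_assoc]
      refine hr fun x hx => ?_
      rw [← mul_assoc]
      exact mul_eq_zero_of_mem_annRight (Ideal.mul_mem_mul hx hy) hzb
    rwa [mul_assoc, he.one_sub.eq] at h1
  refine Ideal.mul_le_left (annRight_annRight_le (M := I * I) (Ideal.mul_le.mpr ?_) hg)
  intro x hx y hy
  have hxy : x * y = x * y * (1 - e) := by rw [mul_sub, mul_one, hI hx hy, sub_zero]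
  rw [hxy]
  exact Ideal.mul_mem_left _ _ hg

end annRight

/-- Let `A` be a finite-dimensional selfinjective algebra, `I` a two-sided
ideal of `A`, and `e` an idempotent with `r_A(I) = Ie`.  Then the map
`B = A/I → eAe/eIe`, `a + I ↦ e*a*e + eIe`, is a well-defined `K`-algebra isomorphism.
Here the corner algebra `eAe` is `{x | e*x*e = x}` (with unit `e`), `eIe` is the image of
`I` under `x ↦ e*x*e`, and the isomorphism statement is expressed elementwise:
the map is well defined, injective, surjective, additive, multiplicative, unital and
`K`-linear on cosets. -/
theorem quotient_iso_corner_quotient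
    {K A : Type*} [Field K] [Ring A] [Algebra K A] [FiniteDimensional K A]
    [Module.Injective Aᵐᵒᵖ A]
    (I : Ideal A) (hI : ∀ x ∈ I, ∀ a : A, x * a ∈ I)  -- `I` is a two-sided ideal
    (e : A) (he : IsIdempotentElem e)
    (hann : rAnn (I : Set A) = (fun x => x * e) '' (I : Set A)) :
    -- `eIe` denotes the set `(fun x => e * x * e) '' I`
    -- well-definedness: elements of `I` are sent into `eIe`
    (∀ a ∈ I, e * a * e ∈ (fun x => e * x * e) '' (I : Set A)) ∧
    -- injectivity: if `e*a*e` lies in `eIe`, then `a ∈ I`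
    (∀ a : A, e * a * e ∈ (fun x => e * x * e) '' (I : Set A) → a ∈ I) ∧
    -- surjectivity: every element of `eAe` is hit modulo `eIe`
    (∀ x : A, e * x * e = x → ∃ a : A, x - e * a * e ∈ (fun x => e * x * e) '' (I : Set A)) ∧
    -- multiplicativity modulo `eIe`
    (∀ a b : A, (e * a * e) * (e * b * e) - e * (a * b) * e ∈
        (fun x => e * x * e) '' (I : Set A)) ∧
    -- additivity
    (∀ a b : A, e * (a + b) * e = e * a * e + e * b * e) ∧
    -- `K`-linearity
    (∀ (k : K) (a : A), e * (k • a) * e = k • (e * a * e)) ∧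
    -- unitality: `1 + I` is sent to the unit `e` of `eAe/eIe`
    (e * (1 : A) * e = e) := by
  have : I.IsTwoSided := ⟨fun b ha => hI _ ha b⟩
  have : IsNoetherianRing A := isNoetherian_of_tower K inferInstance
  have hg : 1 - e ∈ I := one_sub_mem_of_rAnn_eq I he hann
  refine ⟨fun a ha => ⟨a, ha, rfl⟩, ?_, fun x hx => ⟨x, 0, I.zero_mem, by simp [hx]⟩, fun a b => ?_,
    fun a b => by rw [mul_add, add_mul],
    fun k a => by rw [mul_smul_comm, smul_mul_assoc], by rw [mul_one, he.eq]⟩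
  · rintro a ⟨x, hx, hxa⟩
    have h : a = e * x * e + ((1 - e) * a + e * a * (1 - e)) := by
      rw [show e * x * e = e * a * e from hxa]
      noncomm_ring
    rw [h]
    exact I.add_mem (hI _ (I.mul_mem_left e hx) e)
      (I.add_mem (hI _ hg a) (I.mul_mem_left _ hg))
  · refine ⟨-(a * (1 - e) * b), I.neg_mem (hI _ (I.mul_mem_left a hg) b), ?_⟩
    have h : e * a * e * (e * b * e) = e * a * (e * e) * b * e := by noncomm_ring
    rw [h, he.eq]
    noncomm_ring
end

section
/- Let A be a finite-dimensional algebra over a field K and M an indecomposable A-module that does not lie on a short cycle in mod A. If N is an indecomposable A-module with the same class as M in the Grothendieck group K_0(A) (i.e., the same composition factors with multiplicities), then N is isomorphic to M. -/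
/-- A module is indecomposable if it is nonzero and is not the internal direct sum of two
nonzero submodules. -/
def IsIndecomposable (R : Type*) [Ring R] (M : Type*) [AddCommGroup M] [Module R M] :
    Prop :=
  Nontrivial M ∧ ∀ p q : Submodule R M, IsCompl p q → p = ⊥ ∨ q = ⊥

/-- The `i`-th composition factor of a composition series of submodules. -/
abbrev csFactor {R M : Type*} [Ring R] [AddCommGroup M] [Module R M]
    (s : CompositionSeries (Submodule R M)) (i : Fin s.length) :=
  ↥(s i.succ) ⧸ Submodule.comap (s i.succ).subtype (s i.castSucc)

/-- Two modules have the same class in the Grothendieck group `K₀`, i.e. the same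
composition factors with the same multiplicities. -/
def SameCompositionFactors (R : Type*) [Ring R] (M N : Type*) [AddCommGroup M]
    [Module R M] [AddCommGroup N] [Module R N] : Prop :=
  ∃ (s : CompositionSeries (Submodule R M)) (t : CompositionSeries (Submodule R N)),
    s 0 = ⊥ ∧ s (Fin.last _) = ⊤ ∧ t 0 = ⊥ ∧ t (Fin.last _) = ⊤ ∧
    ∃ σ : Fin s.length ≃ Fin t.length,
      ∀ i, Nonempty (csFactor s i ≃ₗ[R] csFactor t (σ i))

/-- `M` lies on a short cycle `M → Y → M` of nonzero non-isomorphisms between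
indecomposable finite-dimensional modules. -/
def LiesOnShortCycle (R : Type*) [Ring R] (M : Type v) [AddCommGroup M] [Module R M] :
    Prop :=
  ∃ Y : ModuleCat.{v} R, Module.Finite R Y ∧ IsIndecomposable R Y ∧
    ∃ (f : M →ₗ[R] Y) (g : Y →ₗ[R] M), f ≠ 0 ∧ g ≠ 0 ∧
      ¬Function.Bijective f ∧ ¬Function.Bijective g

section Splitting

variable {R : Type*} [Ring R]

/-- `M` lies on no short cycle through an indecomposable module in the universe `w`. -/
def AvoidsShortCycles.{w} (R : Type*) [Ring R] (M : Type*) [AddCommGroup M] [Module R M] : Prop :=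
  ∀ (Y : Type w) [AddCommGroup Y] [Module R Y] [Module.Finite R Y], IsIndecomposable R Y →
    ∀ (f : M →ₗ[R] Y) (g : Y →ₗ[R] M), f ≠ 0 → g ≠ 0 →
      ¬Function.Bijective f → Function.Bijective g

theorem IsIndecomposable.of_equiv {M N : Type*} [AddCommGroup M] [Module R M] [AddCommGroup N]
    [Module R N] (e : M ≃ₗ[R] N) (h : IsIndecomposable R M) : IsIndecomposable R N := by
  have := h.1
  refine ⟨e.symm.toEquiv.nontrivial, fun p q hpq => ?_⟩
  have := h.2 (Submodule.orderIsoMapComap e.symm p) (Submodule.orderIsoMapComap e.symm q)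
    ((OrderIso.isCompl_iff _).1 hpq)
  simpa using this

/-- An additive functional on the endomorphisms of `E` that does not kill the identity does not
kill the projection onto some indecomposable direct summand. -/
theorem exists_indecomposable_retract {E G : Type*} [AddCommGroup E] [Module R E] [IsArtinian R E]
    [AddCommGroup G] (T : (E →ₗ[R] E) →+ G) (hT : T LinearMap.id ≠ 0) :
    ∃ (p : Submodule R E) (π : E →ₗ[R] p), π ∘ₗ p.subtype = LinearMap.id ∧
      IsIndecomposable R p ∧ T (p.subtype ∘ₗ π) ≠ 0 := by
  obtain ⟨p, ⟨π, hπ, hTp⟩, hmin⟩ := (wellFounded_lt (α := Submodule R E)).has_min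
    {p | ∃ π : E →ₗ[R] p, π ∘ₗ p.subtype = LinearMap.id ∧ T (p.subtype ∘ₗ π) ≠ 0}
    ⟨⊤, LinearMap.codRestrict ⊤ LinearMap.id (by simp), by ext; simp, hT⟩
  refine ⟨p, π, hπ, ⟨?_, fun a b hab => ?_⟩, hTp⟩
  · by_contra hp
    rw [not_nontrivial_iff_subsingleton] at hp
    exact hTp (by rw [show p.subtype ∘ₗ π = 0 by ext x; simp [Subsingleton.elim (π x) 0], map_zero])
  · by_contra! hne
    have key : ∀ a b : Submodule R p, ∀ hab : IsCompl a b, b ≠ ⊥ →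
        T (p.subtype ∘ₗ a.subtype ∘ₗ a.projectionOnto b hab ∘ₗ π) = 0 := by
      intro a b hab hb
      by_contra h
      refine hmin (a.map p.subtype) ⟨(LinearMap.codRestrict _
        (p.subtype ∘ₗ a.subtype ∘ₗ a.projectionOnto b hab ∘ₗ π) fun x =>
          Submodule.mem_map_of_mem (Subtype.property _)), ?_, ?_⟩ ?_
      · ext ⟨_, x, hx, rfl⟩
        have : π x = x := LinearMap.congr_fun hπ x
        simp only [LinearMap.comp_apply, Submodule.subtype_apply, LinearMap.codRestrict_apply, this,
          LinearMap.id_apply]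
        rw [Submodule.projectionOnto_apply_left hab ⟨x, hx⟩]
      · exact h
      · refine lt_of_le_of_ne (Submodule.map_subtype_le _ _) fun heq => hb ?_
        have : a = ⊤ := by
          rw [← Submodule.comap_map_eq_of_injective p.subtype_injective a, heq]
          simp
        subst this
        simpa using hab.inf_eq_bot
    apply hTp
    have h1 := key a b hab hne.2
    have h2 := key b a hab.symm hne.1
    have : p.subtype ∘ₗ π = p.subtype ∘ₗ a.subtype ∘ₗ a.projectionOnto b hab ∘ₗ π +
        p.subtype ∘ₗ b.subtype ∘ₗ b.projectionOnto a hab.symm ∘ₗ π := by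
      ext x
      have := Submodule.projection_add_projection_eq_self hab (π x)
      simpa using (congrArg Subtype.val this).symm
    rw [this, map_add, h1, h2, add_zero]

variable [IsArtinianRing R] {M : Type*} [AddCommGroup M] [Module R M] [Module.Finite R M]

/-- If `M` avoids short cycles, extensions of `M` by a quotient of `M` split. -/
theorem AvoidsShortCycles.exists_retraction.{w} (hM : AvoidsShortCycles.{w} R M)
    {L : Type*} {E : Type w} [AddCommGroup L] [Module R L] [AddCommGroup E] [Module R E]
    [Module.Finite R E] (ρ : M →ₗ[R] L) (hρ : Function.Surjective ρ) (i : L →ₗ[R] E)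
    (e : E →ₗ[R] M) (hi : Function.Injective i) (he : Function.Surjective e)
    (hie : Function.Exact i e) : ∃ r : E →ₗ[R] L, r ∘ₗ i = LinearMap.id := by
  induction hU : LinearMap.ker ρ using (wellFounded_gt (α := Submodule R M)).induction
    generalizing L E with
  | _ U ih =>
  by_contra hr
  have hs : ¬∃ s : M →ₗ[R] E, e ∘ₗ s = LinearMap.id :=
    fun h => hr (((hie.split_tfae hi he).out 0 1 rfl rfl).1 h)
  have hρi : i ∘ₗ ρ ≠ 0 := fun h => hr ⟨0, LinearMap.ext fun x => by
    obtain ⟨y, rfl⟩ := hρ x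
    have : ρ y = 0 := hi (by simpa using LinearMap.congr_fun h y)
    simp [this]⟩
  obtain ⟨p, π, hπ, hp, hT⟩ := exists_indecomposable_retract (E := E)
    (AddMonoidHom.mk' (fun u : E →ₗ[R] E => u ∘ₗ i ∘ₗ ρ) fun a b => LinearMap.add_comp _ _ _)
    (by simpa using hρi)
  have hπ' : ∀ x : p, π x = x := LinearMap.congr_fun hπ
  replace hT : π ∘ₗ i ∘ₗ ρ ≠ 0 := fun h => hT (by
    simp only [AddMonoidHom.mk'_apply, LinearMap.comp_assoc, h, LinearMap.comp_zero])
  by_cases hg : e ∘ₗ p.subtype = 0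
  · have hpi : ∀ x : p, (x : E) ∈ LinearMap.range i := fun x =>
      (hie x).1 (LinearMap.congr_fun hg x)
    let j : p →ₗ[R] L := (LinearEquiv.ofInjective i hi).symm.toLinearMap ∘ₗ
      Submodule.inclusion fun x hx => hpi ⟨x, hx⟩
    have hj : ∀ x, i (j x) = x := fun x =>
      congrArg Subtype.val ((LinearEquiv.ofInjective i hi).apply_symm_apply ⟨x, hpi x⟩)
    have hker : LinearMap.ker ρ < LinearMap.ker ((p.comap i).mkQ ∘ₗ ρ) := by
      refine lt_of_le_of_ne (LinearMap.ker_le_ker_comp _ _) fun h => ?_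
      obtain ⟨x, hx⟩ := @exists_ne _ hp.1 0
      obtain ⟨y, hy⟩ := hρ (j x)
      have : y ∈ LinearMap.ker ((p.comap i).mkQ ∘ₗ ρ) := by
        simp [hy, hj]
      rw [← h, LinearMap.mem_ker, hy] at this
      apply hx
      rw [← Subtype.coe_inj, ← hj, this, map_zero, Submodule.coe_zero]
    obtain ⟨r, hr'⟩ := ih _ (hU ▸ hker) ((p.comap i).mkQ ∘ₗ ρ)
      ((Submodule.mkQ_surjective _).comp hρ) (Submodule.mapQ (p.comap i) p i le_rfl)
      (p.liftQ e fun x hx => LinearMap.congr_fun hg ⟨x, hx⟩)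
      (by
        rw [← LinearMap.ker_eq_bot, Submodule.ker_mapQ]
        simp)
      (fun x => by
        obtain ⟨y, rfl⟩ := he x
        exact ⟨p.mkQ y, rfl⟩)
      (fun x => by
        obtain ⟨x, rfl⟩ := p.mkQ_surjective x
        change e x = 0 ↔ _
        refine ⟨fun h => ?_, fun ⟨y, hy⟩ => ?_⟩
        · obtain ⟨y, rfl⟩ := (hie x).1 h
          exact ⟨(p.comap i).mkQ y, by simp⟩
        · obtain ⟨y, rfl⟩ := Submodule.mkQ_surjective _ y
          rw [Submodule.mkQ_apply, Submodule.mapQ_apply, Submodule.mkQ_apply,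
            Submodule.Quotient.eq] at hy
          have := LinearMap.congr_fun hg ⟨_, hy⟩
          simpa [hie.apply_apply_eq_zero] using this) rfl
    let s : (L ⧸ p.comap i) →ₗ[R] L := (p.comap i).liftQ (LinearMap.id - j ∘ₗ π ∘ₗ i) fun x hx => by
      apply hi
      have := congrArg Subtype.val (hπ' ⟨i x, hx⟩)
      simp_all
    refine hr ⟨j ∘ₗ π + s ∘ₗ r ∘ₗ p.mkQ, LinearMap.ext fun x => ?_⟩
    have := LinearMap.congr_fun hr' (Submodule.Quotient.mk x)
    simp only [LinearMap.comp_apply, Submodule.mapQ_apply, LinearMap.id_apply] at this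
    have hs : s (Submodule.Quotient.mk x) = x - j (π (i x)) := rfl
    simp [this, hs]
  · by_cases hf : Function.Bijective (π ∘ₗ i ∘ₗ ρ)
    · have hρ' : Function.Bijective ρ := ⟨fun x y h => hf.1 (by simp [h]), hρ⟩
      have h1 : Function.Bijective (π ∘ₗ i) :=
        (Function.Bijective.of_comp_iff (π ∘ₗ i) hρ').1 hf
      exact hr ⟨(LinearEquiv.ofBijective _ h1).symm.toLinearMap ∘ₗ π, LinearMap.ext fun x =>
        (LinearEquiv.ofBijective _ h1).symm_apply_apply x⟩
    · have h1 := hM p hp _ _ hT hg hf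
      exact hs ⟨p.subtype ∘ₗ (LinearEquiv.ofBijective _ h1).symm.toLinearMap, LinearMap.ext fun x =>
        (LinearEquiv.ofBijective _ h1).apply_symm_apply x⟩

/-- If `M` avoids short cycles, extensions of a submodule of `M` by `M` split. -/
theorem AvoidsShortCycles.exists_section.{w} (hM : AvoidsShortCycles.{w} R M)
    {V : Type*} {E : Type w} [AddCommGroup V] [Module R V] [AddCommGroup E] [Module R E]
    [Module.Finite R E] (ι : V →ₗ[R] M) (hι : Function.Injective ι) (i : M →ₗ[R] E)
    (e : E →ₗ[R] V) (hi : Function.Injective i) (he : Function.Surjective e)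
    (hie : Function.Exact i e) : ∃ s : V →ₗ[R] E, e ∘ₗ s = LinearMap.id := by
  induction hU : LinearMap.range ι using (wellFounded_lt (α := Submodule R M)).induction
    generalizing V E with
  | _ U ih =>
  by_contra hs
  have hr : ¬∃ r : E →ₗ[R] M, r ∘ₗ i = LinearMap.id :=
    fun h => hs (((hie.split_tfae hi he).out 0 1 rfl rfl).2 h)
  have hιe : ι ∘ₗ e ≠ 0 := fun h => hs ⟨0, LinearMap.ext fun x => by
    obtain ⟨y, rfl⟩ := he x
    have : e y = 0 := hι (by simpa using LinearMap.congr_fun h y)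
    simp [this]⟩
  obtain ⟨p, π, hπ, hp, hT⟩ := exists_indecomposable_retract (E := E)
    (AddMonoidHom.mk' (fun u : E →ₗ[R] E => (ι ∘ₗ e) ∘ₗ u) fun a b => LinearMap.comp_add _ _ _)
    (by simpa using hιe)
  have hπ' : ∀ x : p, π x = x := LinearMap.congr_fun hπ
  replace hT : ι ∘ₗ e ∘ₗ p.subtype ≠ 0 := fun h => hT (by
    simp only [AddMonoidHom.mk'_apply]
    rw [← LinearMap.comp_assoc, LinearMap.comp_assoc p.subtype, h, LinearMap.zero_comp])
  by_cases hf : π ∘ₗ i = 0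
  · obtain ⟨t, ht⟩ : ∃ t : V →ₗ[R] p, t ∘ₗ e = π := by
      refine ⟨(LinearMap.ker e).liftQ π (fun x hx => ?_) ∘ₗ
        (e.quotKerEquivOfSurjective he).symm.toLinearMap, LinearMap.ext fun x => ?_⟩
      · obtain ⟨y, rfl⟩ := (hie x).1 hx
        exact LinearMap.congr_fun hf y
      · have : (e.quotKerEquivOfSurjective he).symm (e x) = Submodule.Quotient.mk x := by
          rw [LinearEquiv.symm_apply_eq]
          rfl
        simp [this]
    have ht' : ∀ x, t (e x) = π x := LinearMap.congr_fun ht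
    have hlt : LinearMap.range (ι ∘ₗ (LinearMap.ker t).subtype) < LinearMap.range ι := by
      refine lt_of_le_of_ne (LinearMap.range_comp_le_range _ _) fun h => ?_
      obtain ⟨x, hx⟩ := @exists_ne _ hp.1 0
      obtain ⟨y, hy⟩ : ι (e x) ∈ LinearMap.range (ι ∘ₗ (LinearMap.ker t).subtype) :=
        h ▸ LinearMap.mem_range_self _ _
      have h2 : t (e x) = 0 := hι hy ▸ y.2
      exact hx (by rw [← hπ' x, ← ht', h2])
    obtain ⟨σ, hσ⟩ := ih _ (hU ▸ hlt) (ι ∘ₗ (LinearMap.ker t).subtype)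
      (hι.comp (Submodule.subtype_injective _))
      (i.codRestrict (LinearMap.ker π) (LinearMap.congr_fun hf))
      (e.restrict (p := LinearMap.ker π) (q := LinearMap.ker t) fun x hx => by
        rw [LinearMap.mem_ker, ht']; exact hx)
      (fun x y h => hi (congrArg Subtype.val h))
      (fun x => by
        obtain ⟨y, hy⟩ := he x
        exact ⟨⟨y, by rw [LinearMap.mem_ker, ← ht', hy]; exact x.2⟩, Subtype.ext hy⟩)
      (fun x => by
        refine ⟨fun h => ?_, fun ⟨y, hy⟩ => ?_⟩
        · obtain ⟨y, hy⟩ := (hie x).1 (congrArg Subtype.val h)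
          exact ⟨y, Subtype.ext hy⟩
        · exact Subtype.ext (hy ▸ hie.apply_apply_eq_zero y)) rfl
    have hσ' : ∀ x, e (σ x) = x := fun x => congrArg Subtype.val (LinearMap.congr_fun hσ x)
    let d : V →ₗ[R] LinearMap.ker t :=
      (LinearMap.id - e ∘ₗ p.subtype ∘ₗ t).codRestrict _ fun x => by simp [ht', hπ']
    refine hs ⟨p.subtype ∘ₗ t + (LinearMap.ker π).subtype ∘ₗ σ ∘ₗ d, LinearMap.ext fun x => ?_⟩
    have hd : (d x : V) = x - e (t x) := rfl
    simp [hσ', hd]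
  · by_cases hg : Function.Bijective (ι ∘ₗ e ∘ₗ p.subtype)
    · have hι' : Function.Bijective ι := ⟨hι, fun x => (hg.2 x).imp' (e ∘ₗ p.subtype) fun _ h => h⟩
      have h1 : Function.Bijective (e ∘ₗ p.subtype) :=
        (Function.Bijective.of_comp_iff' hι' (e ∘ₗ p.subtype)).1 hg
      exact hs ⟨p.subtype ∘ₗ (LinearEquiv.ofBijective _ h1).symm.toLinearMap, LinearMap.ext fun x =>
        (LinearEquiv.ofBijective _ h1).apply_symm_apply x⟩
    · have h1 : Function.Bijective (π ∘ₗ i) := by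
        by_contra h
        exact hg (hM p hp _ _ hf hT h)
      exact hr ⟨(LinearEquiv.ofBijective _ h1).symm.toLinearMap ∘ₗ π, LinearMap.ext fun x =>
        (LinearEquiv.ofBijective _ h1).symm_apply_apply x⟩

/-- If `M` avoids short cycles and `Ω` is the kernel of an epimorphism `P → M`, then homomorphisms
from `Ω` to quotients of `M` extend to `P`. -/
theorem AvoidsShortCycles.exists_extend.{w₁, w₂} {L : Type w₁} {P : Type w₂} [AddCommGroup L]
    [Module R L] [AddCommGroup P] [Module R P] [Module.Finite R P]
    (hM : AvoidsShortCycles.{max w₁ w₂} R M) (ρ : M →ₗ[R] L) (hρ : Function.Surjective ρ)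
    (q : P →ₗ[R] M) (hq : Function.Surjective q) (ψ : LinearMap.ker q →ₗ[R] L) :
    ∃ Ψ : P →ₗ[R] L, Ψ ∘ₗ (LinearMap.ker q).subtype = ψ := by
  have : Module.Finite R L := Module.Finite.of_surjective ρ hρ
  let S := LinearMap.range ((LinearMap.ker q).subtype.prod (-ψ))
  have hS : ∀ a b, (a, b) ∈ S ↔ ∃ h : a ∈ LinearMap.ker q, ψ ⟨a, h⟩ = -b := by
    intro a b
    refine ⟨fun ⟨x, hx⟩ => ?_, fun ⟨h, hb⟩ => ⟨⟨a, h⟩, by simp [hb]⟩⟩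
    obtain ⟨rfl, rfl⟩ := Prod.mk.inj hx
    exact ⟨x.2, by simp⟩
  obtain ⟨r, hr⟩ := hM.exists_retraction ρ hρ (S.mkQ ∘ₗ LinearMap.inr R P L)
    (S.liftQ (q ∘ₗ LinearMap.fst R P L) fun ⟨a, b⟩ h => ((hS a b).1 h).1)
    (by
      rw [injective_iff_map_eq_zero]
      intro x hx
      simp only [LinearMap.comp_apply, Submodule.mkQ_apply, Submodule.Quotient.mk_eq_zero] at hx
      obtain ⟨h, h'⟩ := (hS _ _).1 hx
      have h0 : ψ ⟨0, h⟩ = 0 := map_zero ψ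
      exact neg_eq_zero.1 (h'.symm.trans h0))
    (fun x => by
      obtain ⟨y, rfl⟩ := hq x
      exact ⟨S.mkQ (y, 0), by simp⟩)
    (fun x => by
      obtain ⟨⟨a, b⟩, rfl⟩ := S.mkQ_surjective x
      refine ⟨fun h => ⟨b + ψ ⟨a, h⟩, ?_⟩, fun ⟨y, hy⟩ => ?_⟩
      · simp only [LinearMap.comp_apply, Submodule.mkQ_apply, Submodule.Quotient.eq]
        simp only [LinearMap.inr_apply, Prod.mk_sub_mk]
        rw [← S.neg_mem_iff]
        refine (hS _ _).2 ⟨by simpa using h, by simp⟩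
      · rw [← hy]; simp)
  refine ⟨r ∘ₗ S.mkQ ∘ₗ LinearMap.inl R P L, LinearMap.ext fun x => ?_⟩
  rw [← LinearMap.id_apply (R := R) (ψ x), ← hr]
  simp only [LinearMap.comp_apply]
  congr 1
  simp only [Submodule.mkQ_apply, Submodule.Quotient.eq]
  refine (hS _ _).2 ⟨by simp, by simp⟩

/-- If `M` avoids short cycles and `j : M → I` is a monomorphism, then homomorphisms from
submodules of `M` to the cokernel of `j` lift to `I`. -/
theorem AvoidsShortCycles.exists_lift.{w₁, w₂} {V : Type w₁} {I : Type w₂} [AddCommGroup V]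
    [Module R V] [AddCommGroup I] [Module R I] [Module.Finite R I]
    (hM : AvoidsShortCycles.{max w₁ w₂} R M) (ι : V →ₗ[R] M) (hι : Function.Injective ι)
    (j : M →ₗ[R] I) (hj : Function.Injective j) (h : V →ₗ[R] I ⧸ LinearMap.range j) :
    ∃ H : V →ₗ[R] I, (LinearMap.range j).mkQ ∘ₗ H = h := by
  have : Module.Finite R V := Module.Finite.of_injective ι hι
  let S := LinearMap.ker ((LinearMap.range j).mkQ ∘ₗ LinearMap.fst R I V - h ∘ₗ LinearMap.snd R I V)
  have hS : ∀ a b, (a, b) ∈ S ↔ (LinearMap.range j).mkQ a = h b := fun a b => by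
    simp [S, sub_eq_zero]
  obtain ⟨s, hs⟩ := hM.exists_section ι hι
    ((LinearMap.inl R I V ∘ₗ j).codRestrict S fun x => (hS _ _).2 (by simp))
    (LinearMap.snd R I V ∘ₗ S.subtype)
    (fun x y hxy => hj (congrArg (fun z => z.1.1) hxy))
    (fun x => by
      obtain ⟨y, hy⟩ := Submodule.mkQ_surjective _ (h x)
      exact ⟨⟨(y, x), (hS _ _).2 hy⟩, rfl⟩)
    (fun ⟨⟨a, b⟩, hab⟩ => by
      refine ⟨fun hb => ?_, fun ⟨y, hy⟩ => ?_⟩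
      · replace hb : b = 0 := hb
        subst hb
        obtain ⟨y, hy⟩ : a ∈ LinearMap.range j := by simpa using (hS _ _).1 hab
        exact ⟨y, Subtype.ext (Prod.ext hy rfl)⟩
      · rw [← hy]; rfl)
  refine ⟨LinearMap.fst R I V ∘ₗ S.subtype ∘ₗ s, LinearMap.ext fun x => ?_⟩
  have h1 : (s x).1.2 = x := LinearMap.congr_fun hs x
  have h2 := (hS (s x).1.1 (s x).1.2).1 (s x).2
  rw [h1] at h2
  exact h2

end Splitting

section Covers

variable {R : Type*} [Ring R]

theorem Module.Baer.of_retract {P Q : Type*} [AddCommGroup P] [Module R P] [AddCommGroup Q]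
    [Module R Q] (hQ : Module.Baer R Q) (i : P →ₗ[R] Q) (r : Q →ₗ[R] P)
    (h : r ∘ₗ i = LinearMap.id) : Module.Baer R P := fun I g => by
  obtain ⟨g', hg'⟩ := hQ I (i ∘ₗ g)
  exact ⟨r ∘ₗ g', fun x hx => by simpa [hg' x hx] using LinearMap.congr_fun h (g ⟨x, hx⟩)⟩

variable [IsArtinianRing R]

/-- A finitely generated module over an artinian ring has a projective cover. -/
theorem exists_projective_cover {F Ω : Type*} [AddCommGroup F] [Module R F] [Module.Finite R F]
    [Module.Projective R F] [AddCommGroup Ω] [Module R Ω] (δ : F →ₗ[R] Ω)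
    (hδ : Function.Surjective δ) :
    ∃ P : Submodule R F, Module.Projective R P ∧ Function.Surjective (δ ∘ₗ P.subtype) ∧
      ∀ W : Submodule R P, LinearMap.ker (δ ∘ₗ P.subtype) ⊔ W = ⊤ → W = ⊤ := by
  obtain ⟨P, ⟨hP, hPδ⟩, hmin⟩ := (wellFounded_lt (α := Submodule R F)).has_min
    {P | Module.Projective R P ∧ Function.Surjective (δ ∘ₗ P.subtype)}
    ⟨⊤, .of_equiv Submodule.topEquiv.symm, fun x => (hδ x).imp' (⟨·, trivial⟩) fun _ h => h⟩
  refine ⟨P, hP, hPδ, fun W hW => ?_⟩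
  set d := δ ∘ₗ P.subtype
  have hdW : Function.Surjective (d ∘ₗ W.subtype) := fun x => by
    obtain ⟨y, rfl⟩ := hPδ x
    obtain ⟨a, ha, b, hb, rfl⟩ := Submodule.mem_sup.1 (hW ▸ Submodule.mem_top : y ∈ _ ⊔ W)
    exact ⟨⟨b, hb⟩, by simp [LinearMap.mem_ker.1 ha]⟩
  obtain ⟨s, hs⟩ := Module.projective_lifting_property (d ∘ₗ W.subtype) d hdW
  let u : Module.End R P := W.subtype ∘ₗ s
  have hu : ∀ n x, d ((u ^ n) x) = d x := fun n x => by
    induction n with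
    | zero => simp
    | succ n ih => rw [pow_succ', Module.End.mul_apply, ← ih]; exact LinearMap.congr_fun hs _
  obtain ⟨n, hn, hn'⟩ := (u.eventually_isCompl_ker_pow_range_pow.and
    (Filter.eventually_ge_atTop 1)).exists
  set Q := LinearMap.range (u ^ n)
  have hQ : Module.Projective R Q := .of_split Q.subtype (Q.projectionOnto _ hn.symm)
    (Submodule.projectionOnto_comp_subtype hn.symm)
  have hQP : Q.map P.subtype = P := by
    refine (Submodule.map_subtype_le _ _).eq_of_not_lt (hmin _ ⟨?_, fun x => ?_⟩)
    · exact .of_equiv (Submodule.equivSubtypeMap P Q)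
    · obtain ⟨y, rfl⟩ := hPδ x
      exact ⟨⟨_, Submodule.mem_map_of_mem (LinearMap.mem_range_self (u ^ n) y)⟩, hu n y⟩
  refine top_unique fun x _ => ?_
  obtain ⟨y, ⟨z, rfl⟩, hy⟩ := (hQP.symm ▸ x.2 : (x : F) ∈ Q.map P.subtype)
  obtain rfl : (u ^ n) z = x := Subtype.ext hy
  obtain ⟨m, rfl⟩ := Nat.exists_eq_add_of_le hn'
  rw [add_comm, pow_succ', Module.End.mul_apply]
  exact (s _).2

/-- A submodule of a finitely generated injective module over an artinian ring has an injective
hull. -/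
theorem exists_injective_hull {J C : Type*} [AddCommGroup J] [Module R J] [Module.Finite R J]
    (hJ : Module.Baer R J) [AddCommGroup C] [Module R C] (j : C →ₗ[R] J)
    (hj : Function.Injective j) :
    ∃ (P : Submodule R J) (c : C →ₗ[R] P), Module.Baer R P ∧ Function.Injective c ∧
      ∀ W : Submodule R P, Disjoint (LinearMap.range c) W → W = ⊥ := by
  obtain ⟨P, ⟨hP, hPj⟩, hmin⟩ := (wellFounded_lt (α := Submodule R J)).has_min
    {P | Module.Baer R P ∧ ∀ x, j x ∈ P}
    ⟨⊤, hJ.of_retract (⊤ : Submodule R J).subtype (Submodule.topEquiv.symm.toLinearMap) rfl,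
      fun _ => trivial⟩
  have hc : Function.Injective (j.codRestrict P hPj) := fun x y h => hj (congrArg Subtype.val h)
  refine ⟨P, j.codRestrict P hPj, hP, hc, fun W hW => ?_⟩
  set c := j.codRestrict P hPj
  obtain ⟨s, hs⟩ := hP.extension_property (W.mkQ ∘ₗ c) (by
    rw [← LinearMap.ker_eq_bot, LinearMap.ker_comp, Submodule.ker_mkQ, eq_bot_iff]
    intro x hx
    exact hc ((Submodule.disjoint_def.1 hW _ (LinearMap.mem_range_self c x) hx).trans
      (map_zero c).symm)) c
  let u : Module.End R P := s ∘ₗ W.mkQ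
  have hu : ∀ n x, (u ^ n) (c x) = c x := fun n x => by
    induction n with
    | zero => simp
    | succ n ih => rw [pow_succ', Module.End.mul_apply, ih]; exact LinearMap.congr_fun hs _
  obtain ⟨n, hn, hn'⟩ := (u.eventually_isCompl_ker_pow_range_pow.and
    (Filter.eventually_ge_atTop 1)).exists
  set Q := LinearMap.range (u ^ n)
  have hQ : Module.Baer R Q := hP.of_retract Q.subtype (Q.projectionOnto _ hn.symm)
    (Submodule.projectionOnto_comp_subtype hn.symm)
  have hQP : Q.map P.subtype = P := by
    refine (Submodule.map_subtype_le _ _).eq_of_not_lt (hmin _ ⟨?_, fun x => ?_⟩)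
    · exact hQ.of_equiv (Submodule.equivSubtypeMap P Q)
    · exact ⟨c x, ⟨c x, hu n x⟩, rfl⟩
  have hsurj : Function.Surjective u := fun x => by
    obtain ⟨y, ⟨z, rfl⟩, hy⟩ := (hQP.symm ▸ x.2 : (x : J) ∈ Q.map P.subtype)
    obtain rfl : (u ^ n) z = x := Subtype.ext hy
    obtain ⟨m, rfl⟩ := Nat.exists_eq_add_of_le hn'
    exact ⟨(u ^ m) z, by rw [add_comm, pow_succ', Module.End.mul_apply]⟩
  have hinj := IsNoetherian.injective_of_surjective_endomorphism u hsurj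
  refine (Submodule.eq_bot_iff _).2 fun x hx => hinj ?_
  simp [u, (Submodule.Quotient.mk_eq_zero W).2 hx]

end Covers

section Coinduced

variable (K R V : Type*) [Field K] [Ring R] [Algebra K R] [AddCommGroup V] [Module K V]

/-- The `R`-module coinduced from the `K`-module `V`. -/
def CoinducedModule := R →ₗ[K] V

namespace CoinducedModule

instance : AddCommGroup (CoinducedModule K R V) := inferInstanceAs (AddCommGroup (R →ₗ[K] V))

instance : Module K (CoinducedModule K R V) := inferInstanceAs (Module K (R →ₗ[K] V))

instance : Module R (CoinducedModule K R V) where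
  smul r (f : R →ₗ[K] V) := LinearMap.comp f (LinearMap.mulRight K r)
  one_smul (f : R →ₗ[K] V) := LinearMap.ext fun x => congrArg f (mul_one x)
  mul_smul r s (f : R →ₗ[K] V) := LinearMap.ext fun x => congrArg f (mul_assoc x r s).symm
  smul_zero _ := rfl
  smul_add _ _ _ := rfl
  add_smul r s (f : R →ₗ[K] V) := LinearMap.ext fun x =>
    (congrArg f (mul_add x r s)).trans (map_add f _ _)
  zero_smul (f : R →ₗ[K] V) := LinearMap.ext fun x => (congrArg f (mul_zero x)).trans (map_zero f)

variable {K R V}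

/-- Elements of the coinduced module as linear maps. -/
def toHom : CoinducedModule K R V ≃ₗ[K] (R →ₗ[K] V) := LinearEquiv.refl K _

theorem toHom_smul (r : R) (f : CoinducedModule K R V) (x : R) :
    toHom (r • f) x = toHom f (x * r) := rfl

instance : IsScalarTower K R (CoinducedModule K R V) where
  smul_assoc k r f := toHom.injective <| LinearMap.ext fun x => by
    rw [toHom_smul, mul_smul_comm, map_smul, map_smul, LinearMap.smul_apply, toHom_smul]

instance [Module.Finite K R] [Module.Finite K V] : Module.Finite K (CoinducedModule K R V) :=
  inferInstanceAs (Module.Finite K (R →ₗ[K] V))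

theorem baer : Module.Baer R (CoinducedModule K R V) := fun I g => by
  let ev : CoinducedModule K R V →ₗ[K] V := LinearMap.applyₗ' K (1 : R) ∘ₗ toHom.toLinearMap
  obtain ⟨G, hG⟩ := LinearMap.exists_extend (p := I.restrictScalars K) (ev ∘ₗ g.restrictScalars K)
  refine ⟨LinearMap.toSpanSingleton R (CoinducedModule K R V) (toHom.symm G), fun x hx =>
    toHom.injective <| LinearMap.ext fun r => ?_⟩
  have h1 : G (r * x) = toHom (g ⟨r * x, I.mul_mem_left r hx⟩) 1 :=
    LinearMap.congr_fun hG ⟨r * x, I.mul_mem_left r hx⟩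
  have h2 : g ⟨r * x, I.mul_mem_left r hx⟩ = r • g ⟨x, hx⟩ := g.map_smul r ⟨x, hx⟩
  rw [h2, toHom_smul, one_mul] at h1
  exact h1

variable (M : Type*) [AddCommGroup M] [Module R M] [Module K M] [IsScalarTower K R M]

/-- The embedding of a module into the coinduced module. -/
def embed : M →ₗ[R] CoinducedModule K R M where
  toFun m := toHom.symm ((LinearMap.toSpanSingleton R M m).restrictScalars K)
  map_add' _ _ := LinearMap.ext fun _ => smul_add _ _ _
  map_smul' r m := LinearMap.ext fun x => (mul_smul x r m).symm

theorem embed_injective : Function.Injective (embed (K := K) (R := R) M) := fun x y h => by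
  have : (1 : R) • x = (1 : R) • y := LinearMap.congr_fun h 1
  simpa using this

end CoinducedModule

end Coinduced

section Counting

variable {K R : Type*} [Field K] [Ring R] [Algebra K R]

instance Module.Finite.linearMap_of_algebra {X Y : Type*} [AddCommGroup X] [Module R X]
    [Module K X] [IsScalarTower K R X] [Module.Finite K X] [AddCommGroup Y] [Module R Y]
    [Module K Y] [IsScalarTower K R Y] [Module.Finite K Y] : Module.Finite K (X →ₗ[R] Y) :=
  .of_injective (LinearMap.restrictScalarsₗ K R X Y K) (LinearMap.restrictScalars_injective K)

theorem finrank_eq_add_of_exact {X Y Z : Type*} [AddCommGroup X] [Module K X] [AddCommGroup Y]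
    [Module K Y] [AddCommGroup Z] [Module K Z] [Module.Finite K Y] {f : X →ₗ[K] Y} {g : Y →ₗ[K] Z}
    (hf : Function.Injective f) (hg : Function.Surjective g) (hfg : Function.Exact f g) :
    Module.finrank K Y = Module.finrank K X + Module.finrank K Z := by
  rw [← g.finrank_range_add_finrank_ker, LinearMap.range_eq_top.2 hg, finrank_top,
    hfg.linearMap_ker_eq, LinearMap.finrank_range_of_inj hf, add_comm]

theorem CompositionSeries.apply_top_eq_sum {M : Type*} [AddCommGroup M] [Module R M]
    (s : CompositionSeries (Submodule R M)) (h₀ : s 0 = ⊥) (h₁ : s (Fin.last _) = ⊤)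
    (φ : Submodule R M → ℕ) (c : Fin s.length → ℕ) (hφ : φ ⊥ = 0)
    (h : ∀ i : Fin s.length, φ (s i.succ) = φ (s i.castSucc) + c i) : φ ⊤ = ∑ i, c i := by
  have key : ∀ (n : ℕ) (t : Fin (n + 1) → Submodule R M) (c : Fin n → ℕ), φ (t 0) = 0 →
      (∀ i : Fin n, φ (t i.succ) = φ (t i.castSucc) + c i) → φ (t (Fin.last n)) = ∑ i, c i := by
    intro n t c h0 h
    induction n with
    | zero => simpa using h0
    | succ n ih =>
      rw [Fin.sum_univ_castSucc, ← ih (fun i => t i.castSucc) (fun i => c i.castSucc) h0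
        fun i => h i.castSucc]
      exact h (Fin.last n)
  rw [← h₁]
  exact key _ s c (by rw [h₀, hφ]) h

/-- The short exact sequence of a step of a composition series. -/
theorem CompositionSeries.exact_step {M : Type*} [AddCommGroup M] [Module R M]
    (s : CompositionSeries (Submodule R M)) (i : Fin s.length) :
    Function.Exact (Submodule.inclusion (s.strictMono.monotone (Fin.castSucc_le_succ i)))
      (Submodule.comap (s i.succ).subtype (s i.castSucc)).mkQ := fun x => by
  simp only [Submodule.mkQ_apply, Submodule.Quotient.mk_eq_zero, Submodule.mem_comap,
    Submodule.subtype_apply, Set.mem_range]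
  exact ⟨fun h => ⟨⟨x, h⟩, rfl⟩, fun ⟨y, hy⟩ => hy ▸ y.2⟩

instance Submodule.finite_of_algebra {M : Type*} [AddCommGroup M] [Module R M] [Module K M]
    [IsScalarTower K R M] [Module.Finite K M] (p : Submodule R M) : Module.Finite K p :=
  .of_injective (p.subtype.restrictScalars K) p.subtype_injective

theorem finrank_hom_congr_right (K : Type*) {M N : Type*} (P : Type*) [Field K] [Algebra K R]
    [AddCommGroup M] [Module R M] [Module K M] [IsScalarTower K R M] [AddCommGroup N] [Module R N]
    [Module K N] [IsScalarTower K R N] [AddCommGroup P] [Module R P] (e : M ≃ₗ[R] N) :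
    Module.finrank K (P →ₗ[R] M) = Module.finrank K (P →ₗ[R] N) :=
  LinearEquiv.finrank_eq (LinearEquiv.ofBijective (LinearMap.compRight K e.toLinearMap)
    ⟨fun _ _ h => LinearMap.ext fun x => e.injective (LinearMap.congr_fun h x),
      fun f => ⟨e.symm.toLinearMap ∘ₗ f, LinearMap.ext fun x => e.apply_symm_apply (f x)⟩⟩)

theorem finrank_hom_congr_left (K : Type*) {M N : Type*} (P : Type*) [Field K] [Algebra K R]
    [AddCommGroup M] [Module R M] [AddCommGroup N] [Module R N] [AddCommGroup P] [Module R P]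
    [Module K P] [IsScalarTower K R P] (e : M ≃ₗ[R] N) :
    Module.finrank K (M →ₗ[R] P) = Module.finrank K (N →ₗ[R] P) :=
  LinearEquiv.finrank_eq (LinearEquiv.ofBijective (LinearMap.lcomp K P e.symm.toLinearMap)
    ⟨fun _ _ h => LinearMap.ext fun x => by simpa using LinearMap.congr_fun h (e x),
      fun f => ⟨f ∘ₗ e.toLinearMap, LinearMap.ext fun x => congrArg f (e.apply_symm_apply x)⟩⟩)

variable {M N : Type*} [AddCommGroup M] [Module R M] [Module K M] [IsScalarTower K R M]
  [Module.Finite K M] [AddCommGroup N] [Module R N] [Module K N] [IsScalarTower K R N]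
  [Module.Finite K N]

section Projective

variable {P : Type*} [AddCommGroup P] [Module R P] [Module K P] [IsScalarTower K R P]
  [Module.Finite K P]

theorem finrank_hom_eq_sum_of_projective [Module.Projective R P]
    (s : CompositionSeries (Submodule R M)) (h₀ : s 0 = ⊥) (h₁ : s (Fin.last _) = ⊤) :
    Module.finrank K (P →ₗ[R] M) = ∑ i, Module.finrank K (P →ₗ[R] csFactor s i) := by
  rw [← finrank_hom_congr_right K P (Submodule.topEquiv (R := R) (M := M))]
  refine s.apply_top_eq_sum h₀ h₁ (fun p => Module.finrank K (P →ₗ[R] p)) _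
    Module.finrank_zero_of_subsingleton fun i => ?_
  refine finrank_eq_add_of_exact (f := LinearMap.compRight K (Submodule.inclusion
    (s.strictMono.monotone (Fin.castSucc_le_succ i)))) (g := LinearMap.compRight K
      (Submodule.comap (s i.succ).subtype (s i.castSucc)).mkQ) (fun f g h => ?_) (fun f => ?_)
      fun f => ⟨fun h => ?_, ?_⟩
  · exact LinearMap.ext fun x => Submodule.inclusion_injective
      (s.strictMono.monotone (Fin.castSucc_le_succ i)) (LinearMap.congr_fun h x)
  · exact Module.projective_lifting_property _ f (Submodule.mkQ_surjective _)
  · have h' : ∀ x, (f x : M) ∈ s i.castSucc := fun x => by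
      obtain ⟨y, hy⟩ := (s.exact_step i (f x)).1 (LinearMap.congr_fun h x)
      exact hy ▸ y.2
    exact ⟨((s i.succ).subtype ∘ₗ f).codRestrict _ h', rfl⟩
  · rintro ⟨g, rfl⟩
    exact LinearMap.ext fun x => (s.exact_step i).apply_apply_eq_zero (g x)

theorem finrank_hom_eq_sum_of_baer (hP : Module.Baer R P)
    (s : CompositionSeries (Submodule R M)) (h₀ : s 0 = ⊥) (h₁ : s (Fin.last _) = ⊤) :
    Module.finrank K (M →ₗ[R] P) = ∑ i, Module.finrank K (csFactor s i →ₗ[R] P) := by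
  rw [← finrank_hom_congr_left K P (Submodule.topEquiv (R := R) (M := M))]
  refine s.apply_top_eq_sum h₀ h₁ (fun p => Module.finrank K (p →ₗ[R] P)) _
    Module.finrank_zero_of_subsingleton fun i => ?_
  rw [add_comm]
  refine finrank_eq_add_of_exact (g := LinearMap.lcomp K P (Submodule.inclusion
    (s.strictMono.monotone (Fin.castSucc_le_succ i)))) (f := LinearMap.lcomp K P
      (Submodule.comap (s i.succ).subtype (s i.castSucc)).mkQ) (fun f g h => ?_) (fun f => ?_)
      fun f => ⟨fun h => ?_, ?_⟩
  · exact LinearMap.ext fun x => by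
      obtain ⟨x, rfl⟩ := Submodule.mkQ_surjective _ x
      exact LinearMap.congr_fun h x
  · exact hP.extension_property _ (Submodule.inclusion_injective _) f
  · refine ⟨Submodule.liftQ _ f fun x hx => ?_, rfl⟩
    exact LinearMap.congr_fun h ⟨x, hx⟩
  · rintro ⟨g, rfl⟩
    exact LinearMap.ext fun x =>
      (congrArg g ((s.exact_step i).apply_apply_eq_zero x)).trans (map_zero g)

variable (K) in
theorem SameCompositionFactors.finrank_hom_eq_of_projective (h : SameCompositionFactors R M N)
    [Module.Projective R P] :
    Module.finrank K (P →ₗ[R] M) = Module.finrank K (P →ₗ[R] N) := by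
  obtain ⟨s, t, hs₀, hs₁, ht₀, ht₁, σ, hσ⟩ := h
  rw [finrank_hom_eq_sum_of_projective s hs₀ hs₁, finrank_hom_eq_sum_of_projective t ht₀ ht₁]
  exact Fintype.sum_equiv σ _ _ fun i => finrank_hom_congr_right K P (hσ i).some

variable (K) in
theorem SameCompositionFactors.finrank_hom_eq_of_baer (h : SameCompositionFactors R M N)
    (hP : Module.Baer R P) :
    Module.finrank K (M →ₗ[R] P) = Module.finrank K (N →ₗ[R] P) := by
  obtain ⟨s, t, hs₀, hs₁, ht₀, ht₁, σ, hσ⟩ := h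
  rw [finrank_hom_eq_sum_of_baer hP s hs₀ hs₁, finrank_hom_eq_sum_of_baer hP t ht₀ ht₁]
  exact Fintype.sum_equiv σ _ _ fun i => finrank_hom_congr_left K P (hσ i).some

end Projective

/-- A linear map that is surjective but not injective forces every linear map between spaces of the
same dimensions to be non-injective. -/
theorem exists_ne_zero_apply_eq_zero {X Y X' Y' : Type*} [AddCommGroup X] [Module K X]
    [AddCommGroup Y] [Module K Y] [AddCommGroup X'] [Module K X'] [AddCommGroup Y'] [Module K Y']
    [Module.Finite K X] [Module.Finite K Y'] (hX : Module.finrank K X = Module.finrank K X')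
    (hY : Module.finrank K Y = Module.finrank K Y') (T : X →ₗ[K] Y) (T' : X' →ₗ[K] Y')
    (hT : Function.Surjective T) {x : X} (hx : x ≠ 0) (hTx : T x = 0) :
    ∃ x', x' ≠ 0 ∧ T' x' = 0 := by
  by_contra! h
  have hinj : Function.Injective T' :=
    (injective_iff_map_eq_zero T').2 fun y hy => by_contra fun h' => h y h' hy
  have h1 := LinearMap.finrank_le_finrank_of_injective hinj
  have h2 := T.finrank_range_add_finrank_ker
  rw [LinearMap.range_eq_top.2 hT, finrank_top] at h2
  have h3 : Nontrivial (LinearMap.ker T) := ⟨⟨x, hTx⟩, 0, fun h => hx (congrArg Subtype.val h)⟩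
  have := Module.finrank_pos (R := K) (M := LinearMap.ker T)
  omega

end Counting

section NoShortCycle

variable {R : Type u} [Ring R] {M : Type v} [AddCommGroup M] [Module R M]

theorem avoidsShortCycles_of_not_liesOnShortCycle.{w} (K : Type*) [Field K] [Algebra K R]
    [Module.Finite K R] [Nontrivial M] (hM : ¬LiesOnShortCycle R M) :
    AvoidsShortCycles.{w} R M := by
  intro Y _ _ _ hY f g hf hg hf'
  by_contra hg'
  let := Module.compHom M (algebraMap K R)
  let := Module.compHom Y (algebraMap K R)
  have : IsScalarTower K R Y := .of_algebraMap_smul fun _ _ => rfl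
  have : Module.Finite K Y := .trans R Y
  obtain ⟨m, hm⟩ := exists_ne (0 : M)
  have : Small.{v} K := small_of_injective (smul_left_injective K hm)
  have : Small.{v} Y := small_of_injective (Module.finBasis K Y).equivFun.injective
  let e := Shrink.linearEquiv.{v} R Y
  refine hM ⟨ModuleCat.of R (Shrink.{v} Y), .equiv e.symm, hY.of_equiv e.symm,
    e.symm.toLinearMap ∘ₗ f, g ∘ₗ e.toLinearMap, fun h => hf ?_, fun h => hg ?_, fun h => hf' ?_,
    fun h => hg' ?_⟩
  · exact LinearMap.ext fun x => e.symm.injective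
      ((LinearMap.congr_fun h x).trans (map_zero e.symm).symm)
  · exact LinearMap.ext fun x => by simpa using LinearMap.congr_fun h (e.symm x)
  · exact (Function.Bijective.of_comp_iff' e.symm.bijective f).1 h
  · exact (Function.Bijective.of_comp_iff g e.bijective).1 h

theorem AvoidsShortCycles.exists_hom_ne_zero (K : Type*) {N : Type*} [Field K] [Algebra K R]
    [Module.Finite K R] [Nontrivial M] [AddCommGroup N] [Module R N] [Module K M]
    [IsScalarTower K R M] [Module.Finite K M] [Module K N] [IsScalarTower K R N] [Module.Finite K N]
    (hM : AvoidsShortCycles.{max u v} R M) (h : SameCompositionFactors R M N) :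
    ∃ f : M →ₗ[R] N, f ≠ 0 := by
  have : IsArtinianRing R := .of_finite K R
  have : Module.Finite R M := .of_restrictScalars_finite K R M
  obtain ⟨n, q, hq⟩ := Module.Finite.exists_fin' R M
  let Ω := LinearMap.ker q
  obtain ⟨m, δ, hδ⟩ := Module.Finite.exists_fin' R Ω
  obtain ⟨P, hP, hd, hsup⟩ := exists_projective_cover δ hδ
  set d := δ ∘ₗ P.subtype
  have hT : Function.Surjective (LinearMap.lcomp K M (Ω.subtype ∘ₗ d)) := fun k => by
    let U := (LinearMap.ker d).map k
    obtain ⟨ψ, hψ⟩ : ∃ ψ : Ω →ₗ[R] M ⧸ U, ψ ∘ₗ d = U.mkQ ∘ₗ k := by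
      refine ⟨(LinearMap.ker d).mapQ U k (Submodule.le_comap_map _ _) ∘ₗ
        (d.quotKerEquivOfSurjective hd).symm.toLinearMap, LinearMap.ext fun x => ?_⟩
      have : (d.quotKerEquivOfSurjective hd).symm (d x) = Submodule.Quotient.mk x := by
        rw [LinearEquiv.symm_apply_eq]
        rfl
      simp [this]
    obtain ⟨Ψ, hΨ⟩ := hM.exists_extend U.mkQ U.mkQ_surjective q hq ψ
    obtain ⟨l, hl⟩ := Module.projective_lifting_property U.mkQ Ψ U.mkQ_surjective
    let k' := k - l ∘ₗ Ω.subtype ∘ₗ d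
    have hk' : ∀ x, k' x ∈ U := fun x => by
      have h1 : U.mkQ (l (d x)) = Ψ (d x) := LinearMap.congr_fun hl _
      have h2 : Ψ (d x) = ψ (d x) := LinearMap.congr_fun hΨ _
      have h3 : ψ (d x) = U.mkQ (k x) := LinearMap.congr_fun hψ x
      rw [← U.ker_mkQ, LinearMap.mem_ker]
      simp only [k', LinearMap.sub_apply, map_sub, LinearMap.comp_apply, Submodule.subtype_apply]
      rw [h1, h2, h3, sub_self]
    have hker := hsup (LinearMap.ker k') (top_unique fun x _ => by
      obtain ⟨y, hy, hxy⟩ := hk' x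
      have hy' : d y = 0 := hy
      refine Submodule.mem_sup.2 ⟨y, hy, x - y, ?_, add_sub_cancel y x⟩
      rw [LinearMap.mem_ker, map_sub, sub_eq_zero, ← hxy]
      simp [k', hy'])
    exact ⟨l, (sub_eq_zero.1 (LinearMap.ker_eq_top.1 hker)).symm⟩
  obtain ⟨φ, hφ, hφ0⟩ := exists_ne_zero_apply_eq_zero (h.finrank_hom_eq_of_projective K)
    (h.finrank_hom_eq_of_projective K) _ (LinearMap.lcomp K N (Ω.subtype ∘ₗ d)) hT (x := q)
    (fun h0 => by
      obtain ⟨m, hm⟩ := exists_ne (0 : M)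
      obtain ⟨x, rfl⟩ := hq m
      exact hm (LinearMap.congr_fun h0 x))
    (LinearMap.ext fun x => (d x).2)
  have hker : ∀ x ∈ Ω, φ x = 0 := fun x hx => by
    obtain ⟨y, hy⟩ := hd ⟨x, hx⟩
    have : φ (d y) = 0 := LinearMap.congr_fun hφ0 y
    rwa [hy] at this
  refine ⟨Ω.liftQ φ hker ∘ₗ (q.quotKerEquivOfSurjective hq).symm.toLinearMap, fun h0 => hφ ?_⟩
  refine LinearMap.ext fun x => ?_
  exact (congrArg (Ω.liftQ φ hker) ((q.quotKerEquivOfSurjective hq).symm_apply_apply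
    (Submodule.Quotient.mk x))).symm.trans (LinearMap.congr_fun h0 (q x))

/-- For an injective copresentation `M → J → P`, with `P` an essential extension of the cokernel of
`M → J`, every map from `M` to `P` factors through `J`. -/
theorem AvoidsShortCycles.exists_comp_eq.{w} [IsArtinianRing R] [Module.Finite R M] {J : Type w}
    {P : Type*} [AddCommGroup J] [Module R J] [Module.Finite R J] [AddCommGroup P] [Module R P]
    (hM : AvoidsShortCycles.{max v w} R M) (hJ : Module.Baer R J) (j : M →ₗ[R] J)
    (hj : Function.Injective j) (c : J ⧸ LinearMap.range j →ₗ[R] P) (hc : Function.Injective c)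
    (hess : ∀ W : Submodule R P, Disjoint (LinearMap.range c) W → W = ⊥) (k : M →ₗ[R] P) :
    ∃ l : M →ₗ[R] J, (c ∘ₗ (LinearMap.range j).mkQ) ∘ₗ l = k := by
  let e := c ∘ₗ (LinearMap.range j).mkQ
  let V := (LinearMap.range c).comap k
  let t : V →ₗ[R] J ⧸ LinearMap.range j := (LinearEquiv.ofInjective c hc).symm.toLinearMap ∘ₗ
    (k ∘ₗ V.subtype).codRestrict (LinearMap.range c) Subtype.property
  have ht : ∀ x, c (t x) = k x := fun x =>
    congrArg Subtype.val ((LinearEquiv.ofInjective c hc).apply_symm_apply ⟨k x, x.2⟩)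
  obtain ⟨H, hH⟩ := hM.exists_lift V.subtype V.subtype_injective j hj t
  obtain ⟨l, hl⟩ := hJ.extension_property V.subtype V.subtype_injective H
  let k' := k - e ∘ₗ l
  have hk' : ∀ x ∈ V, k' x = 0 := fun x hx => by
    have h1 : l x = H ⟨x, hx⟩ := LinearMap.congr_fun hl ⟨x, hx⟩
    have h2 : (LinearMap.range j).mkQ (H ⟨x, hx⟩) = t ⟨x, hx⟩ := LinearMap.congr_fun hH ⟨x, hx⟩
    have h3 := ht ⟨x, hx⟩
    simp only [k', e, LinearMap.sub_apply, LinearMap.comp_apply]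
    rw [h1, h2, h3, sub_self]
  have hrange := hess (LinearMap.range k') (Submodule.disjoint_def.2 fun x hx ⟨y, hy⟩ => by
    rw [← hy]
    apply hk'
    rw [← hy] at hx
    have : k y = k' y + e (l y) := by simp [k']
    exact Submodule.mem_comap.2 (this ▸ add_mem hx (LinearMap.mem_range_self c _)))
  exact ⟨l, (sub_eq_zero.1 (LinearMap.range_eq_bot.1 hrange)).symm⟩

theorem AvoidsShortCycles.exists_hom_ne_zero_of_embedding.{w} (K : Type*) {N : Type*} [Field K]
    [Algebra K R] [Module.Finite K R] [Nontrivial M] [AddCommGroup N] [Module R N] [Module K M]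
    [IsScalarTower K R M] [Module.Finite K M] [Module K N] [IsScalarTower K R N] [Module.Finite K N]
    {J : Type w} [AddCommGroup J] [Module R J] [Module K J] [IsScalarTower K R J]
    [Module.Finite K J] (hM : AvoidsShortCycles.{max v w} R M) (h : SameCompositionFactors R M N)
    (hJ : Module.Baer R J) (j : M →ₗ[R] J) (hj : Function.Injective j) :
    ∃ f : N →ₗ[R] M, f ≠ 0 := by
  have : IsArtinianRing R := .of_finite K R
  have : Module.Finite R J := .of_restrictScalars_finite K R J
  have : Module.Finite R M := .of_restrictScalars_finite K R M
  have : Module.Finite R (CoinducedModule K R (J ⧸ LinearMap.range j)) :=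
    .of_restrictScalars_finite K R _
  obtain ⟨P, c, hP, hc, hess⟩ := exists_injective_hull
    (CoinducedModule.baer (K := K) (R := R) (V := J ⧸ LinearMap.range j))
    (CoinducedModule.embed (K := K) (R := R) (J ⧸ LinearMap.range j))
    (CoinducedModule.embed_injective _)
  let e := c ∘ₗ (LinearMap.range j).mkQ
  have he : ∀ x, e x = 0 ↔ x ∈ LinearMap.range j := fun x => by
    rw [← Submodule.Quotient.mk_eq_zero, ← map_eq_zero_iff c hc]
    rfl
  have hT : Function.Surjective (LinearMap.compRight K (M := M) e) :=
    hM.exists_comp_eq hJ j hj c hc hess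
  obtain ⟨φ, hφ, hφ0⟩ := exists_ne_zero_apply_eq_zero
    (h.finrank_hom_eq_of_baer K hJ) (h.finrank_hom_eq_of_baer K hP) _
    (LinearMap.compRight K (M := N) e) hT (x := j)
    (fun h0 => by
      obtain ⟨m, hm⟩ := exists_ne (0 : M)
      exact hm (hj ((LinearMap.congr_fun h0 m).trans (map_zero j).symm)))
    (LinearMap.ext fun x => (he _).2 (LinearMap.mem_range_self j x))
  have hmem : ∀ x, φ x ∈ LinearMap.range j := fun x => (he _).1 (LinearMap.congr_fun hφ0 x)
  refine ⟨(LinearEquiv.ofInjective j hj).symm.toLinearMap ∘ₗ φ.codRestrict _ hmem, fun h0 => hφ ?_⟩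
  refine LinearMap.ext fun x => ?_
  exact congrArg Subtype.val ((LinearEquiv.ofInjective j hj).symm.map_eq_zero_iff.1
    (LinearMap.congr_fun h0 x))

theorem AvoidsShortCycles.exists_hom_ne_zero' (K : Type*) {N : Type*} [Field K] [Algebra K R]
    [Module.Finite K R] [Nontrivial M] [AddCommGroup N] [Module R N] [Module K M]
    [IsScalarTower K R M] [Module.Finite K M] [Module K N] [IsScalarTower K R N] [Module.Finite K N]
    (hM : AvoidsShortCycles.{max u v} R M) (h : SameCompositionFactors R M N) :
    ∃ f : N →ₗ[R] M, f ≠ 0 :=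
  hM.exists_hom_ne_zero_of_embedding K h CoinducedModule.baer (CoinducedModule.embed (K := K) M)
    (CoinducedModule.embed_injective M)

end NoShortCycle

/-- Let `A` be a finite-dimensional algebra over a field `K` and `M` an
indecomposable finite-dimensional right `A`-module not lying on a short cycle.  If `N` is
an indecomposable finite-dimensional right `A`-module with the same class as `M` in
`K₀(A)` (the same composition factors with multiplicities), then `N ≅ M`. -/
theorem module_determined_by_composition_factors_of_no_short_cycle
    {K A : Type*} [Field K] [Ring A] [Algebra K A] [FiniteDimensional K A]
    (M : Type v) [AddCommGroup M] [Module Aᵐᵒᵖ M] [Module.Finite Aᵐᵒᵖ M]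
    (N : Type v) [AddCommGroup N] [Module Aᵐᵒᵖ N] [Module.Finite Aᵐᵒᵖ N]
    (hM : IsIndecomposable Aᵐᵒᵖ M) (hN : IsIndecomposable Aᵐᵒᵖ N)
    (hcycle : ¬LiesOnShortCycle Aᵐᵒᵖ M)
    (hK0 : SameCompositionFactors Aᵐᵒᵖ M N) :
    Nonempty (N ≃ₗ[Aᵐᵒᵖ] M) := by
  let := Module.compHom M (algebraMap K Aᵐᵒᵖ)
  let := Module.compHom N (algebraMap K Aᵐᵒᵖ)
  have : IsScalarTower K Aᵐᵒᵖ M := .of_algebraMap_smul fun _ _ => rfl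
  have : IsScalarTower K Aᵐᵒᵖ N := .of_algebraMap_smul fun _ _ => rfl
  have : Module.Finite K M := .trans Aᵐᵒᵖ M
  have : Module.Finite K N := .trans Aᵐᵒᵖ N
  have := hM.1
  have hM' := avoidsShortCycles_of_not_liesOnShortCycle K hcycle
  obtain ⟨f, hf⟩ := hM'.exists_hom_ne_zero K hK0
  obtain ⟨g, hg⟩ := hM'.exists_hom_ne_zero' K hK0
  by_contra hne
  exact hcycle ⟨ModuleCat.of Aᵐᵒᵖ N, ‹_›, hN, f, g, hf, hg,
    fun h => hne ⟨(LinearEquiv.ofBijective f h).symm⟩, fun h => hne ⟨LinearEquiv.ofBijective g h⟩⟩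
end

section
/- Let A be a finite-dimensional algebra over a field K whose module category mod A admits no short cycles. Then A is of finite representation type. -/
section

universe u v w

/-- No indecomposable finite `R`-module lies on a short cycle. -/
def NoShortCycles (R : Type u) [Ring R] : Prop :=
  ∀ (M : Type v) [AddCommGroup M] [Module R M],
    Module.Finite R M → IsIndecomposable R M → ¬LiesOnShortCycle R M

/-- Every map from `X` lifts along every surjection with kernel isomorphic to `N`; that is,
`Ext¹(X, N) = 0`. -/
def ExtOneVanishes (R : Type u) [Ring R] (X N : Type v) [AddCommGroup X] [Module R X]
    [AddCommGroup N] [Module R N] : Prop :=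
  ∀ (E E' : Type v) [AddCommGroup E] [AddCommGroup E'] [Module R E] [Module R E']
    (i : N →ₗ[R] E) (p : E →ₗ[R] E'), Function.Injective i → Function.Surjective p →
    Function.Exact i p → ∀ f : X →ₗ[R] E', ∃ g : X →ₗ[R] E, p ∘ₗ g = f

section Factor

variable {R : Type*} [Ring R] {X Y Z : Type*} [AddCommGroup X] [AddCommGroup Y] [AddCommGroup Z]
  [Module R X] [Module R Y] [Module R Z]

theorem LinearMap.exists_comp_eq_of_surjective {p : X →ₗ[R] Y} (hp : Function.Surjective p)
    (g : X →ₗ[R] Z) (h : ∀ x, p x = 0 → g x = 0) : ∃ g' : Y →ₗ[R] Z, g' ∘ₗ p = g := by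
  refine ⟨(LinearMap.ker p).liftQ g (fun x hx => h x hx) ∘ₗ
    (p.quotKerEquivOfSurjective hp).symm.toLinearMap, ?_⟩
  ext x
  have : (p.quotKerEquivOfSurjective hp).symm (p x) = Submodule.Quotient.mk x := by
    rw [LinearEquiv.symm_apply_eq]; rfl
  simp only [LinearMap.comp_apply, LinearEquiv.coe_coe, this]
  exact Submodule.liftQ_apply _ _ _

theorem LinearMap.exists_comp_eq_of_injective {i : Y →ₗ[R] Z} (hi : Function.Injective i)
    (g : X →ₗ[R] Z) (h : ∀ x, ∃ y, i y = g x) : ∃ g' : X →ₗ[R] Y, i ∘ₗ g' = g :=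
  ⟨(LinearEquiv.ofInjective i hi).symm.toLinearMap ∘ₗ
    g.codRestrict (LinearMap.range i) (fun x => h x), by
    ext x
    have := (LinearEquiv.ofInjective i hi).apply_symm_apply
      (g.codRestrict (LinearMap.range i) (fun x => h x) x)
    exact congrArg Subtype.val this⟩

end Factor

section Ext

variable {R : Type u} [Ring R] {X N : Type v} [AddCommGroup X] [Module R X]
    [AddCommGroup N] [Module R N]

theorem ExtOneVanishes.of_splits
    (h : ∀ (E : Type v) [AddCommGroup E] [Module R E] (i : N →ₗ[R] E) (p : E →ₗ[R] X),
      Function.Injective i → Function.Surjective p → Function.Exact i p →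
      ∃ s : X →ₗ[R] E, p ∘ₗ s = LinearMap.id) : ExtOneVanishes R X N := by
  intro E E' _ _ _ _ i p hi hp hip f
  let W : Submodule R (E × X) :=
    LinearMap.eqLocus (p ∘ₗ LinearMap.fst R E X) (f ∘ₗ LinearMap.snd R E X)
  let j : N →ₗ[R] W := (LinearMap.codRestrict W (LinearMap.inl R E X ∘ₗ i) (fun n => by
    change p (i n) = f 0
    rw [hip.apply_apply_eq_zero, map_zero]))
  let q : W →ₗ[R] X := LinearMap.snd R E X ∘ₗ W.subtype
  obtain ⟨s, hs⟩ := h W j q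
    (fun a b hab => hi (by simpa [j, Subtype.ext_iff] using hab))
    (fun x => by
      obtain ⟨e, he⟩ := hp (f x)
      exact ⟨⟨(e, x), by simpa [W, LinearMap.mem_eqLocus] using he⟩, rfl⟩)
    (by
      rintro ⟨⟨e, x⟩, hw⟩
      constructor
      · intro hx
        have hx : x = 0 := hx
        subst hx
        have hw : p e = f 0 := hw
        rw [map_zero] at hw
        obtain ⟨n, rfl⟩ := (hip e).1 hw
        exact ⟨n, rfl⟩
      · rintro ⟨n, hn⟩
        have := congrArg (fun t : W => t.1.2) hn
        exact this.symm)
  refine ⟨LinearMap.fst R E X ∘ₗ W.subtype ∘ₗ s, ?_⟩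
  ext x
  have h1 : p (s x).1.1 = f (s x).1.2 := (s x).2
  have h2 : (s x).1.2 = x := LinearMap.congr_fun hs x
  simp [h1, h2]

theorem ExtOneVanishes.exists_extension (h : ExtOneVanishes R X N) {Ω P : Type v}
    [AddCommGroup Ω] [Module R Ω] [AddCommGroup P] [Module R P] {j : Ω →ₗ[R] P} {π : P →ₗ[R] X}
    (hj : Function.Injective j) (hπ : Function.Surjective π) (hjπ : Function.Exact j π)
    (ψ : Ω →ₗ[R] N) : ∃ ψ' : P →ₗ[R] N, ψ' ∘ₗ j = ψ := by
  let D : Submodule R (N × P) := LinearMap.range (LinearMap.prod ψ (-j))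
  let i : N →ₗ[R] (N × P) ⧸ D := D.mkQ ∘ₗ LinearMap.inl R N P
  let k : P →ₗ[R] (N × P) ⧸ D := D.mkQ ∘ₗ LinearMap.inr R N P
  let p : (N × P) ⧸ D →ₗ[R] X := D.liftQ (π ∘ₗ LinearMap.snd R N P) (by
    rintro _ ⟨o, rfl⟩
    simp [hjπ.apply_apply_eq_zero])
  have hkj : ∀ o, k (j o) = i (ψ o) := by
    intro o
    have : (LinearMap.inl R N P (ψ o)) - (LinearMap.inr R N P (j o)) ∈ D := ⟨o, by simp⟩
    exact ((Submodule.Quotient.eq D).2 this).symm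
  have hi : Function.Injective i := by
    rw [injective_iff_map_eq_zero]
    intro n hn
    obtain ⟨o, ho⟩ := (Submodule.Quotient.mk_eq_zero D).1 hn
    have h2 : j o = 0 := by simpa using congrArg Prod.snd ho
    have h1 : ψ o = n := by simpa using congrArg Prod.fst ho
    rw [← h1, (map_eq_zero_iff j hj).1 h2, map_zero]
  have hip : Function.Exact i p := by
    intro e
    obtain ⟨⟨n, x⟩, rfl⟩ := D.mkQ_surjective e
    constructor
    · intro hx
      have hx : π x = 0 := hx
      obtain ⟨o, rfl⟩ := (hjπ x).1 hx
      refine ⟨n + ψ o, ?_⟩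
      rw [map_add, ← hkj]
      simp only [i, k, LinearMap.comp_apply, ← map_add]
      simp
    · rintro ⟨n', hn'⟩
      rw [← hn']
      simp [p, i]
  obtain ⟨s, hs⟩ := h _ _ i p hi (fun x => by
    obtain ⟨y, rfl⟩ := hπ x
    exact ⟨k y, by simp [p, k]⟩) hip LinearMap.id
  have hpk : ∀ x, p (k x) = π x := fun x => by simp [p, k]
  obtain ⟨θ, hθ⟩ := LinearMap.exists_comp_eq_of_injective hi (k - s ∘ₗ π) (fun x => by
    apply (hip _).1
    have := LinearMap.congr_fun hs (π x)
    simp only [LinearMap.comp_apply, LinearMap.id_apply] at this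
    simp [hpk, this])
  refine ⟨θ, ?_⟩
  ext o
  apply hi
  have := LinearMap.congr_fun hθ (j o)
  simp only [LinearMap.comp_apply, LinearMap.sub_apply, hkj, hjπ.apply_apply_eq_zero,
    map_zero, sub_zero] at this
  simpa using this

theorem ExtOneVanishes.of_linearEquiv (h : ExtOneVanishes R X N) {Y : Type v} [AddCommGroup Y]
    [Module R Y] (e : X ≃ₗ[R] Y) : ExtOneVanishes R Y N := by
  intro E E' _ _ _ _ i π hi hπ hiπ f
  obtain ⟨g, hg⟩ := h E E' i π hi hπ hiπ (f ∘ₗ e.toLinearMap)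
  refine ⟨g ∘ₗ e.symm.toLinearMap, ?_⟩
  rw [← LinearMap.comp_assoc, hg]
  ext x
  simp

theorem ExtOneVanishes.of_isCompl {p q : Submodule R X} (hpq : IsCompl p q)
    (hp : ExtOneVanishes R p N) (hq : ExtOneVanishes R q N) : ExtOneVanishes R X N := by
  intro E E' _ _ _ _ i π hi hπ hiπ f
  obtain ⟨g, hg⟩ := hp E E' i π hi hπ hiπ (f ∘ₗ p.subtype)
  obtain ⟨h, hh⟩ := hq E E' i π hi hπ hiπ (f ∘ₗ q.subtype)
  refine ⟨LinearMap.ofIsCompl hpq g h, ?_⟩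
  symm
  rw [← LinearMap.ofIsCompl_eq hpq (φ := f ∘ₗ p.subtype) (ψ := f ∘ₗ q.subtype) (χ := f)
    (fun _ => rfl) (fun _ => rfl)]
  apply LinearMap.ofIsCompl_eq
  · intro u; simp [← hg]
  · intro u; simp [← hh]

end Ext

section ShortCycles

variable {R : Type u} [Ring R]

theorem IsIndecomposable.bijective_of_comp_eq_id {X E : Type*} [AddCommGroup X] [Module R X]
    [AddCommGroup E] [Module R E] [Nontrivial E] (hX : IsIndecomposable R X)
    {a : E →ₗ[R] X} {b : X →ₗ[R] E} (h : b ∘ₗ a = LinearMap.id) : Function.Bijective a := by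
  have hba : ∀ x, b (a x) = x := LinearMap.congr_fun h
  have hinj : Function.Injective a := Function.LeftInverse.injective hba
  have hc : IsCompl (LinearMap.range a) (LinearMap.ker b) := by
    constructor
    · rw [Submodule.disjoint_def]
      rintro _ ⟨x, rfl⟩ hx
      rw [LinearMap.mem_ker, hba] at hx
      rw [hx, map_zero]
    · rw [codisjoint_iff, eq_top_iff]
      intro x _
      refine Submodule.mem_sup.2 ⟨a (b x), ⟨_, rfl⟩, x - a (b x), ?_, by abel⟩
      rw [LinearMap.mem_ker, map_sub, hba, sub_self]
  refine ⟨hinj, ?_⟩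
  rcases hX.2 _ _ hc with h0 | h0
  · exfalso
    obtain ⟨x, hx⟩ := exists_ne (0 : E)
    apply hx
    apply hinj
    rw [map_zero]
    have : a x ∈ LinearMap.range a := ⟨x, rfl⟩
    rw [h0] at this
    exact this
  · rw [← LinearMap.range_eq_top]
    have := hc.sup_eq_top
    rwa [h0, sup_bot_eq] at this

theorem exists_indecomposable_summand_of_ne_zero {E M : Type*} [AddCommGroup E] [Module R E]
    [AddCommGroup M] [Module R M] [IsArtinian R E] {h : E →ₗ[R] M} (hh : h ≠ 0) :
    ∃ p q : Submodule R E, IsCompl p q ∧ IsIndecomposable R p ∧ h ∘ₗ p.subtype ≠ 0 := by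
  obtain ⟨p, ⟨⟨q, hpq⟩, hp⟩, hmin⟩ := IsArtinian.set_has_minimal
    {p : Submodule R E | (∃ q, IsCompl p q) ∧ h ∘ₗ p.subtype ≠ 0}
    ⟨⊤, ⟨⊥, isCompl_top_bot⟩, fun h0 => hh (by
      ext x; exact LinearMap.congr_fun h0 (⟨x, trivial⟩ : (⊤ : Submodule R E)))⟩
  refine ⟨p, q, hpq, ⟨?_, ?_⟩, hp⟩
  · by_contra hn
    rw [not_nontrivial_iff_subsingleton] at hn
    exact hp (Subsingleton.elim _ _)
  · have key : ∀ a b : Submodule R p, IsCompl a b → h ∘ₗ p.subtype ∘ₗ a.subtype ≠ 0 → b = ⊥ := by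
      intro a b hab ha
      have hsup : a.map p.subtype ⊔ b.map p.subtype = p := by
        rw [← Submodule.map_sup, hab.sup_eq_top, Submodule.map_subtype_top]
      have hdis : Disjoint (a.map p.subtype) (b.map p.subtype) := by
        rw [disjoint_iff, ← Submodule.map_inf _ p.injective_subtype, hab.inf_eq_bot,
          Submodule.map_bot]
      have hc : IsCompl (a.map p.subtype) (b.map p.subtype ⊔ q) :=
        hdis.isCompl_sup_right_of_isCompl_sup_left (by rwa [hsup])
      have hnlt := hmin (a.map p.subtype) ⟨⟨_, hc⟩, fun h0 => ha (by
        ext x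
        exact LinearMap.congr_fun h0 ⟨(x : p), Submodule.mem_map_of_mem x.2⟩)⟩
      have hle : a.map p.subtype ≤ p := Submodule.map_subtype_le _ _
      have heq : a.map p.subtype = p := by
        by_contra hne
        exact hnlt (lt_of_le_of_ne hle hne)
      rw [heq, disjoint_iff_inf_le] at hdis
      have : b.map p.subtype = ⊥ := by
        rw [eq_bot_iff]
        exact (le_inf (Submodule.map_subtype_le _ _) le_rfl).trans hdis
      exact Submodule.map_injective_of_injective p.injective_subtype
        (this.trans (Submodule.map_bot _).symm)
    intro a b hab
    by_cases ha : h ∘ₗ p.subtype ∘ₗ a.subtype = 0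
    · left
      apply key b a hab.symm
      intro hb
      apply hp
      rw [← LinearMap.ofIsCompl_eq hab (φ := 0) (ψ := 0) (χ := h ∘ₗ p.subtype)
        (fun u => (LinearMap.congr_fun ha u).symm) (fun u => (LinearMap.congr_fun hb u).symm)]
      exact LinearMap.ofIsCompl_eq hab (by simp) (by simp)
    · right
      exact key a b hab ha

variable {M X N : Type v} [AddCommGroup M] [Module R M] [AddCommGroup X] [Module R X]
  [AddCommGroup N] [Module R N]

theorem NoShortCycles.bijective_or_bijective (h : NoShortCycles.{u, v} R) [Module.Finite R M]
    [Module.Finite R X] (hM : IsIndecomposable R M) (hX : IsIndecomposable R X)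
    {f : M →ₗ[R] X} {g : X →ₗ[R] M} (hf : f ≠ 0) (hg : g ≠ 0) :
    Function.Bijective f ∨ Function.Bijective g := by
  by_contra hcon
  rw [not_or] at hcon
  exact h M inferInstance hM ⟨ModuleCat.of R X, ‹Module.Finite R X›, hX, f, g, hf, hg, hcon.1,
    hcon.2⟩

theorem NoShortCycles.bijective_of_ne_zero (h : NoShortCycles.{u, v} R) [Module.Finite R M]
    (hM : IsIndecomposable R M) {f : M →ₗ[R] M} (hf : f ≠ 0) : Function.Bijective f :=
  (h.bijective_or_bijective hM hM hf hf).elim id id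

variable [IsArtinianRing R]

/-- If `X → M` is a nonzero map between indecomposable modules over a ring without short cycles,
then `Ext¹(X, N) = 0` for every `N` generated by `M`. -/
theorem NoShortCycles.extOneVanishes_of_ne_zero (h : NoShortCycles.{u, v} R) [Module.Finite R M]
    [Module.Finite R X] (hM : IsIndecomposable R M) (hX : IsIndecomposable R X)
    {k : X →ₗ[R] M} (hk : k ≠ 0) {ι : Type*} [Finite ι]
    {π : (ι → M) →ₗ[R] N} (hπ : Function.Surjective π) :
    ExtOneVanishes R X N := by
  classical
  apply ExtOneVanishes.of_splits
  intro E _ _ i p hi hp hip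
  have : Module.Finite R N := Module.Finite.of_surjective π hπ
  have : IsArtinian R E := isArtinian_of_range_eq_ker i p (LinearMap.exact_iff.1 hip).symm
  have : IsNoetherian R E := isNoetherian_of_range_eq_ker i p (LinearMap.exact_iff.1 hip).symm
  have hkp : k ∘ₗ p ≠ 0 := fun h0 => hk (by
    ext x
    obtain ⟨e, rfl⟩ := hp x
    exact LinearMap.congr_fun h0 e)
  obtain ⟨E₁, E₂, hc, hE₁, hne⟩ := exists_indecomposable_summand_of_ne_zero hkp
  have := hE₁.1
  by_contra hns
  have hsplit : ∀ b : X →ₗ[R] E₁, b ∘ₗ (p ∘ₗ E₁.subtype) ≠ LinearMap.id := by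
    intro b hb
    have hbij := hX.bijective_of_comp_eq_id hb
    let e := LinearEquiv.ofBijective _ hbij
    refine hns ⟨E₁.subtype ∘ₗ e.symm.toLinearMap, ?_⟩
    ext x
    exact e.apply_symm_apply x
  let pr : E →ₗ[R] E₁ := E₁.projectionOnto E₂ hc
  have hpr : ∀ x : E₁, pr x = x := fun x => Submodule.projectionOnto_apply_left hc x
  have hpri : pr ∘ₗ i ≠ 0 := by
    intro h0
    obtain ⟨b, hb⟩ := LinearMap.exists_comp_eq_of_surjective hp pr (fun x hx => by
      obtain ⟨n, rfl⟩ := (hip x).1 hx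
      exact LinearMap.congr_fun h0 n)
    apply hsplit b
    rw [← LinearMap.comp_assoc, hb]
    ext x
    simp [hpr]
  have hne' : pr ∘ₗ i ∘ₗ π ≠ 0 := fun h0 => hpri (by
    ext1 x
    obtain ⟨y, rfl⟩ := hπ x
    exact LinearMap.congr_fun h0 y)
  obtain ⟨t, ht⟩ : ∃ t, pr ∘ₗ i ∘ₗ π ∘ₗ LinearMap.single R (fun _ : ι => M) t ≠ 0 := by
    by_contra hcon
    push Not at hcon
    exact hne' (LinearMap.pi_ext' (fun t => by
      rw [LinearMap.zero_comp]; exact hcon t))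
  set c := pr ∘ₗ i ∘ₗ π ∘ₗ LinearMap.single R (fun _ : ι => M) t with hcdef
  have hw : Function.Bijective ((k ∘ₗ p) ∘ₗ E₁.subtype) := by
    rcases h.bijective_or_bijective hM hE₁ ht hne with hb | hb
    · have hcomp : ((k ∘ₗ p) ∘ₗ E₁.subtype) ∘ₗ c ≠ 0 := fun h0 => hne (by
        ext1 x
        obtain ⟨y, rfl⟩ := hb.2 x
        exact LinearMap.congr_fun h0 y)
      have := h.bijective_of_ne_zero hM hcomp
      exact (Function.Bijective.of_comp_iff _ hb).1 this
    · exact hb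
  let e := LinearEquiv.ofBijective _ hw
  apply hsplit (e.symm.toLinearMap ∘ₗ k)
  ext1 x
  exact e.symm_apply_apply x

/-- `Ext¹(X, N) = 0` whenever the indecomposable module `M` cogenerates `X` and generates `N`. -/
theorem NoShortCycles.extOneVanishes_of_injective (h : NoShortCycles.{u, v} R)
    [Module.Finite R M] (hM : IsIndecomposable R M) [hfin : Module.Finite R X] {κ : Type*}
    {j : X →ₗ[R] (κ → M)} (hj : Function.Injective j) {ι : Type*} [Finite ι]
    {π : (ι → M) →ₗ[R] N}
    (hπ : Function.Surjective π) : ExtOneVanishes R X N := by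
  suffices H : ∀ p : Submodule R X, ExtOneVanishes R p N by
    have : IsCompl (⊤ : Submodule R X) ⊥ := isCompl_top_bot
    exact ExtOneVanishes.of_isCompl this (H _) (H _)
  intro p
  induction p using WellFoundedLT.induction with
  | ind p ih =>
  by_cases hnt : Nontrivial p
  swap
  · rw [not_nontrivial_iff_subsingleton] at hnt
    intro E E' _ _ _ _ i π hi hπ hip f
    exact ⟨0, by ext x; rw [Subsingleton.elim x 0]; simp⟩
  by_cases hp : IsIndecomposable R p
  · obtain ⟨x, hx⟩ := exists_ne (0 : p)
    have hjx : j x ≠ 0 := fun h0 => hx (Subtype.ext ((map_eq_zero_iff j hj).1 h0))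
    obtain ⟨t, ht⟩ := Function.ne_iff.1 hjx
    refine h.extOneVanishes_of_ne_zero hM hp (k := LinearMap.proj t ∘ₗ j ∘ₗ p.subtype)
      (fun h0 => ht (LinearMap.congr_fun h0 x)) hπ
  · have : ∃ a b : Submodule R p, IsCompl a b ∧ a ≠ ⊥ ∧ b ≠ ⊥ := by
      by_contra hcon
      push Not at hcon
      exact hp ⟨hnt, fun a b hab => by
        by_cases ha : a = ⊥
        · exact Or.inl ha
        · exact Or.inr (hcon a b hab ha)⟩
    obtain ⟨a, b, hab, ha, hb⟩ := this
    have key : ∀ a b : Submodule R p, IsCompl a b → b ≠ ⊥ → ExtOneVanishes R a N := by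
      intro a b hab hb
      have hlt : a.map p.subtype < p := by
        refine lt_of_le_of_ne (Submodule.map_subtype_le _ _) (fun heq => hb ?_)
        have : a = ⊤ := by
          apply Submodule.map_injective_of_injective p.injective_subtype
          rw [heq, Submodule.map_subtype_top]
        subst this
        simpa using hab.inf_eq_bot
      exact (ih _ hlt).of_linearEquiv
        (Submodule.equivMapOfInjective p.subtype p.injective_subtype a).symm
    exact ExtOneVanishes.of_isCompl hab (key a b hab hb) (key b a hab.symm ha)

end ShortCycles

section Faithful

variable {R : Type v} [Ring R]

/-- If `M` cogenerates `R` and `Ext¹(X, N) = 0` for all `N` generated by `M`, then the syzygies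
of `X` are projective. -/
theorem projective_of_extOneVanishes {M X Ω P : Type v} [AddCommGroup M] [Module R M]
    [AddCommGroup X] [Module R X] [AddCommGroup Ω] [Module R Ω] [AddCommGroup P] [Module R P]
    {κ : Type} [Finite κ] {e : R →ₗ[R] (κ → M)} (he : Function.Injective e)
    (hext : ∀ (ι : Type) [Finite ι] (N : Type v) [AddCommGroup N] [Module R N]
      (π : (ι → M) →ₗ[R] N), Function.Surjective π → ExtOneVanishes R X N)
    [Module.Finite R Ω] [Module.Projective R P] {j : Ω →ₗ[R] P} {p : P →ₗ[R] X}
    (hj : Function.Injective j) (hp : Function.Surjective p) (hjp : Function.Exact j p) :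
    Module.Projective R Ω := by
  obtain ⟨n, q, hq⟩ := Module.Finite.exists_fin' R Ω
  let h : (Fin n → R) →ₗ[R] (Fin n × κ → M) :=
    LinearMap.pi (fun t => LinearMap.proj t.2 ∘ₗ e ∘ₗ LinearMap.proj t.1)
  have hh : Function.Injective h := by
    intro x y hxy
    ext i
    apply he
    ext t
    exact congrFun hxy (i, t)
  let U := (LinearMap.ker q).map h
  obtain ⟨ψ, hψ⟩ := LinearMap.exists_comp_eq_of_surjective hq (U.mkQ ∘ₗ h) (fun x hx =>
    (Submodule.Quotient.mk_eq_zero U).2 ⟨x, hx, rfl⟩)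
  obtain ⟨ψ', hψ'⟩ := (hext _ _ U.mkQ U.mkQ_surjective).exists_extension hj hp hjp ψ
  obtain ⟨θ, hθ⟩ := Module.projective_lifting_property U.mkQ ψ' U.mkQ_surjective
  have hmem : ∀ x, (h - θ ∘ₗ j ∘ₗ q) x ∈ U := by
    intro x
    rw [← Submodule.Quotient.mk_eq_zero, LinearMap.sub_apply, Submodule.Quotient.mk_sub, sub_eq_zero]
    have h1 := LinearMap.congr_fun hθ (j (q x))
    have h2 := LinearMap.congr_fun hψ' (q x)
    have h3 := LinearMap.congr_fun hψ x
    exact (h1.trans (h2.trans h3)).symm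
  obtain ⟨r, hr⟩ := LinearMap.exists_comp_eq_of_injective hh (h - θ ∘ₗ j ∘ₗ q) (fun x => by
    obtain ⟨y, _, hy⟩ := hmem x
    exact ⟨y, hy⟩)
  have hr' : ∀ x, h (r x) = h x - θ (j (q x)) := LinearMap.congr_fun hr
  have hqr : ∀ x, q (r x) = 0 := by
    intro x
    obtain ⟨y, hy, hxy⟩ := hmem x
    have : r x = y := hh ((hr' x).trans hxy.symm)
    rw [this]
    exact hy
  have hrq : ∀ x, q x = 0 → r x = x := fun x hx => hh (by rw [hr', hx, map_zero, map_zero, sub_zero])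
  obtain ⟨s, hs⟩ := LinearMap.exists_comp_eq_of_surjective hq (LinearMap.id - r) (fun x hx => by
    simp [hrq x hx])
  refine Module.Projective.of_split s q ?_
  ext1 x
  obtain ⟨y, rfl⟩ := hq x
  have := LinearMap.congr_fun hs y
  simp only [LinearMap.comp_apply, LinearMap.sub_apply, LinearMap.id_apply] at this ⊢
  rw [this, map_sub, hqr, sub_zero]

/-- The simple module `S` is a subfactor of `M`. -/
def IsSubfactor (R : Type*) [Ring R] (S M : Type*) [AddCommGroup S] [Module R S]
    [AddCommGroup M] [Module R M] : Prop :=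
  ∃ (U : Submodule R M) (f : S →ₗ[R] M ⧸ U), f ≠ 0

theorem exists_simple_subfactor [IsNoetherianRing R] {I N : Type v} [AddCommGroup I] [Module R I]
    [AddCommGroup N] [Module R N] [IsNoetherian R N] {g : I →ₗ[R] N} (hg : g ≠ 0) :
    ∃ (S : Type v) (_ : AddCommGroup S) (_ : Module R S) (f : I →ₗ[R] S), IsSimpleModule R S ∧
      Function.Surjective f ∧ IsSubfactor R S N := by
  obtain ⟨U, hU, hmax⟩ := set_has_maximal_iff_noetherian.2 ‹IsNoetherian R N›
    {U : Submodule R N | ¬ LinearMap.range g ≤ U} ⟨⊥, fun h0 => hg (LinearMap.range_eq_bot.1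
      (le_bot_iff.1 h0))⟩
  let T := LinearMap.range (U.mkQ ∘ₗ g)
  have hT : T ≠ ⊥ := by
    intro h0
    apply hU
    rintro _ ⟨x, rfl⟩
    rw [← Submodule.Quotient.mk_eq_zero]
    exact LinearMap.congr_fun (LinearMap.range_eq_bot.1 h0) x
  have hmin : ∀ V : Submodule R (N ⧸ U), V ≠ ⊥ → T ≤ V := by
    intro V hV
    have hlt : U < V.comap U.mkQ := by
      refine lt_of_le_of_ne ?_ ?_
      · intro x hx
        rw [Submodule.mem_comap, Submodule.mkQ_apply, (Submodule.Quotient.mk_eq_zero U).2 hx]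
        exact V.zero_mem
      · intro heq
        apply hV
        rw [eq_bot_iff]
        intro y hy
        obtain ⟨x, rfl⟩ := U.mkQ_surjective y
        have : x ∈ U := by rw [heq]; exact hy
        exact (Submodule.Quotient.mk_eq_zero U).2 this
    have : LinearMap.range g ≤ V.comap U.mkQ := by
      by_contra hn
      exact hmax _ hn hlt
    rintro _ ⟨x, rfl⟩
    exact this ⟨x, rfl⟩
  have hnt : Nontrivial T := Submodule.nontrivial_iff_ne_bot.2 hT
  refine ⟨T, inferInstance, inferInstance, (U.mkQ ∘ₗ g).rangeRestrict, ?_,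
    LinearMap.surjective_rangeRestrict _, U, T.subtype, ?_⟩
  · rw [isSimpleModule_iff]
    refine { eq_bot_or_eq_top := fun V => ?_ }
    by_cases hV : V = ⊥
    · exact Or.inl hV
    · right
      have h1 : V.map T.subtype ≠ ⊥ := fun h0 => hV (Submodule.map_injective_of_injective
        T.injective_subtype (h0.trans (Submodule.map_bot _).symm))
      apply Submodule.map_injective_of_injective T.injective_subtype
      rw [Submodule.map_subtype_top]
      exact le_antisymm (Submodule.map_subtype_le _ _) (hmin _ h1)
  · intro h0
    obtain ⟨x, hx⟩ := exists_ne (0 : T)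
    exact hx (Subtype.ext (LinearMap.congr_fun h0 x))

variable {K : Type w} [Field K] [Algebra K R]

theorem exists_generators_annihilator (M : Type*) [AddCommGroup M] [Module R M] [Module K M]
    [IsScalarTower K R M] [FiniteDimensional K M] :
    ∃ (n : ℕ) (m : Fin n → M), ∀ r : R, (∀ i, r • m i = 0) → r ∈ Module.annihilator R M := by
  let b := Module.finBasis K M
  refine ⟨_, b, fun r hr => Module.mem_annihilator.2 fun x => ?_⟩
  have := SMulCommClass.symm
  rw [← b.sum_repr x, Finset.smul_sum]
  refine Finset.sum_eq_zero fun i _ => ?_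
  rw [smul_comm, hr, smul_zero]

/-- Over an algebra without short cycles, the annihilator of an indecomposable module only depends
on its simple subfactors. -/
theorem NoShortCycles.annihilator_le [FiniteDimensional K R] (h : NoShortCycles.{v, v} R)
    {M N : Type v} [AddCommGroup M] [Module R M] [AddCommGroup N] [Module R N] [Module K M]
    [IsScalarTower K R M] [Module.Finite R M] [Module.Finite R N] (hM : IsIndecomposable R M)
    (hMN : ∀ (S : Type v) [AddCommGroup S] [Module R S], IsSimpleModule R S →
      IsSubfactor R S N → IsSubfactor R S M) :
    Module.annihilator R M ≤ Module.annihilator R N := by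
  have : IsArtinianRing R := IsArtinianRing.of_finite K R
  have : FiniteDimensional K M := Module.Finite.trans R M
  obtain ⟨n, m, hm⟩ := exists_generators_annihilator (R := R) (K := K) M
  intro a ha
  rw [Module.mem_annihilator]
  intro x
  by_contra hx
  let I : Submodule R R := Module.annihilator R M
  obtain ⟨S, _, _, f, hS, hf, hSN⟩ := exists_simple_subfactor (R := R) (I := I) (N := N)
    (g := LinearMap.toSpanSingleton R N x ∘ₗ I.subtype)
    (fun h0 => hx (by simpa using LinearMap.congr_fun h0 ⟨a, ha⟩))
  obtain ⟨U, g, hg⟩ := hMN S hS hSN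
  let c : R →ₗ[R] (Fin n → M) := LinearMap.pi (fun i => LinearMap.toSpanSingleton R M (m i))
  let π : (Unit → M) →ₗ[R] M ⧸ U := U.mkQ ∘ₗ LinearMap.proj ()
  have hext : ExtOneVanishes R (LinearMap.range c) (M ⧸ U) :=
    h.extOneVanishes_of_injective hM (j := (LinearMap.range c).subtype)
      (LinearMap.range c).injective_subtype (π := π) (fun y => by
        obtain ⟨z, rfl⟩ := U.mkQ_surjective y
        exact ⟨fun _ => z, rfl⟩)
  obtain ⟨ψ, hψ⟩ := hext.exists_extension (j := I.subtype) (π := c.rangeRestrict)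
    I.injective_subtype c.surjective_rangeRestrict (by
      intro r
      constructor
      · intro hr
        refine ⟨⟨r, hm r fun i => ?_⟩, rfl⟩
        exact congrFun (congrArg Subtype.val hr) i
      · rintro ⟨r, rfl⟩
        ext i
        exact Module.mem_annihilator.1 r.2 _) (g ∘ₗ f)
  apply hg
  ext1 s
  obtain ⟨r, rfl⟩ := hf s
  have h1 : ψ r = g (f r) := LinearMap.congr_fun hψ r
  obtain ⟨y, hy⟩ := U.mkQ_surjective (ψ 1)
  rw [← h1, ← mul_one (r : R), ← smul_eq_mul, map_smul, ← hy, ← map_smul,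
    Module.mem_annihilator.1 r.2 y, map_zero]
  rfl

end Faithful

section HomDim

set_option linter.unusedSectionVars false

open Module

theorem finrank_eq_add_finrank_range {K U V W : Type*} [Field K] [AddCommGroup U] [AddCommGroup V]
    [AddCommGroup W] [Module K U] [Module K V] [Module K W] [FiniteDimensional K V]
    {f : U →ₗ[K] V} {g : V →ₗ[K] W} (hf : Function.Injective f) (hfg : Function.Exact f g) :
    finrank K V = finrank K U + finrank K (LinearMap.range g) := by
  rw [← LinearMap.finrank_range_add_finrank_ker g, hfg.linearMap_ker_eq,
    LinearMap.finrank_range_of_inj hf, add_comm]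

variable {K : Type w} {R : Type u} [Field K] [Ring R] [Algebra K R]
  {A B C N : Type*} [AddCommGroup A] [AddCommGroup B] [AddCommGroup C] [AddCommGroup N]
  [Module K A] [Module K B] [Module K C] [Module K N]
  [Module R A] [Module R B] [Module R C] [Module R N]
  [IsScalarTower K R A] [IsScalarTower K R B] [IsScalarTower K R C] [IsScalarTower K R N]

instance finiteDimensional_hom [FiniteDimensional K A] [FiniteDimensional K B] :
    FiniteDimensional K (A →ₗ[R] B) :=
  FiniteDimensional.of_injective (LinearMap.restrictScalarsₗ K R A B K)
    (LinearMap.restrictScalars_injective K)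

variable [FiniteDimensional K A] [FiniteDimensional K B] [FiniteDimensional K C]
  [FiniteDimensional K N] {i : A →ₗ[R] B} {p : B →ₗ[R] C}

variable (K N) in
/-- Precomposition as a linear map over the ground field. -/
def precompₗ (i : A →ₗ[R] B) : (B →ₗ[R] N) →ₗ[K] (A →ₗ[R] N) where
  toFun f := f ∘ₗ i
  map_add' _ _ := rfl
  map_smul' _ _ := rfl

variable (K N) in
/-- Postcomposition as a linear map over the ground field. -/
def postcompₗ (p : B →ₗ[R] C) :
    (N →ₗ[R] B) →ₗ[K] (N →ₗ[R] C) where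
  toFun f := p ∘ₗ f
  map_add' _ _ := LinearMap.comp_add _ _ _
  map_smul' c f := by
    ext x
    exact (p.restrictScalars K).map_smul c (f x)

variable (hi : Function.Injective i) (hp : Function.Surjective p) (hip : Function.Exact i p)

include hp hip in
theorem finrank_hom_eq_add_range :
    finrank K (B →ₗ[R] N) = finrank K (C →ₗ[R] N) +
      finrank K (LinearMap.range (precompₗ K N i)) := by
  refine finrank_eq_add_finrank_range (f := precompₗ K N p) ?_ ?_
  · intro f g hfg
    ext c
    obtain ⟨b, rfl⟩ := hp c
    exact LinearMap.congr_fun hfg b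
  · intro f
    constructor
    · intro hf
      exact LinearMap.exists_comp_eq_of_surjective hp f (fun x hx => by
        obtain ⟨y, rfl⟩ := (hip x).1 hx
        exact LinearMap.congr_fun hf y)
    · rintro ⟨g, rfl⟩
      ext a
      change g (p (i a)) = 0
      rw [hip.apply_apply_eq_zero, map_zero]

include hi hip in
theorem finrank_hom_eq_add_range' :
    finrank K (N →ₗ[R] B) = finrank K (N →ₗ[R] A) +
      finrank K (LinearMap.range (postcompₗ K N p)) := by
  refine finrank_eq_add_finrank_range (f := postcompₗ K N i) ?_ ?_
  · intro f g hfg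
    ext c
    exact hi (LinearMap.congr_fun hfg c)
  · intro f
    constructor
    · intro hf
      exact LinearMap.exists_comp_eq_of_injective hi f (fun x =>
        (hip _).1 (LinearMap.congr_fun hf x))
    · rintro ⟨g, rfl⟩
      ext a
      exact hip.apply_apply_eq_zero _

include hp hip in
variable (K N) in
theorem finrank_hom_le_add : finrank K (B →ₗ[R] N) ≤
    finrank K (C →ₗ[R] N) + finrank K (A →ₗ[R] N) := by
  rw [finrank_hom_eq_add_range hp hip]
  exact Nat.add_le_add_left (Submodule.finrank_le _) _

include hp hip in
theorem finrank_hom_eq_add (h : ∀ f : A →ₗ[R] N, ∃ g : B →ₗ[R] N, g ∘ₗ i = f) :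
    finrank K (B →ₗ[R] N) = finrank K (C →ₗ[R] N) + finrank K (A →ₗ[R] N) := by
  have h' : Function.Surjective (precompₗ K N i) := h
  rw [finrank_hom_eq_add_range hp hip, LinearMap.range_eq_top.2 h', finrank_top]

include hi hip in
variable (K N) in
theorem finrank_hom_le_add' : finrank K (N →ₗ[R] B) ≤
    finrank K (N →ₗ[R] A) + finrank K (N →ₗ[R] C) := by
  rw [finrank_hom_eq_add_range' hi hip]
  exact Nat.add_le_add_left (Submodule.finrank_le _) _

include hi hip in
theorem finrank_hom_eq_add' (h : ∀ f : N →ₗ[R] C, ∃ g : N →ₗ[R] B, p ∘ₗ g = f) :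
    finrank K (N →ₗ[R] B) = finrank K (N →ₗ[R] A) + finrank K (N →ₗ[R] C) := by
  have h' : Function.Surjective (postcompₗ K N p) := h
  rw [finrank_hom_eq_add_range' hi hip, LinearMap.range_eq_top.2 h', finrank_top]

include hi hip in
theorem finrank_hom_lt_add' {f : N →ₗ[R] C} (h : ∀ g : N →ₗ[R] B, p ∘ₗ g ≠ f) :
    finrank K (N →ₗ[R] B) < finrank K (N →ₗ[R] A) + finrank K (N →ₗ[R] C) := by
  rw [finrank_hom_eq_add_range' hi hip]
  refine Nat.add_lt_add_left (Submodule.finrank_lt fun htop => ?_) _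
  obtain ⟨g, hg⟩ := LinearMap.range_eq_top.1 htop f
  exact h g hg

end HomDim

section Syzygy

open Module TensorProduct

variable (K : Type w) (R : Type v) [Field K] [Ring R] [Algebra K R]
  (X : Type v) [AddCommGroup X] [Module K X] [Module R X] [IsScalarTower K R X]
  {N : Type v} [AddCommGroup N] [Module K N] [Module R N] [IsScalarTower K R N]

/-- Maps out of the free module on a vector space. -/
noncomputable def freeHomEquiv : (X →ₗ[K] N) ≃ₗ[K] (R ⊗[K] X →ₗ[R] N) :=
  (LinearMap.ringLmapEquivSelf R K (X →ₗ[K] N)).symm ≪≫ₗ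
    TensorProduct.AlgebraTensorModule.lift.equiv K R K R X N

omit [Module R X] [IsScalarTower K R X] in
variable {K R X} in
theorem freeHomEquiv_tmul (f : X →ₗ[K] N) (r : R) (x : X) :
    freeHomEquiv K R X f (r ⊗ₜ x) = r • f x := by
  rfl

/-- The multiplication map from the free module on the vector space underlying `X`. -/
noncomputable def mulMap : R ⊗[K] X →ₗ[R] X := freeHomEquiv K R X LinearMap.id

@[simp]
theorem mulMap_tmul (r : R) (x : X) : mulMap K R X (r ⊗ₜ x) = r • x := freeHomEquiv_tmul _ _ _

theorem mulMap_surjective : Function.Surjective (mulMap K R X) := fun x => ⟨1 ⊗ₜ x, by simp⟩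

/-- The kernel of the multiplication map. -/
def Syzygy : Type v := LinearMap.ker (mulMap K R X)

noncomputable instance : AddCommGroup (Syzygy K R X) :=
  inferInstanceAs (AddCommGroup (LinearMap.ker (mulMap K R X)))
noncomputable instance : Module R (Syzygy K R X) :=
  inferInstanceAs (Module R (LinearMap.ker (mulMap K R X)))
noncomputable instance : Module K (Syzygy K R X) :=
  inferInstanceAs (Module K (LinearMap.ker (mulMap K R X)))
instance : IsScalarTower K R (Syzygy K R X) :=
  inferInstanceAs (IsScalarTower K R (LinearMap.ker (mulMap K R X)))

/-- The inclusion of the syzygy module. -/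
noncomputable def Syzygy.incl : Syzygy K R X →ₗ[R] R ⊗[K] X := (LinearMap.ker (mulMap K R X)).subtype

theorem Syzygy.incl_injective : Function.Injective (Syzygy.incl K R X) :=
  (LinearMap.ker (mulMap K R X)).injective_subtype

theorem Syzygy.exact : Function.Exact (Syzygy.incl K R X) (mulMap K R X) :=
  LinearMap.exact_subtype_ker_map _

instance [FiniteDimensional K R] [FiniteDimensional K X] : FiniteDimensional K (Syzygy K R X) :=
  FiniteDimensional.of_injective ((Syzygy.incl K R X).restrictScalars K)
    (Syzygy.incl_injective K R X)

instance : Module.Projective R (R ⊗[K] X) :=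
  Module.Projective.of_basis ((Basis.ofVectorSpace K X).baseChange R)

omit [Module R X] [IsScalarTower K R X] in
theorem finrank_free_hom [FiniteDimensional K X] [FiniteDimensional K N] :
    finrank K (R ⊗[K] X →ₗ[R] N) = finrank K X * finrank K N := by
  rw [← (freeHomEquiv K R X (N := N)).finrank_eq, Module.finrank_linearMap]

theorem finrank_syzygy [FiniteDimensional K R] [FiniteDimensional K X] :
    finrank K (Syzygy K R X) + finrank K X = finrank K R * finrank K X := by
  have h := finrank_eq_add_finrank_range (K := K) (f := (Syzygy.incl K R X).restrictScalars K)
    (g := (mulMap K R X).restrictScalars K) (Syzygy.incl_injective K R X) (Syzygy.exact K R X)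
  have h' : Function.Surjective ((mulMap K R X).restrictScalars K) := mulMap_surjective K R X
  rw [LinearMap.range_eq_top.2 h', finrank_top,
    Module.finrank_tensorProduct] at h
  exact h.symm

variable {K R X}

theorem Syzygy.exists_exact {Y Z : Type v} [AddCommGroup Y] [Module K Y] [Module R Y]
    [IsScalarTower K R Y] [AddCommGroup Z] [Module K Z] [Module R Z]
    [IsScalarTower K R Z] {i : X →ₗ[R] Y} {p : Y →ₗ[R] Z} (hi : Function.Injective i)
    (hp : Function.Surjective p) (hip : Function.Exact i p) :
    ∃ (i' : Syzygy K R X →ₗ[R] Syzygy K R Y) (p' : Syzygy K R Y →ₗ[R] Syzygy K R Z),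
      Function.Injective i' ∧ Function.Surjective p' ∧ Function.Exact i' p' := by
  let Fi : R ⊗[K] X →ₗ[R] R ⊗[K] Y := AlgebraTensorModule.lTensor R R (i.restrictScalars K)
  let Fp : R ⊗[K] Y →ₗ[R] R ⊗[K] Z := AlgebraTensorModule.lTensor R R (p.restrictScalars K)
  have hFi : Function.Injective Fi :=
    Module.Flat.lTensor_preserves_injective_linearMap (M := R) (i.restrictScalars K) hi
  have hFp : Function.Surjective Fp := LinearMap.lTensor_surjective R (g := p.restrictScalars K) hp
  have hF : Function.Exact Fi Fp :=
    lTensor_exact R (f := i.restrictScalars K) (g := p.restrictScalars K) hip hp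
  have hmi : ∀ z, mulMap K R Y (Fi z) = i (mulMap K R X z) := fun z => by
    induction z with
    | zero => simp
    | add a b ha hb => simp only [map_add, ha, hb]
    | tmul r x => simp [Fi]
  have hmp : ∀ z, mulMap K R Z (Fp z) = p (mulMap K R Y z) := fun z => by
    induction z with
    | zero => simp
    | add a b ha hb => simp only [map_add, ha, hb]
    | tmul r x => simp [Fp]
  have hX := Syzygy.exact K R X
  have hY := Syzygy.exact K R Y
  have hZ := Syzygy.exact K R Z
  obtain ⟨i', hi'⟩ := LinearMap.exists_comp_eq_of_injective (Syzygy.incl_injective K R Y)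
    (Fi ∘ₗ Syzygy.incl K R X) (fun x => (hY _).1 (by
      rw [LinearMap.comp_apply, hmi, hX.apply_apply_eq_zero, map_zero]))
  obtain ⟨p', hp'⟩ := LinearMap.exists_comp_eq_of_injective (Syzygy.incl_injective K R Z)
    (Fp ∘ₗ Syzygy.incl K R Y) (fun x => (hZ _).1 (by
      rw [LinearMap.comp_apply, hmp, hY.apply_apply_eq_zero, map_zero]))
  have hi'' := fun x => LinearMap.congr_fun hi' x
  have hp'' := fun x => LinearMap.congr_fun hp' x
  simp only [LinearMap.comp_apply] at hi'' hp''
  refine ⟨i', p', ?_, ?_, ?_⟩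
  · intro a b hab
    apply Syzygy.incl_injective K R X
    apply hFi
    rw [← hi'', ← hi'', hab]
  · intro z
    obtain ⟨y, hy⟩ := hFp (Syzygy.incl K R Z z)
    have h0 : p (mulMap K R Y y) = 0 := by
      rw [← hmp, hy, hZ.apply_apply_eq_zero]
    obtain ⟨x, hx⟩ := (hip _).1 h0
    obtain ⟨t, ht⟩ := (hY (y - Fi (1 ⊗ₜ x))).1 (by
      rw [map_sub, hmi, mulMap_tmul, one_smul, hx, sub_self])
    refine ⟨t, Syzygy.incl_injective K R Z ?_⟩
    rw [hp'', ht, map_sub, hF.apply_apply_eq_zero, sub_zero, hy]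
  · intro y
    constructor
    · intro hy
      obtain ⟨x, hx⟩ := (hF (Syzygy.incl K R Y y)).1 (by rw [← hp'', hy, map_zero])
      obtain ⟨t, ht⟩ := (hX x).1 (hi (by rw [← hmi, hx, hY.apply_apply_eq_zero, map_zero]))
      refine ⟨t, Syzygy.incl_injective K R Y ?_⟩
      rw [hi'', ht, hx]
    · rintro ⟨x, rfl⟩
      apply Syzygy.incl_injective K R Z
      rw [hp'', hi'', hF.apply_apply_eq_zero, map_zero]

end Syzygy

section EulerForm

open Module TensorProduct

theorem ExtOneVanishes.of_projective {R : Type u} [Ring R] {P N : Type v} [AddCommGroup P]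
    [Module R P] [AddCommGroup N] [Module R N] [Module.Projective R P] : ExtOneVanishes R P N := by
  intro E E' _ _ _ _ i p hi hp hip f
  exact Module.projective_lifting_property p f hp

variable (K : Type w) (R : Type v) [Field K] [Ring R] [Algebra K R]

/-- The Euler form computed from the standard presentation of `X`. When the second syzygy of `X`
is projective this is the alternating sum of the dimensions of the `Extⁱ(X, N)`. -/
noncomputable def eulerForm (X N : Type v) [AddCommGroup X] [Module K X] [Module R X]
    [IsScalarTower K R X] [AddCommGroup N] [Module K N] [Module R N] [IsScalarTower K R N] : ℤ :=
  (2 - finrank K R) * (finrank K X * finrank K N) +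
    finrank K (Syzygy K R (Syzygy K R X) →ₗ[R] N)

/-- All second syzygies of finite-dimensional modules are projective. -/
def SecondSyzygiesProjective : Prop :=
  ∀ (X : Type v) [AddCommGroup X] [Module K X] [Module R X] [IsScalarTower K R X]
    [FiniteDimensional K X], Module.Projective R (Syzygy K R (Syzygy K R X))

variable [FiniteDimensional K R]
  {X Y Z N : Type v} [AddCommGroup X] [Module K X] [Module R X] [IsScalarTower K R X]
  [AddCommGroup Y] [Module K Y] [Module R Y] [IsScalarTower K R Y]
  [AddCommGroup Z] [Module K Z] [Module R Z] [IsScalarTower K R Z]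
  [AddCommGroup N] [Module K N] [Module R N] [IsScalarTower K R N]
  [FiniteDimensional K X] [FiniteDimensional K Y] [FiniteDimensional K Z] [FiniteDimensional K N]

variable {R}

theorem ExtOneVanishes.finrank_hom_le_eulerForm (h : ExtOneVanishes R X N) :
    (finrank K (X →ₗ[R] N) : ℤ) ≤ eulerForm K R X N := by
  have h1 := finrank_hom_eq_add (K := K) (mulMap_surjective K R X) (Syzygy.exact K R X)
    (h.exists_extension (Syzygy.incl_injective K R X) (mulMap_surjective K R X)
      (Syzygy.exact K R X))
  have h2 := finrank_hom_le_add K N (mulMap_surjective K R (Syzygy K R X))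
    (Syzygy.exact K R (Syzygy K R X))
  have h3 := finrank_syzygy K R X
  rw [finrank_free_hom] at h1 h2
  rw [eulerForm]
  zify at h1 h2 h3
  have h4 : (finrank K (Syzygy K R X) : ℤ) = (finrank K R - 1) * finrank K X := by linarith
  rw [h4] at h2
  linarith

theorem eulerForm_le_finrank_hom [Module.Projective R (Syzygy K R X)] :
    eulerForm K R X N ≤ finrank K (X →ₗ[R] N) := by
  have h1 := finrank_hom_le_add K N (mulMap_surjective K R X) (Syzygy.exact K R X)
  have h2 := finrank_hom_eq_add (K := K) (mulMap_surjective K R (Syzygy K R X))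
    (Syzygy.exact K R (Syzygy K R X))
    ((ExtOneVanishes.of_projective (N := N)).exists_extension (Syzygy.incl_injective K R _)
      (mulMap_surjective K R _) (Syzygy.exact K R _))
  have h3 := finrank_syzygy K R X
  rw [finrank_free_hom] at h1 h2
  rw [eulerForm]
  zify at h1 h2 h3
  have h4 : (finrank K (Syzygy K R X) : ℤ) = (finrank K R - 1) * finrank K X := by linarith
  rw [h4] at h2
  linarith

variable {K} {i : X →ₗ[R] Y} {p : Y →ₗ[R] Z} (hi : Function.Injective i)
  (hp : Function.Surjective p) (hip : Function.Exact i p)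

include hi hp hip

omit [FiniteDimensional K R] [FiniteDimensional K X] [FiniteDimensional K Z] in
theorem finrank_eq_add_of_exact_s12 : finrank K Y = finrank K X + finrank K Z := by
  have h := finrank_eq_add_finrank_range (K := K) (f := i.restrictScalars K)
    (g := p.restrictScalars K) hi hip
  have h' : Function.Surjective (p.restrictScalars K) := hp
  rwa [LinearMap.range_eq_top.2 h', finrank_top] at h

theorem SecondSyzygiesProjective.eulerForm_add_left (h : SecondSyzygiesProjective K R) :
    eulerForm K R Y N = eulerForm K R X N + eulerForm K R Z N := by
  obtain ⟨i', p', hi', hp', hip'⟩ := Syzygy.exists_exact (K := K) hi hp hip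
  obtain ⟨i'', p'', hi'', hp'', hip''⟩ := Syzygy.exists_exact (K := K) hi' hp' hip'
  have := h Z
  have h1 := finrank_hom_eq_add (K := K) hp'' hip''
    ((ExtOneVanishes.of_projective (N := N)).exists_extension hi'' hp'' hip'')
  have h2 := finrank_eq_add_of_exact_s12 (K := K) hi hp hip
  rw [eulerForm, eulerForm, eulerForm, h1, h2]
  push_cast
  ring

theorem SecondSyzygiesProjective.eulerForm_add_right (h : SecondSyzygiesProjective K R) :
    eulerForm K R N Y = eulerForm K R N X + eulerForm K R N Z := by
  have := h N
  have h1 := finrank_hom_eq_add' (K := K) (N := Syzygy K R (Syzygy K R N)) hi hip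
    (fun f => Module.projective_lifting_property p f hp)
  have h2 := finrank_eq_add_of_exact_s12 (K := K) hi hp hip
  rw [eulerForm, eulerForm, eulerForm, h1, h2]
  push_cast
  ring

end EulerForm

section FaithfulIndecomposable

open Module TensorProduct

variable {K : Type w} {R : Type v} [Field K] [Ring R] [Algebra K R] [FiniteDimensional K R]
  {M N : Type v} [AddCommGroup M] [Module K M] [Module R M] [IsScalarTower K R M]
  [FiniteDimensional K M]

theorem exists_embedding_of_annihilator_eq_bot (K : Type w) [Field K] [Algebra K R] [Module K M]
    [IsScalarTower K R M] [FiniteDimensional K M] (hM : Module.annihilator R M = ⊥) :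
    ∃ (n : ℕ) (e : R →ₗ[R] (Fin n → M)), Function.Injective e := by
  obtain ⟨n, m, hm⟩ := exists_generators_annihilator (R := R) (K := K) M
  refine ⟨n, LinearMap.pi (fun i => LinearMap.toSpanSingleton R M (m i)), ?_⟩
  rw [injective_iff_map_eq_zero]
  intro r hr
  have := hm r fun i => congrFun hr i
  rwa [hM] at this

theorem NoShortCycles.secondSyzygiesProjective (h : NoShortCycles.{v, v} R)
    (hM : IsIndecomposable R M) (hann : Module.annihilator R M = ⊥) :
    SecondSyzygiesProjective K R := by
  intro X _ _ _ _ _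
  have : IsArtinianRing R := IsArtinianRing.of_finite K R
  have : Module.Finite R M := Module.Finite.of_restrictScalars_finite K R M
  have : Module.Finite R (Syzygy K R X) := Module.Finite.of_restrictScalars_finite K R _
  have : Module.Finite R (Syzygy K R (Syzygy K R X)) :=
    Module.Finite.of_restrictScalars_finite K R _
  obtain ⟨n, e, he⟩ := exists_embedding_of_annihilator_eq_bot K hann
  let b := ((Module.finBasis K X).baseChange R).equivFun
  let j : Syzygy K R X →ₗ[R] (Fin (finrank K X) × Fin n → M) :=
    LinearMap.pi fun a => LinearMap.proj a.2 ∘ₗ e ∘ₗ LinearMap.proj a.1 ∘ₗ b.toLinearMap ∘ₗ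
      Syzygy.incl K R X
  have hj : Function.Injective j := by
    intro x y hxy
    apply Syzygy.incl_injective K R X
    apply b.injective
    ext a
    apply he
    ext c
    exact congrFun hxy (a, c)
  exact projective_of_extOneVanishes he
    (fun ι _ N _ _ π hπ => h.extOneVanishes_of_injective hM hj hπ)
    (Syzygy.incl_injective K R (Syzygy K R X)) (mulMap_surjective K R _) (Syzygy.exact K R _)

theorem NoShortCycles.projective_syzygy (h : NoShortCycles.{v, v} R)
    (hM : IsIndecomposable R M) (hann : Module.annihilator R M = ⊥) :
    Module.Projective R (Syzygy K R M) := by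
  have : IsArtinianRing R := IsArtinianRing.of_finite K R
  have : Module.Finite R M := Module.Finite.of_restrictScalars_finite K R M
  have : Module.Finite R (Syzygy K R M) := Module.Finite.of_restrictScalars_finite K R _
  obtain ⟨n, e, he⟩ := exists_embedding_of_annihilator_eq_bot K hann
  have := hM.1
  exact projective_of_extOneVanishes he
    (fun ι _ N _ _ π hπ => h.extOneVanishes_of_ne_zero hM hM (k := LinearMap.id) (fun h0 => by
      obtain ⟨x, hx⟩ := exists_ne (0 : M)
      exact hx (LinearMap.congr_fun h0 x)) hπ)
    (Syzygy.incl_injective K R M) (mulMap_surjective K R _) (Syzygy.exact K R _)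

/-- Indecomposable modules have no self-extensions. -/
theorem NoShortCycles.extOneVanishes_self (h : NoShortCycles.{v, v} R)
    (K : Type w) [Field K] [Algebra K R] [FiniteDimensional K R] [Module.Finite R M]
    (hM : IsIndecomposable R M) : ExtOneVanishes R M M := by
  have : IsArtinianRing R := IsArtinianRing.of_finite K R
  have := hM.1
  exact h.extOneVanishes_of_ne_zero hM hM (k := LinearMap.id) (fun h0 => by
      obtain ⟨x, hx⟩ := exists_ne (0 : M)
      exact hx (LinearMap.congr_fun h0 x)) (π := LinearMap.proj (R := R) (φ := fun _ : Unit => M) ())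
      (fun x => ⟨fun _ => x, rfl⟩)

omit [FiniteDimensional K R] in
theorem NoShortCycles.finrank_end_le (h : NoShortCycles.{v, v} R) (hM : IsIndecomposable R M) :
    finrank K (M →ₗ[R] M) ≤ finrank K M := by
  have : Module.Finite R M := Module.Finite.of_restrictScalars_finite K R M
  have := hM.1
  obtain ⟨m, hm⟩ := exists_ne (0 : M)
  let ev : (M →ₗ[R] M) →ₗ[K] M :=
    { toFun := fun f => f m
      map_add' := fun _ _ => rfl
      map_smul' := fun _ _ => rfl }
  refine LinearMap.finrank_le_finrank_of_injective (f := ev) ?_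
  rw [injective_iff_map_eq_zero]
  intro f hf
  by_contra h0
  exact hm ((h.bijective_of_ne_zero hM h0).1 (by rw [map_zero]; exact hf))

end FaithfulIndecomposable

section ClassVector

open Module TensorProduct

variable {K : Type w} {R : Type v} [Field K] [Ring R] [Algebra K R]

instance finiteDimensional_submodule {X : Type*} [AddCommGroup X] [Module K X]
    [Module R X] [IsScalarTower K R X] [FiniteDimensional K X] (p : Submodule R X) :
    FiniteDimensional K p :=
  FiniteDimensional.of_injective (p.subtype.restrictScalars K) p.injective_subtype

instance finiteDimensional_quotient {X : Type*} [AddCommGroup X] [Module K X]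
    [Module R X] [IsScalarTower K R X] [FiniteDimensional K X] (p : Submodule R X) :
    FiniteDimensional K (X ⧸ p) :=
  Module.Finite.of_surjective (p.mkQ.restrictScalars K) p.mkQ_surjective

variable {ι : Type} [Fintype ι] (S : ι → Type v) [∀ i, AddCommGroup (S i)] [∀ i, Module K (S i)]
  [∀ i, Module R (S i)] [∀ i, IsScalarTower K R (S i)]

variable (K R) in
/-- Dimension and Euler form cannot distinguish `X` from `⨁ᵢ Sᵢ ^ xᵢ`. -/
def HasClass (x : ι → ℕ) (X : Type v) [AddCommGroup X] [Module K X] [Module R X]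
    [IsScalarTower K R X] : Prop :=
  finrank K X = ∑ i, x i * finrank K (S i) ∧
    ∀ (W : Type v) [AddCommGroup W] [Module K W] [Module R W] [IsScalarTower K R W]
      [FiniteDimensional K W],
      eulerForm K R X W = ∑ i, x i * eulerForm K R (S i) W ∧
        eulerForm K R W X = ∑ i, x i * eulerForm K R W (S i)

variable {S} [FiniteDimensional K R] (hgl : SecondSyzygiesProjective K R)
  {X Y Y' Z : Type v} [AddCommGroup X] [Module K X] [Module R X] [IsScalarTower K R X]
  [AddCommGroup Y] [Module K Y] [Module R Y] [IsScalarTower K R Y]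
  [AddCommGroup Y'] [Module K Y'] [Module R Y'] [IsScalarTower K R Y']
  [AddCommGroup Z] [Module K Z] [Module R Z] [IsScalarTower K R Z]
  [FiniteDimensional K X] [FiniteDimensional K Y] [FiniteDimensional K Z] [FiniteDimensional K Y']
  {x z : ι → ℕ}

include hgl

theorem HasClass.add (hX : HasClass K R S x X) (hZ : HasClass K R S z Z)
    {i : X →ₗ[R] Y} {p : Y →ₗ[R] Z} (hi : Function.Injective i)
    (hp : Function.Surjective p) (hip : Function.Exact i p) : HasClass K R S (x + z) Y := by
  refine ⟨?_, fun W _ _ _ _ _ => ⟨?_, ?_⟩⟩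
  · rw [finrank_eq_add_of_exact_s12 hi hp hip, hX.1, hZ.1, ← Finset.sum_add_distrib]
    exact Finset.sum_congr rfl fun i _ => by rw [Pi.add_apply, add_mul]
  · rw [hgl.eulerForm_add_left hi hp hip, (hX.2 W).1, (hZ.2 W).1, ← Finset.sum_add_distrib]
    exact Finset.sum_congr rfl fun i _ => by rw [Pi.add_apply, Nat.cast_add, add_mul]
  · rw [hgl.eulerForm_add_right hi hp hip, (hX.2 W).2, (hZ.2 W).2, ← Finset.sum_add_distrib]
    exact Finset.sum_congr rfl fun i _ => by rw [Pi.add_apply, Nat.cast_add, add_mul]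

theorem HasClass.of_exact_of_exact (hY : HasClass K R S x Y)
    {i : X →ₗ[R] Y} {p : Y →ₗ[R] Z} (hi : Function.Injective i)
    (hp : Function.Surjective p) (hip : Function.Exact i p)
    {i' : X →ₗ[R] Y'} {p' : Y' →ₗ[R] Z} (hi' : Function.Injective i')
    (hp' : Function.Surjective p') (hip' : Function.Exact i' p') : HasClass K R S x Y' := by
  refine ⟨?_, fun W _ _ _ _ _ => ⟨?_, ?_⟩⟩
  · rw [← hY.1, finrank_eq_add_of_exact_s12 hi hp hip, finrank_eq_add_of_exact_s12 hi' hp' hip']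
  · rw [← (hY.2 W).1, hgl.eulerForm_add_left hi hp hip, hgl.eulerForm_add_left hi' hp' hip']
  · rw [← (hY.2 W).2, hgl.eulerForm_add_right hi hp hip, hgl.eulerForm_add_right hi' hp' hip']

theorem hasClass_zero [Subsingleton X] : HasClass K R S 0 X := by
  have h1 : Function.Exact (LinearMap.id : X →ₗ[R] X) (LinearMap.id : X →ₗ[R] X) := fun y =>
    ⟨fun _ => ⟨y, rfl⟩, fun _ => Subsingleton.elim _ _⟩
  refine ⟨?_, fun W _ _ _ _ _ => ⟨?_, ?_⟩⟩
  · simp [finrank_zero_of_subsingleton]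
  · have := hgl.eulerForm_add_left (N := W) Function.injective_id Function.surjective_id h1
    simpa using this
  · have := hgl.eulerForm_add_right (N := W) Function.injective_id Function.surjective_id h1
    simpa using this

theorem HasClass.of_linearEquiv (hX : HasClass K R S x X) (e : X ≃ₗ[R] Y) :
    HasClass K R S x Y := by
  have := hX.add hgl (hasClass_zero (X := PUnit) hgl) (p := 0) e.injective
    (fun y => ⟨0, Subsingleton.elim _ _⟩) (fun y => ⟨fun _ => e.surjective y,
      fun _ => Subsingleton.elim _ _⟩)
  rwa [add_zero] at this

variable [∀ i, FiniteDimensional K (S i)]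

omit [FiniteDimensional K R] hgl [∀ (i : ι), FiniteDimensional K (S i)] in
theorem hasClass_single [DecidableEq ι] (i : ι) : HasClass K R S (Pi.single i 1) (S i) := by
  refine ⟨?_, fun W _ _ _ _ _ => ⟨?_, ?_⟩⟩ <;> simp [Pi.single_apply]

theorem exists_hasClass (hS : ∀ (T : Type v) [AddCommGroup T] [Module R T], IsSimpleModule R T →
    ∃ i, Nonempty (S i ≃ₗ[R] T)) (X : Type v) [AddCommGroup X] [Module K X] [Module R X]
    [IsScalarTower K R X] [FiniteDimensional K X] : ∃ x, HasClass K R S x X := by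
  classical
  induction hn : finrank K X using Nat.strong_induction_on generalizing X with
  | _ n ih =>
    rcases subsingleton_or_nontrivial X with hX | hX
    · exact ⟨0, hasClass_zero hgl⟩
    · have : IsArtinianRing R := IsArtinianRing.of_finite K R
      have : Module.Finite R X := Module.Finite.of_restrictScalars_finite K R _
      obtain ⟨T, hT, -⟩ := (eq_bot_or_exists_atom_le (⊤ : Submodule R X)).resolve_left top_ne_bot
      have hsim : IsSimpleModule R T := isSimpleModule_iff_isAtom.2 hT
      obtain ⟨i, ⟨e⟩⟩ := hS T hsim
      have hex : Function.Exact T.subtype T.mkQ := LinearMap.exact_subtype_mkQ T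
      have hd := finrank_eq_add_of_exact_s12 (K := K) T.injective_subtype T.mkQ_surjective hex
      have : Nontrivial T := IsSimpleModule.nontrivial R T
      have : 0 < finrank K T := finrank_pos
      obtain ⟨z, hz⟩ := ih (finrank K (X ⧸ T)) (by omega) (X ⧸ T) rfl
      exact ⟨_, ((hasClass_single i).of_linearEquiv hgl e).add hgl hz T.injective_subtype
        T.mkQ_surjective hex⟩

theorem exists_module_hasClass (x : ι → ℕ) :
    ∃ (X : Type v) (_ : AddCommGroup X) (_ : Module K X) (_ : Module R X)
      (_ : IsScalarTower K R X) (_ : FiniteDimensional K X), HasClass K R S x X := by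
  classical
  induction hn : ∑ i, x i generalizing x with
  | zero =>
    have : x = 0 := by
      ext i
      exact (Finset.sum_eq_zero_iff.1 hn) i (Finset.mem_univ i)
    subst this
    exact ⟨PUnit, inferInstance, inferInstance, inferInstance, inferInstance, inferInstance,
      hasClass_zero hgl⟩
  | succ n ih =>
    obtain ⟨i, -, hi⟩ : ∃ i ∈ Finset.univ, x i ≠ 0 :=
      Finset.exists_ne_zero_of_sum_ne_zero (by omega)
    have hx : x = Pi.single i 1 + (x - Pi.single i 1) := by
      ext j
      rcases eq_or_ne j i with rfl | hj
      · simp; omega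
      · simp [hj]
    have hsum : ∑ j, (x - Pi.single i 1 : ι → ℕ) j = n := by
      have h1 : ∑ j, x j = ∑ j, ((Pi.single i 1 : ι → ℕ) + (x - Pi.single i 1) : ι → ℕ) j := by rw [← hx]
      simp only [Pi.add_apply, Finset.sum_add_distrib, Finset.sum_pi_single', Finset.mem_univ,
        if_true] at h1
      rw [hn] at h1
      omega
    obtain ⟨X, _, _, _, _, _, hX⟩ := ih _ hsum
    refine ⟨S i × X, inferInstance, inferInstance, inferInstance, inferInstance, inferInstance, ?_⟩
    rw [hx]
    exact (hasClass_single i).add hgl hX (i := LinearMap.inl R _ _) (p := LinearMap.snd R _ _)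
      LinearMap.inl_injective LinearMap.snd_surjective .inl_snd

end ClassVector

section WeakPositivity

open Module TensorProduct

theorem ExtOneVanishes.of_retract {R : Type u} [Ring R] {X Y N : Type v} [AddCommGroup X]
    [Module R X] [AddCommGroup Y] [Module R Y] [AddCommGroup N] [Module R N]
    (h : ExtOneVanishes R X N) {s : Y →ₗ[R] X} {r : X →ₗ[R] Y} (hrs : r ∘ₗ s = LinearMap.id) :
    ExtOneVanishes R Y N := by
  intro E E' _ _ _ _ i p hi hp hip f
  obtain ⟨g, hg⟩ := h E E' i p hi hp hip (f ∘ₗ r)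
  refine ⟨g ∘ₗ s, ?_⟩
  rw [← LinearMap.comp_assoc, hg, LinearMap.comp_assoc, hrs, LinearMap.comp_id]

variable {K : Type w} {R : Type v} [Field K] [Ring R] [Algebra K R]
  {ι : Type} [Fintype ι] {S : ι → Type v} [∀ i, AddCommGroup (S i)] [∀ i, Module K (S i)]
  [∀ i, Module R (S i)] [∀ i, IsScalarTower K R (S i)]
  [FiniteDimensional K R]
  {N A B : Type v} [AddCommGroup N] [Module K N] [Module R N] [IsScalarTower K R N]
  [AddCommGroup A] [Module K A] [Module R A] [IsScalarTower K R A]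
  [AddCommGroup B] [Module K B] [Module R B] [IsScalarTower K R B]
  [FiniteDimensional K N] [FiniteDimensional K A] [FiniteDimensional K B]
  {x : ι → ℕ}

section Prod

omit [FiniteDimensional K R]

theorem LinearEquiv.exact_inl_snd {R : Type*} [Ring R] {N A B : Type*} [AddCommGroup N] [Module R N]
    [AddCommGroup A] [Module R A] [AddCommGroup B] [Module R B] (e : N ≃ₗ[R] A × B) :
    Function.Injective (e.symm.toLinearMap ∘ₗ LinearMap.inl R A B) ∧
    Function.Surjective (LinearMap.snd R A B ∘ₗ e.toLinearMap) ∧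
    Function.Exact (e.symm.toLinearMap ∘ₗ LinearMap.inl R A B)
      (LinearMap.snd R A B ∘ₗ e.toLinearMap) := by
  refine ⟨e.symm.injective.comp LinearMap.inl_injective,
    (LinearMap.snd_surjective (R := R) (M := A) (M₂ := B)).comp e.surjective, fun y => ⟨fun hy => ⟨(e y).1, ?_⟩, ?_⟩⟩
  · apply e.injective
    simp only [LinearMap.comp_apply, LinearEquiv.coe_coe, LinearEquiv.apply_symm_apply]
    exact Prod.ext rfl hy.symm
  · rintro ⟨a, rfl⟩
    simp

theorem finrank_hom_prod_right (e : N ≃ₗ[R] A × B) {W : Type v} [AddCommGroup W] [Module K W] [Module R W]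
    [IsScalarTower K R W] [FiniteDimensional K W] : finrank K (W →ₗ[R] N) =
      finrank K (W →ₗ[R] A) + finrank K (W →ₗ[R] B) :=
  finrank_hom_eq_add' e.exact_inl_snd.1 e.exact_inl_snd.2.2
    (fun f => ⟨e.symm.toLinearMap ∘ₗ LinearMap.inr R A B ∘ₗ f, by ext; simp⟩)

theorem finrank_hom_prod_left (e : N ≃ₗ[R] A × B) {W : Type v} [AddCommGroup W] [Module K W] [Module R W]
    [IsScalarTower K R W] [FiniteDimensional K W] : finrank K (N →ₗ[R] W) =
      finrank K (B →ₗ[R] W) + finrank K (A →ₗ[R] W) :=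
  finrank_hom_eq_add e.exact_inl_snd.2.1 e.exact_inl_snd.2.2
    (fun f => ⟨f ∘ₗ LinearMap.fst R A B ∘ₗ e.toLinearMap, by ext; simp⟩)

end Prod

variable (hgl : SecondSyzygiesProjective K R)

include hgl

theorem HasClass.extOneVanishes_of_minimal (hN : HasClass K R S x N)
    (hmin : ∀ (E : Type v) [AddCommGroup E] [Module K E] [Module R E] [IsScalarTower K R E]
      [FiniteDimensional K E], HasClass K R S x E →
        finrank K (N →ₗ[R] N) ≤ finrank K (E →ₗ[R] E))
    (e : N ≃ₗ[R] A × B) : ExtOneVanishes R B A := by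
  apply ExtOneVanishes.of_splits
  intro E _ _ i p hi hp hip
  by_contra hcon
  push Not at hcon
  let := Module.compHom E (algebraMap K R)
  have : IsScalarTower K R E := ⟨fun a b c => by
    rw [Algebra.smul_def, mul_smul]; rfl⟩
  have : FiniteDimensional K E := by
    have : Module.Finite R A := Module.Finite.of_restrictScalars_finite K R _
    have : Module.Finite R B := Module.Finite.of_restrictScalars_finite K R _
    have := Module.Finite.of_exact hip hp
    exact Module.Finite.trans R E
  have hE := hN.of_exact_of_exact hgl e.exact_inl_snd.1 e.exact_inl_snd.2.1 e.exact_inl_snd.2.2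
    hi hp hip
  have h1 := hmin E hE
  have h2 := finrank_hom_lt_add' (K := K) hi hip hcon
  have h3 := finrank_hom_le_add K E hp hip
  have h4 := finrank_hom_le_add' K A hi hip
  rw [finrank_hom_prod_right e, finrank_hom_prod_left e, finrank_hom_prod_left e] at h1
  omega

theorem eulerForm_prod (e : N ≃ₗ[R] A × B) : eulerForm K R N N =
    eulerForm K R A A + eulerForm K R A B + eulerForm K R B A + eulerForm K R B B := by
  obtain ⟨h1, h2, h3⟩ := e.exact_inl_snd
  rw [hgl.eulerForm_add_left h1 h2 h3, hgl.eulerForm_add_right h1 h2 h3,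
    hgl.eulerForm_add_right h1 h2 h3]
  ring

theorem eulerForm_self_pos (hself : ∀ (M : Type v) [AddCommGroup M] [Module R M]
      [Module.Finite R M], IsIndecomposable R M → ExtOneVanishes R M M)
    (N : Type v) [AddCommGroup N] [Module K N] [Module R N] [IsScalarTower K R N]
    [FiniteDimensional K N] [Nontrivial N]
    (hN : ∀ (A B : Type v) [AddCommGroup A] [Module K A] [Module R A] [IsScalarTower K R A]
      [FiniteDimensional K A] [AddCommGroup B] [Module K B] [Module R B] [IsScalarTower K R B]
      [FiniteDimensional K B], (N ≃ₗ[R] A × B) → ExtOneVanishes R B A) :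
    0 < eulerForm K R N N := by
  induction hn : finrank K N using Nat.strong_induction_on generalizing N with
  | _ n ih =>
    by_cases hind : IsIndecomposable R N
    · have : Module.Finite R N := Module.Finite.of_restrictScalars_finite K R _
      have h1 := (hself N hind).finrank_hom_le_eulerForm K
      have : Nontrivial (N →ₗ[R] N) := by
        obtain ⟨y, hy⟩ := exists_ne (0 : N)
        exact ⟨LinearMap.id, 0, fun h => hy (LinearMap.congr_fun h y)⟩
      have h2 : 0 < finrank K (N →ₗ[R] N) := finrank_pos
      omega
    · obtain ⟨p, q, hpq, hp, hq⟩ : ∃ p q : Submodule R N, IsCompl p q ∧ p ≠ ⊥ ∧ q ≠ ⊥ := by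
        by_contra hcon
        refine hind ⟨inferInstance, fun p q hpq => ?_⟩
        by_contra h
        rw [not_or] at h
        exact hcon ⟨p, q, hpq, h⟩
      let e : N ≃ₗ[R] p × q := (Submodule.prodEquivOfIsCompl p q hpq).symm
      let e' : N ≃ₗ[R] q × p := (Submodule.prodEquivOfIsCompl q p hpq.symm).symm
      have hdim := finrank_eq_add_of_exact_s12 (K := K) e.exact_inl_snd.1 e.exact_inl_snd.2.1
        e.exact_inl_snd.2.2
      have hp' : Nontrivial p := Submodule.nontrivial_iff_ne_bot.2 hp
      have hq' : Nontrivial q := Submodule.nontrivial_iff_ne_bot.2 hq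
      have h1 : 0 < finrank K p := finrank_pos
      have h2 : 0 < finrank K q := finrank_pos
      have key : ∀ (P Q : Submodule R N) (e : N ≃ₗ[R] P × Q) [Nontrivial P],
          finrank K P < n → 0 < eulerForm K R P P := by
        intro P Q e _ hP
        refine ih _ hP P ?_ rfl
        intro A B _ _ _ _ _ _ _ _ _ _ e₁
        have := hN A (B × Q) (e ≪≫ₗ e₁.prodCongr (LinearEquiv.refl R Q) ≪≫ₗ
          LinearEquiv.prodAssoc R A B Q)
        exact this.of_retract (s := LinearMap.inl R B Q) (r := LinearMap.fst R B Q) (by ext; simp)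
      have k1 := key p q e (by omega)
      have k2 := key q p e' (by omega)
      have k3 := (hN p q e).finrank_hom_le_eulerForm K
      have k4 := (hN q p e').finrank_hom_le_eulerForm K
      rw [eulerForm_prod hgl e]
      omega

variable [∀ i, FiniteDimensional K (S i)] [∀ i, Nontrivial (S i)]

theorem sum_eulerForm_pos (hself : ∀ (M : Type v) [AddCommGroup M] [Module R M]
      [Module.Finite R M], IsIndecomposable R M → ExtOneVanishes R M M)
    (hx : x ≠ 0) : 0 < ∑ i, ∑ j, (x i : ℤ) * x j * eulerForm K R (S i) (S j) := by
  classical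
  let P : ℕ → Prop := fun d => ∃ (X : Type v) (_ : AddCommGroup X) (_ : Module K X)
    (_ : Module R X) (_ : IsScalarTower K R X) (_ : FiniteDimensional K X),
    HasClass K R S x X ∧ finrank K (X →ₗ[R] X) = d
  have hP : ∃ d, P d := by
    obtain ⟨X, _, _, _, _, _, hX⟩ := exists_module_hasClass (S := S) hgl x
    exact ⟨_, X, inferInstance, inferInstance, inferInstance, inferInstance, inferInstance, hX, rfl⟩
  obtain ⟨N, _, _, _, _, _, hN, hd⟩ := Nat.find_spec hP
  have hmin : ∀ (E : Type v) [AddCommGroup E] [Module K E] [Module R E] [IsScalarTower K R E]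
      [FiniteDimensional K E], HasClass K R S x E →
        finrank K (N →ₗ[R] N) ≤ finrank K (E →ₗ[R] E) := by
    intro E _ _ _ _ _ hE
    rw [hd]
    exact Nat.find_min' hP ⟨E, inferInstance, inferInstance, inferInstance, inferInstance,
      inferInstance, hE, rfl⟩
  have hnt : Nontrivial N := by
    obtain ⟨i, hi⟩ := Function.ne_iff.1 hx
    have h1 : 0 < finrank K (S i) := finrank_pos
    have h2 : x i * finrank K (S i) ≤ ∑ j, x j * finrank K (S j) :=
      Finset.single_le_sum (f := fun j => x j * finrank K (S j)) (fun _ _ => Nat.zero_le _)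
        (Finset.mem_univ i)
    have h3 : 0 < x i := Nat.pos_of_ne_zero hi
    refine Module.nontrivial_of_finrank_pos (R := K) ?_
    rw [hN.1]
    exact (Nat.mul_pos h3 h1).trans_le h2
  have := eulerForm_self_pos hgl hself N (fun A B _ _ _ _ _ _ _ _ _ _ e =>
    hN.extOneVanishes_of_minimal hgl hmin e)
  rw [(hN.2 N).1] at this
  simp only [(hN.2 (S _)).2, Finset.mul_sum] at this
  simpa only [mul_assoc] using this

end WeakPositivity

section QuadraticForm

open Finset

variable {ι : Type*} [Fintype ι]

theorem exists_rat_same_relations (z : ι → ℝ) :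
    ∃ y : ι → ℚ, (∀ i, 0 < z i → 0 < y i) ∧ (∀ i, z i = 0 → y i = 0) ∧
      ∀ a : ι → ℤ, ∑ i, (a i : ℝ) * z i = 0 → ∑ i, (a i : ℚ) * y i = 0 := by
  let V := Submodule.span ℚ (Set.range z)
  have : FiniteDimensional ℚ V := FiniteDimensional.span_of_finite ℚ (Set.finite_range z)
  let β := Module.finBasis ℚ V
  let ζ : ι → V := fun i => ⟨z i, Submodule.subset_span ⟨i, rfl⟩⟩
  have hz : ∀ i, z i = ∑ k, (β.repr (ζ i) k : ℝ) * (β k : ℝ) := by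
    intro i
    have h := congrArg Subtype.val (β.sum_repr (ζ i))
    simp only [AddSubmonoidClass.coe_finsetSum, Submodule.coe_smul, Rat.smul_def] at h
    exact h.symm
  have hopen : IsOpen {u : Fin (Module.finrank ℚ V) → ℝ |
      ∀ i, 0 < z i → 0 < ∑ k, (β.repr (ζ i) k : ℝ) * u k} := by
    simp only [Set.ofPred_forall]
    refine isOpen_iInter_of_finite fun i => isOpen_iInter_of_finite fun _ => ?_
    exact isOpen_lt continuous_const (by fun_prop)
  obtain ⟨ε, hε, hball⟩ := Metric.isOpen_iff.1 hopen (fun k => (β k : ℝ))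
    (fun i hi => by rwa [← hz])
  have hq : ∀ k, ∃ q : ℚ, dist (q : ℝ) (β k : ℝ) < ε := fun k => by
    obtain ⟨q, h1, h2⟩ := exists_rat_btwn (show (β k : ℝ) - ε < β k by linarith)
    exact ⟨q, by rw [Real.dist_eq, abs_sub_lt_iff]; constructor <;> linarith⟩
  choose u hu using hq
  have hu' := hball (show (fun k => (u k : ℝ)) ∈ Metric.ball _ ε by
    rw [Metric.mem_ball, dist_pi_lt_iff hε]; exact hu)
  let θ : V →ₗ[ℚ] ℚ := β.constr ℚ u
  have hθ : ∀ i, θ (ζ i) = ∑ k, β.repr (ζ i) k * u k := fun i => by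
    simp only [θ, Module.Basis.constr_apply_fintype, smul_eq_mul, Module.Basis.equivFun_apply]
  refine ⟨fun i => θ (ζ i), fun i hi => ?_, fun i hi => ?_, fun a ha => ?_⟩
  · have : 0 < ∑ k, (β.repr (ζ i) k : ℝ) * (u k : ℝ) := hu' i hi
    change 0 < θ (ζ i)
    rw [hθ]
    exact_mod_cast this
  · have : ζ i = 0 := Subtype.ext hi
    change θ (ζ i) = 0
    rw [this, map_zero]
  · have : ∑ i, (a i : ℚ) • ζ i = 0 := by
      apply Subtype.ext
      simp only [AddSubmonoidClass.coe_finsetSum, Submodule.coe_smul, Rat.smul_def]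
      simpa using ha
    have h2 := congrArg θ this
    simpa only [map_sum, map_smul, smul_eq_mul, map_zero] using h2

variable {b : ι → ι → ℤ} (hpos : ∀ x : ι → ℕ, x ≠ 0 → 0 < ∑ i, ∑ j, (x i : ℤ) * x j * b i j)

include hpos

theorem quadratic_pos_of_rat {y : ι → ℚ} (hy : ∀ i, 0 ≤ y i) (hy0 : y ≠ 0) :
    0 < ∑ i, ∑ j, y i * y j * b i j := by
  let D : ℕ := ∏ i, (y i).den
  have hD : 0 < D := Finset.prod_pos fun i _ => (y i).den_pos
  have hx : ∀ i, ∃ k : ℕ, (k : ℚ) = D * y i := by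
    intro i
    obtain ⟨c, hc⟩ : (y i).den ∣ D := Finset.dvd_prod_of_mem _ (Finset.mem_univ i)
    obtain ⟨m, hm⟩ := Int.eq_ofNat_of_zero_le (Rat.num_nonneg.2 (hy i))
    refine ⟨c * m, ?_⟩
    have h1 : ((y i).den : ℚ) * y i = m := by
      rw [Rat.den_mul_eq_num, hm]; rfl
    rw [hc]
    push_cast
    rw [← h1]
    ring
  choose x hx using hx
  have hx0 : x ≠ 0 := by
    rintro rfl
    apply hy0
    ext i
    have := hx i
    simp only [Pi.zero_apply, Nat.cast_zero] at this
    have hD' : (D : ℚ) ≠ 0 := by positivity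
    simpa [hD'] using this.symm
  have h1 := hpos x hx0
  have h2 : ((∑ i, ∑ j, (x i : ℤ) * x j * b i j : ℤ) : ℚ) =
      (D : ℚ) ^ 2 * ∑ i, ∑ j, y i * y j * b i j := by
    push_cast
    simp only [hx, Finset.mul_sum]
    exact Finset.sum_congr rfl fun i _ => Finset.sum_congr rfl fun j _ => by ring
  have h3 : (0 : ℚ) < (D : ℚ) ^ 2 * ∑ i, ∑ j, y i * y j * b i j := by
    rw [← h2]; exact_mod_cast h1
  exact pos_of_mul_pos_right h3 (by positivity)

theorem quadratic_nonneg_of_real {z : ι → ℝ} (hz : ∀ i, 0 ≤ z i) :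
    0 ≤ ∑ i, ∑ j, z i * z j * b i j := by
  by_contra! hneg
  have hopen : IsOpen {z : ι → ℝ | ∑ i, ∑ j, z i * z j * b i j < 0} :=
    isOpen_lt (by fun_prop) continuous_const
  obtain ⟨ε, hε, hball⟩ := Metric.isOpen_iff.1 hopen z hneg
  have hq : ∀ i, ∃ q : ℚ, z i < q ∧ (q : ℝ) < z i + ε := fun i => exists_rat_btwn (by linarith)
  choose y hy using hq
  have h1 := hball (show (fun i => (y i : ℝ)) ∈ Metric.ball z ε by
    rw [Metric.mem_ball, dist_pi_lt_iff hε]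
    intro i
    rw [Real.dist_eq, abs_sub_lt_iff]
    constructor <;> linarith [hy i])
  have hy1 : ∀ i, 0 < y i := fun i => by
    have := (hz i).trans_lt (hy i).1
    exact_mod_cast this
  have hne : y ≠ 0 := by
    rintro rfl
    have : IsEmpty ι := ⟨fun i => (hy1 i).ne rfl⟩
    simp at hneg
  have h2 := quadratic_pos_of_rat hpos (fun i => (hy1 i).le) hne
  have h1' : ∑ i, ∑ j, (y i : ℝ) * y j * b i j < 0 := h1
  have h3 : (∑ i, ∑ j, y i * y j * b i j : ℚ) < 0 := by exact_mod_cast h1'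
  exact absurd h2 h3.not_gt

theorem quadratic_pos_of_real {z : ι → ℝ} (hz : ∀ i, 0 ≤ z i) (hz0 : z ≠ 0) :
    0 < ∑ i, ∑ j, z i * z j * b i j := by
  classical
  refine (quadratic_nonneg_of_real hpos hz).lt_of_ne fun hQ => ?_
  have hgrad : ∀ i, 0 < z i → ∑ j, ((b i j + b j i : ℤ) : ℝ) * z j = 0 := by
    intro i hi
    set L := ∑ j, ((b i j + b j i : ℤ) : ℝ) * z j with hL
    have hvar : ∀ t : ℝ, -z i ≤ t → 0 ≤ t * L + t ^ 2 * b i i := by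
      intro t ht
      have h := quadratic_nonneg_of_real hpos (z := fun j => z j + t * (if j = i then 1 else 0))
        (fun j => by
          split_ifs with hj
          · subst hj; linarith
          · simpa using hz j)
      have hexp : ∑ k, ∑ j, (z k + t * (if k = i then 1 else 0)) *
          (z j + t * (if j = i then 1 else 0)) * b k j =
          ∑ k, ∑ j, z k * z j * b k j + (t * L + t ^ 2 * b i i) := by
        have : ∀ k j, (z k + t * (if k = i then 1 else 0)) *
          (z j + t * (if j = i then 1 else 0)) * b k j = z k * z j * b k j +
          (if k = i then t * (z j * b k j) else 0) + (if j = i then t * (z k * b k j) else 0) +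
          (if k = i then if j = i then t ^ 2 * b k j else 0 else 0) := by
          intro k j
          split_ifs <;> ring
        simp only [this, Finset.sum_add_distrib]
        have e1 : ∑ k, ∑ j, (if k = i then t * (z j * b k j) else 0) = ∑ j, t * (z j * b i j) := by
          rw [Finset.sum_comm]
          simp
        have e2 : ∑ k, ∑ j, (if j = i then t * (z k * b k j) else 0) =
            ∑ k, t * (z k * b k i) := by simp
        have e3 : ∑ k, ∑ j, (if k = i then if j = i then t ^ 2 * (b k j : ℝ) else 0 else 0) =
            t ^ 2 * b i i := by
          rw [Finset.sum_comm]
          simp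
        have e4 : ∑ j, t * (z j * b i j) + ∑ k, t * (z k * b k i) = t * L := by
          rw [hL, Finset.mul_sum, ← Finset.sum_add_distrib]
          exact Finset.sum_congr rfl fun j _ => by push_cast; ring
        rw [e1, e2, e3, ← e4]
        ring
      rw [hexp, ← hQ, zero_add] at h
      exact h
    have hbound : ∀ s : ℝ, 0 < s → s ≤ z i → |L| ≤ s * b i i := by
      intro s hs hsz
      have h1 := hvar s (by linarith)
      have h2 := hvar (-s) (by linarith)
      refine abs_le.2 ⟨?_, ?_⟩
      · have : 0 ≤ s * (L + s * b i i) := by linarith [h1]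
        linarith [nonneg_of_mul_nonneg_right this hs]
      · have : 0 ≤ s * (-L + s * b i i) := by linarith [h2]
        linarith [nonneg_of_mul_nonneg_right this hs]
    by_contra hL0
    have hLpos : 0 < |L| := abs_pos.2 hL0
    have hb : (0 : ℝ) < b i i := by
      have := hLpos.trans_le (hbound (z i) hi le_rfl)
      exact pos_of_mul_pos_right this hi.le
    have h1 := hbound (min (z i) (|L| / (2 * b i i))) (lt_min hi (by positivity)) (min_le_left _ _)
    have h2 : min (z i) (|L| / (2 * b i i)) * b i i ≤ |L| / (2 * b i i) * b i i :=
      mul_le_mul_of_nonneg_right (min_le_right _ _) hb.le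
    have h3 : |L| / (2 * b i i) * b i i = |L| / 2 := by field_simp
    linarith
  obtain ⟨y, hy1, hy2, hy3⟩ := exists_rat_same_relations z
  have hy : ∀ i, 0 ≤ y i := fun i => (hz i).eq_or_lt.elim (fun h => (hy2 i h.symm).ge)
    (fun h => (hy1 i h).le)
  have hy0 : y ≠ 0 := by
    obtain ⟨i, hi⟩ := Function.ne_iff.1 hz0
    have := hy1 i ((hz i).lt_of_ne' hi)
    exact fun h => this.ne' (congrFun h i)
  have h1 := quadratic_pos_of_rat hpos hy hy0
  have h2 : ∑ i, y i * ∑ j, ((b i j + b j i : ℤ) : ℚ) * y j = 0 := by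
    refine Finset.sum_eq_zero fun i _ => ?_
    rcases (hz i).eq_or_lt with h | h
    · rw [hy2 i h.symm, zero_mul]
    · rw [hy3 _ (hgrad i h), mul_zero]
  have h3 : ∑ i, ∑ j, y i * y j * b i j = ∑ i, ∑ j, y i * y j * (b j i : ℚ) := by
    rw [Finset.sum_comm]
    exact Finset.sum_congr rfl fun i _ => Finset.sum_congr rfl fun j _ => by ring
  have h4 : ∑ i, y i * ∑ j, ((b i j + b j i : ℤ) : ℚ) * y j =
      ∑ i, ∑ j, y i * y j * b i j + ∑ i, ∑ j, y i * y j * (b j i : ℚ) := by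
    simp only [Finset.mul_sum, ← Finset.sum_add_distrib]
    exact Finset.sum_congr rfl fun i _ => Finset.sum_congr rfl fun j _ => by push_cast; ring
  rw [h4, ← h3] at h2
  linarith

theorem finite_setOf_quadratic_le (w : ι → ℕ) :
    {x : ι → ℕ | ∑ i, ∑ j, (x i : ℤ) * x j * b i j ≤ ∑ i, (x i : ℤ) * w i}.Finite := by
  classical
  rcases isEmpty_or_nonempty ι with hι | hι
  · exact Set.toFinite _
  let Q : (ι → ℝ) → ℝ := fun z => ∑ i, ∑ j, z i * z j * b i j
  have hQ : Continuous Q := by fun_prop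
  let C : Set (ι → ℝ) := Metric.sphere 0 1 ∩ {z | ∀ i, 0 ≤ z i}
  have hC : IsCompact C := by
    refine (isCompact_sphere _ _).inter_right ?_
    simp only [Set.ofPred_forall]
    exact isClosed_iInter fun i => isClosed_le continuous_const (continuous_apply i)
  have hCne : C.Nonempty := ⟨fun _ => 1, by simp [pi_norm_const], fun _ => zero_le_one⟩
  obtain ⟨z₀, hz₀, hmin⟩ := hC.exists_isMinOn hCne hQ.continuousOn
  have hc : 0 < Q z₀ := quadratic_pos_of_real hpos hz₀.2 (by
    rintro rfl
    simpa using hz₀.1)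
  have hle : ∀ z : ι → ℝ, (∀ i, 0 ≤ z i) → z ≠ 0 → Q z₀ * ‖z‖ ^ 2 ≤ Q z := by
    intro z hz hz0
    have hn : 0 < ‖z‖ := norm_pos_iff.2 hz0
    have h1 : ‖z‖⁻¹ • z ∈ C := by
      refine ⟨?_, fun i => ?_⟩
      · rw [mem_sphere_zero_iff_norm, norm_smul, norm_inv, norm_norm, inv_mul_cancel₀ hn.ne']
      · have := hz i
        simp only [Pi.smul_apply, smul_eq_mul]
        positivity
    have h2 : Q z₀ ≤ Q (‖z‖⁻¹ • z) := hmin h1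
    have h3 : Q (‖z‖⁻¹ • z) * ‖z‖ ^ 2 = Q z := by
      simp only [Q, Pi.smul_apply, smul_eq_mul, Finset.sum_mul]
      refine Finset.sum_congr rfl fun i _ => Finset.sum_congr rfl fun j _ => ?_
      field_simp
    rw [← h3]
    exact mul_le_mul_of_nonneg_right h2 (by positivity)
  let B := (∑ i, (w i : ℝ)) / Q z₀
  refine (Set.finite_Iic (fun _ : ι => ⌊B⌋₊)).subset fun x hx i => ?_
  rcases eq_or_ne x 0 with rfl | hx0
  · exact Nat.zero_le _
  refine Nat.le_floor ?_
  let z : ι → ℝ := fun i => x i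
  have hz0 : z ≠ 0 := fun h => hx0 (by
    ext i
    have : (x i : ℝ) = 0 := congrFun h i
    exact_mod_cast this)
  have hn : 0 < ‖z‖ := norm_pos_iff.2 hz0
  have h1 := hle z (fun i => Nat.cast_nonneg _) hz0
  have hxi : ∀ i, (x i : ℝ) ≤ ‖z‖ := fun i => by
    have := norm_le_pi_norm z i
    simpa [z] using this
  have h2 : Q z ≤ ∑ i, (x i : ℝ) * w i := by
    have : ∑ i, ∑ j, (x i : ℤ) * x j * b i j ≤ ∑ i, (x i : ℤ) * w i := hx
    simp only [Q, z]
    exact_mod_cast this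
  have h3 : ∑ i, (x i : ℝ) * w i ≤ ‖z‖ * ∑ i, (w i : ℝ) := by
    rw [Finset.mul_sum]
    exact Finset.sum_le_sum fun i _ => mul_le_mul_of_nonneg_right (hxi i) (Nat.cast_nonneg _)
  have h4 : Q z₀ * ‖z‖ ≤ ∑ i, (w i : ℝ) := by
    have : ‖z‖ * (Q z₀ * ‖z‖) ≤ ‖z‖ * ∑ i, (w i : ℝ) := by nlinarith
    exact le_of_mul_le_mul_left this hn
  refine (hxi i).trans ?_
  rw [le_div_iff₀ hc]
  linarith

end QuadraticForm

section FiniteIsoClasses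

open Module

/-- Finitely many isomorphism classes of modules satisfy `P`. -/
def FinitelyManyIsoClasses {R : Type u} [Ring R] (P : ModuleCat.{v} R → Prop) : Prop :=
  ∃ (κ : Type) (_ : Finite κ) (V : κ → ModuleCat.{v} R), ∀ M, P M → ∃ k, Nonempty (M ≃ₗ[R] V k)

theorem FinitelyManyIsoClasses.of_invariant {R : Type u} [Ring R] {P : ModuleCat.{v} R → Prop}
    {α : Type} {s : Set α} (hs : s.Finite) {r : α → ModuleCat.{v} R → Prop}
    (h : ∀ M, P M → ∃ a ∈ s, r a M)
    (hr : ∀ a M N, P M → P N → r a M → r a N → Nonempty (M ≃ₗ[R] N)) :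
    FinitelyManyIsoClasses P := by
  have hV : ∀ a : s, ∃ N, (∃ N', P N' ∧ r a N') → P N ∧ r a N := fun a => by
    by_cases ha : ∃ N', P N' ∧ r a N'
    · exact ⟨ha.choose, fun _ => ha.choose_spec⟩
    · exact ⟨ModuleCat.of R PUnit, fun ha' => (ha ha').elim⟩
  choose V hV using hV
  refine ⟨s, hs, V, fun M hM => ?_⟩
  obtain ⟨a, has, haM⟩ := h M hM
  obtain ⟨hP, hr'⟩ := hV ⟨a, has⟩ ⟨M, hM, haM⟩
  exact ⟨⟨a, has⟩, hr a _ _ hM hP haM hr'⟩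

theorem FinitelyManyIsoClasses.of_finite_cover {R : Type u} [Ring R] {P : ModuleCat.{v} R → Prop}
    {α : Type} [Finite α] {r : α → ModuleCat.{v} R → Prop} (h : ∀ M, P M → ∃ a, r a M)
    (hr : ∀ a, FinitelyManyIsoClasses fun M => P M ∧ r a M) :
    FinitelyManyIsoClasses P := by
  choose κ hκ V hV using hr
  refine ⟨Σ a, κ a, inferInstance, fun t => V t.1 t.2, fun M hM => ?_⟩
  obtain ⟨a, ha⟩ := h M hM
  obtain ⟨k, hk⟩ := hV a M ⟨hM, ha⟩
  exact ⟨⟨a, k⟩, hk⟩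

variable {K : Type w} {R : Type v} [Field K] [Ring R] [Algebra K R]

variable (K) in
theorem exists_simple_family_of_nonzero_hom [FiniteDimensional K R] (X : Type v) [AddCommGroup X]
    [Module K X] [Module R X] [IsScalarTower K R X] [FiniteDimensional K X] :
    ∃ (ι : Type) (_ : Fintype ι) (S : ι → ModuleCat.{v} R), (∀ i, IsSimpleModule R (S i)) ∧
      ∀ (T : Type v) [AddCommGroup T] [Module R T], IsSimpleModule R T →
        ∀ f : X →ₗ[R] T, f ≠ 0 → ∃ i, Nonempty (S i ≃ₗ[R] T) := by
  induction hn : finrank K X using Nat.strong_induction_on generalizing X with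
  | _ n ih =>
    rcases subsingleton_or_nontrivial X with hX | hX
    · exact ⟨Empty, inferInstance, Empty.elim, fun i => i.elim, fun T _ _ _ f hf =>
        (hf (Subsingleton.elim _ _)).elim⟩
    · have : IsArtinianRing R := IsArtinianRing.of_finite K R
      have : Module.Finite R X := Module.Finite.of_restrictScalars_finite K R _
      obtain ⟨A, hA, -⟩ := (eq_bot_or_exists_atom_le (⊤ : Submodule R X)).resolve_left top_ne_bot
      have hsim : IsSimpleModule R A := isSimpleModule_iff_isAtom.2 hA
      have hex : Function.Exact A.subtype A.mkQ := LinearMap.exact_subtype_mkQ A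
      have hd := finrank_eq_add_of_exact_s12 (K := K) A.injective_subtype A.mkQ_surjective hex
      have : Nontrivial A := IsSimpleModule.nontrivial R A
      have : 0 < finrank K A := finrank_pos
      obtain ⟨ι, _, S, hS, hT⟩ := ih (finrank K (X ⧸ A)) (by omega) (X ⧸ A) rfl
      refine ⟨Option ι, inferInstance, fun o => o.elim (ModuleCat.of R A) S, ?_, ?_⟩
      · rintro (_ | i)
        · change IsSimpleModule R A
          exact hsim
        · exact hS i
      · intro T _ _ hTs f hf
        by_cases h0 : f ∘ₗ A.subtype = 0
        · obtain ⟨g, rfl⟩ := LinearMap.exists_comp_eq_of_surjective A.mkQ_surjective f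
            (fun x hx => by
              rw [Submodule.mkQ_apply, Submodule.Quotient.mk_eq_zero] at hx
              exact LinearMap.congr_fun h0 ⟨x, hx⟩)
          obtain ⟨i, hi⟩ := hT T hTs g (by rintro rfl; exact hf (LinearMap.zero_comp _))
          exact ⟨some i, hi⟩
        · have e : A ≃ₗ[R] T :=
            LinearEquiv.ofBijective (f ∘ₗ A.subtype) (LinearMap.bijective_of_ne_zero h0)
          exact ⟨none, ⟨e⟩⟩

variable (K R) in
theorem exists_simple_family [FiniteDimensional K R] :
    ∃ (ι : Type) (_ : Fintype ι) (S : ι → ModuleCat.{v} R), (∀ i, IsSimpleModule R (S i)) ∧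
      ∀ (T : Type v) [AddCommGroup T] [Module R T], IsSimpleModule R T →
        ∃ i, Nonempty (S i ≃ₗ[R] T) := by
  obtain ⟨ι, _, S, hS, hT⟩ := exists_simple_family_of_nonzero_hom K (R := R) R
  refine ⟨ι, inferInstance, S, hS, fun T _ _ hTs => ?_⟩
  have := IsSimpleModule.nontrivial R T
  obtain ⟨t, ht⟩ := exists_ne (0 : T)
  exact hT T hTs (LinearMap.toSpanSingleton R T t) (fun h0 => ht (by
    simpa using LinearMap.congr_fun h0 1))

variable [FiniteDimensional K R] {ι : Type} [Fintype ι] {S : ι → Type v}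
  [∀ i, AddCommGroup (S i)] [∀ i, Module K (S i)] [∀ i, Module R (S i)]
  [∀ i, IsScalarTower K R (S i)]
  {M N : Type v} [AddCommGroup M] [Module K M] [Module R M] [IsScalarTower K R M]
  [AddCommGroup N] [Module K N] [Module R N] [IsScalarTower K R N]
  [FiniteDimensional K M] [FiniteDimensional K N] {x : ι → ℕ}

omit [FiniteDimensional K R] [FiniteDimensional K M] in
theorem HasClass.eulerForm_eq [∀ i, FiniteDimensional K (S i)] (hM : HasClass K R S x M)
    (hN : HasClass K R S x N) :
    eulerForm K R M N = ∑ i, ∑ j, (x i : ℤ) * x j * eulerForm K R (S i) (S j) := by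
  rw [(hM.2 N).1]
  simp only [(hN.2 (S _)).2, Finset.mul_sum, mul_assoc]

omit [FiniteDimensional K R] [FiniteDimensional K N] in
theorem IsIndecomposable.eulerForm_self_pos (hM : IsIndecomposable R M)
    (hext : ExtOneVanishes R M M) [FiniteDimensional K R] : 0 < eulerForm K R M M := by
  have h1 := hext.finrank_hom_le_eulerForm K
  have : Nontrivial (M →ₗ[R] M) := by
    have := hM.1
    obtain ⟨y, hy⟩ := exists_ne (0 : M)
    exact ⟨LinearMap.id, 0, fun h => hy (LinearMap.congr_fun h y)⟩
  have h2 : 0 < finrank K (M →ₗ[R] M) := finrank_pos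
  omega

theorem NoShortCycles.nonempty_linearEquiv_of_hasClass (h : NoShortCycles.{v, v} R)
    [∀ i, FiniteDimensional K (S i)]
    (hM : IsIndecomposable R M) (hN : IsIndecomposable R N) (hMa : Module.annihilator R M = ⊥)
    (hNa : Module.annihilator R N = ⊥) (hMx : HasClass K R S x M) (hNx : HasClass K R S x N) :
    Nonempty (M ≃ₗ[R] N) := by
  have : Module.Finite R M := Module.Finite.of_restrictScalars_finite K R _
  have : Module.Finite R N := Module.Finite.of_restrictScalars_finite K R _
  have h1 := h.projective_syzygy (K := K) hM hMa
  have h2 := h.projective_syzygy (K := K) hN hNa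
  have hpos := hM.eulerForm_self_pos (K := K) (h.extOneVanishes_self K hM)
  have hMN := eulerForm_le_finrank_hom K (R := R) (X := M) (N := N)
  have hNM := eulerForm_le_finrank_hom K (R := R) (X := N) (N := M)
  rw [hMx.eulerForm_eq hMx] at hpos
  rw [hMx.eulerForm_eq hNx] at hMN
  rw [hNx.eulerForm_eq hMx] at hNM
  have : Nontrivial (M →ₗ[R] N) := Module.nontrivial_of_finrank_pos (R := K) (by omega)
  have : Nontrivial (N →ₗ[R] M) := Module.nontrivial_of_finrank_pos (R := K) (by omega)
  obtain ⟨f, hf⟩ := exists_ne (0 : M →ₗ[R] N)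
  obtain ⟨g, hg⟩ := exists_ne (0 : N →ₗ[R] M)
  rcases h.bijective_or_bijective hM hN hf hg with hb | hb
  · exact ⟨LinearEquiv.ofBijective f hb⟩
  · exact ⟨(LinearEquiv.ofBijective g hb).symm⟩

/-- Without short cycles there are only finitely many faithful indecomposable modules. -/
theorem NoShortCycles.finitelyManyIsoClasses_faithful (K : Type w) [Field K] [Algebra K R]
    [FiniteDimensional K R] (h : NoShortCycles.{v, v} R) :
    FinitelyManyIsoClasses fun M : ModuleCat.{v} R =>
      Module.Finite R M ∧ IsIndecomposable R M ∧ Module.annihilator R M = ⊥ := by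
  have hcomp : ∀ (X : Type v) [AddCommGroup X] [Module R X],
      ∃ (_ : Module K X), IsScalarTower K R X := fun X _ _ => by
    let := Module.compHom X (algebraMap K R)
    exact ⟨inferInstance, ⟨fun a b c => by rw [Algebra.smul_def, mul_smul]; rfl⟩⟩
  have hfd : ∀ (X : Type v) [AddCommGroup X] [Module R X] [Module K X] [IsScalarTower K R X],
      Module.Finite R X → FiniteDimensional K X := fun X _ _ _ _ _ => Module.Finite.trans R X
  by_cases hex : ∃ M : ModuleCat.{v} R,
      Module.Finite R M ∧ IsIndecomposable R M ∧ Module.annihilator R M = ⊥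
  swap
  · exact ⟨Empty, inferInstance, Empty.elim, fun M hM => (hex ⟨M, hM⟩).elim⟩
  obtain ⟨M₀, hf₀, hi₀, ha₀⟩ := hex
  obtain ⟨_, _⟩ := hcomp M₀
  have := hfd M₀ hf₀
  have hgl : SecondSyzygiesProjective K R := h.secondSyzygiesProjective hi₀ ha₀
  obtain ⟨ι, _, S, hS, hT⟩ := exists_simple_family K R
  choose instK instT using fun i => hcomp (S i)
  have hSf : ∀ i, FiniteDimensional K (S i) := fun i => hfd _ (by have := hS i; infer_instance)
  have hSn : ∀ i, Nontrivial (S i) := fun i => IsSimpleModule.nontrivial R (S i)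
  have hpos : ∀ x : ι → ℕ, x ≠ 0 →
      0 < ∑ i, ∑ j, (x i : ℤ) * x j * eulerForm K R (S i) (S j) := fun x hx =>
    sum_eulerForm_pos hgl (fun M _ _ _ hM => h.extOneVanishes_self K hM) hx
  refine FinitelyManyIsoClasses.of_invariant
    (finite_setOf_quadratic_le hpos fun i => finrank K (S i))
    (r := fun x M => ∃ (_ : Module K M) (_ : IsScalarTower K R M),
      HasClass K R (fun i => S i) x M) ?_ ?_
  · rintro M ⟨hf, hi, ha⟩
    obtain ⟨_, _⟩ := hcomp M
    have := hfd M hf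
    obtain ⟨x, hx⟩ := exists_hasClass (S := fun i => S i) hgl hT M
    refine ⟨x, ?_, inferInstance, inferInstance, hx⟩
    have := h.projective_syzygy (K := K) hi ha
    have h1 := eulerForm_le_finrank_hom K (R := R) (X := M) (N := M)
    have h2 := h.finrank_end_le (K := K) hi
    rw [hx.eulerForm_eq hx] at h1
    rw [hx.1] at h2
    have h3 : ((finrank K (M →ₗ[R] M) : ℕ) : ℤ) ≤ ((∑ i, x i * finrank K (S i) : ℕ) : ℤ) := by
      exact_mod_cast h2
    push_cast at h3
    exact h1.trans h3
  · rintro x M N ⟨hf, hi, ha⟩ ⟨hf', hi', ha'⟩ ⟨_, _, hx⟩ ⟨_, _, hx'⟩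
    have := hfd M hf
    have := hfd N hf'
    exact h.nonempty_linearEquiv_of_hasClass hi hi' ha ha' hx hx'

end FiniteIsoClasses

section ChangeOfRings

variable {R : Type*} {B : Type*} [Ring R] [Ring B] {φ : R →+* B}
  {M N : Type*} [AddCommGroup M] [Module R M] [Module B M] [AddCommGroup N] [Module R N]
  [Module B N]

/-- Submodules do not change under restriction of scalars along a surjective ring homomorphism. -/
def Submodule.orderIsoOfSurjective (hφ : Function.Surjective φ)
    (hM : ∀ (a : R) (m : M), φ a • m = a • m) : Submodule R M ≃o Submodule B M where
  toFun p := { p.toAddSubmonoid with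
    smul_mem' := fun a m hm => by
      obtain ⟨a, rfl⟩ := hφ a
      rw [hM]
      exact p.smul_mem a hm }
  invFun p := { p.toAddSubmonoid with
    smul_mem' := fun a m hm => by
      rw [← hM]
      exact p.smul_mem (φ a) hm }
  left_inv _ := rfl
  right_inv _ := rfl
  map_rel_iff' := Iff.rfl

theorem IsIndecomposable.of_surjective (hφ : Function.Surjective φ)
    (hM : ∀ (a : R) (m : M), φ a • m = a • m) (h : IsIndecomposable R M) :
    IsIndecomposable B M := by
  refine ⟨h.1, fun p q hpq => ?_⟩
  have := h.2 _ _ ((Submodule.orderIsoOfSurjective hφ hM).symm.isCompl hpq)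
  simpa only [map_eq_bot_iff] using this

theorem IsIndecomposable.restrictScalars_of_surjective (hφ : Function.Surjective φ)
    (hM : ∀ (a : R) (m : M), φ a • m = a • m) (h : IsIndecomposable B M) :
    IsIndecomposable R M := by
  refine ⟨h.1, fun p q hpq => ?_⟩
  have := h.2 _ _ ((Submodule.orderIsoOfSurjective hφ hM).isCompl hpq)
  simpa only [map_eq_bot_iff] using this

theorem Module.Finite.of_surjective_ringHom (hM : ∀ (a : R) (m : M), φ a • m = a • m)
    (h : Module.Finite R M) : Module.Finite B M :=
  let f : M →ₛₗ[φ] M :=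
    { toFun := id, map_add' := fun _ _ => rfl, map_smul' := fun a m => (hM a m).symm }
  Module.Finite.of_surjective f Function.surjective_id

theorem Module.Finite.restrictScalars_of_surjective (hφ : Function.Surjective φ)
    (hM : ∀ (a : R) (m : M), φ a • m = a • m) (h : Module.Finite B M) : Module.Finite R M := by
  obtain ⟨s, hs⟩ := h.fg_top
  refine ⟨s, ?_⟩
  have h1 : Submodule.span B (s : Set M) ≤
      Submodule.orderIsoOfSurjective hφ hM (Submodule.span R (s : Set M)) :=
    Submodule.span_le.2 Submodule.subset_span
  rw [hs, top_le_iff, map_eq_top_iff] at h1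
  exact h1

/-- A linear map is linear over any ring whose action factors through the given one. -/
def LinearMap.restrictScalarsAlong (hM : ∀ (a : R) (m : M), φ a • m = a • m)
    (hN : ∀ (a : R) (n : N), φ a • n = a • n) (f : M →ₗ[B] N) : M →ₗ[R] N where
  toFun := f
  map_add' := f.map_add
  map_smul' a m := by rw [← hM, map_smul, hN]; rfl

theorem NoShortCycles.of_surjective {R : Type*} {B : Type*} [Ring R] [Ring B] {φ : R →+* B}
    (hφ : Function.Surjective φ) (h : NoShortCycles.{_, v} R) : NoShortCycles.{_, v} B := by
  rintro M _ _ hf hi ⟨Y, hYf, hYi, f, g, hf0, hg0, hfb, hgb⟩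
  let := Module.compHom M φ
  let := Module.compHom Y φ
  have hM : ∀ (a : R) (m : M), φ a • m = a • m := fun _ _ => rfl
  have hY : ∀ (a : R) (m : Y), φ a • m = a • m := fun _ _ => rfl
  refine h M (hf.restrictScalars_of_surjective hφ hM) (hi.restrictScalars_of_surjective hφ hM)
    ⟨ModuleCat.of R Y, hYf.restrictScalars_of_surjective hφ hY,
      hYi.restrictScalars_of_surjective hφ hY, f.restrictScalarsAlong hM hY,
      g.restrictScalarsAlong hY hM, ?_, ?_, hfb, hgb⟩
  · exact fun h0 => hf0 (LinearMap.ext fun m => LinearMap.congr_fun h0 m)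
  · exact fun h0 => hg0 (LinearMap.ext fun m => LinearMap.congr_fun h0 m)

theorem FinitelyManyIsoClasses.mono {R : Type u} [Ring R] {P Q : ModuleCat.{v} R → Prop}
    (h : FinitelyManyIsoClasses Q) (hPQ : ∀ M, P M → Q M) : FinitelyManyIsoClasses P := by
  obtain ⟨κ, hκ, V, hV⟩ := h
  exact ⟨κ, hκ, V, fun M hM => hV M (hPQ M hM)⟩

/-- A module annihilated by the kernel of a surjective ring homomorphism is a module over the
target. -/
theorem exists_module_of_ker_le_annihilator (hφ : Function.Surjective φ) {M : Type*}
    [AddCommGroup M] [Module R M] (hM : RingHom.ker φ ≤ Module.annihilator R M) :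
    ∃ _ : Module B M, ∀ (a : R) (m : M), φ a • m = a • m := by
  have hk : RingHom.ker φ ≤ RingHom.ker (Module.toAddMonoidEnd R M) := fun a ha => by
    refine AddMonoidHom.ext fun m => ?_
    exact Module.mem_annihilator.1 (hM ha) m
  let ψ : B →+* AddMonoid.End M := φ.liftOfSurjective hφ ⟨_, hk⟩
  refine ⟨Module.compHom M ψ, fun a m => ?_⟩
  change ψ (φ a) m = _
  have : ψ (φ a) = Module.toAddMonoidEnd R M a := φ.liftOfRightInverse_comp_apply _ _ ⟨_, hk⟩ a
  rw [this]
  rfl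

theorem FinitelyManyIsoClasses.of_surjective {R : Type*} {B : Type*} [Ring R] [Ring B]
    {φ : R →+* B} (hφ : Function.Surjective φ) {P : ModuleCat.{v} R → Prop}
    {P' : ModuleCat.{v} B → Prop} (h : FinitelyManyIsoClasses P')
    (hk : ∀ M, P M → RingHom.ker φ ≤ Module.annihilator R M)
    (hP : ∀ (M : ModuleCat.{v} R) [Module B M], (∀ (a : R) (m : M), φ a • m = a • m) →
      P M → P' (ModuleCat.of B M)) :
    FinitelyManyIsoClasses P := by
  obtain ⟨κ, hκ, V, hV⟩ := h
  refine ⟨κ, hκ, fun k => (ModuleCat.restrictScalars φ).obj (V k), fun M hM => ?_⟩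
  obtain ⟨_, hMφ⟩ := exists_module_of_ker_le_annihilator hφ (hk M hM)
  obtain ⟨k, ⟨e⟩⟩ := hV _ (hP M hMφ hM)
  exact ⟨k, ⟨{ e.toAddEquiv with
    map_smul' := fun a m => by
      change e (a • m) = φ a • e m
      rw [← hMφ]
      exact e.map_smul (φ a) m }⟩⟩

end ChangeOfRings

section Assembly

variable {K : Type w} {R : Type v} [Field K] [Ring R] [Algebra K R]

theorem IsSubfactor.of_linearEquiv {R : Type*} [Ring R] {S T M : Type*} [AddCommGroup S]
    [AddCommGroup T] [AddCommGroup M] [Module R S] [Module R T] [Module R M] (e : S ≃ₗ[R] T)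
    (h : IsSubfactor R S M) : IsSubfactor R T M := by
  obtain ⟨U, f, hf⟩ := h
  refine ⟨U, f ∘ₗ e.symm.toLinearMap, fun h0 => hf (LinearMap.ext fun s => ?_)⟩
  simpa using LinearMap.congr_fun h0 (e s)

/-- Without short cycles there are only finitely many indecomposable modules with a given
annihilator. -/
theorem NoShortCycles.finitelyManyIsoClasses_annihilator (K : Type w) [Field K] [Algebra K R]
    [FiniteDimensional K R] (h : NoShortCycles.{v, v} R) (I : Ideal R) [I.IsTwoSided] :
    FinitelyManyIsoClasses fun M : ModuleCat.{v} R =>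
      Module.Finite R M ∧ IsIndecomposable R M ∧ Module.annihilator R M = I := by
  have hφ : Function.Surjective (Ideal.Quotient.mk I) := Ideal.Quotient.mk_surjective
  have : FiniteDimensional K (R ⧸ I) :=
    Module.Finite.of_surjective (Ideal.Quotient.mkₐ K I).toLinearMap hφ
  refine FinitelyManyIsoClasses.of_surjective hφ
    ((h.of_surjective hφ).finitelyManyIsoClasses_faithful K) ?_ ?_
  · rintro M ⟨-, -, hM⟩
    rw [hM, Ideal.mk_ker]
  · rintro M _ hMφ ⟨hf, hi, ha⟩
    refine ⟨hf.of_surjective_ringHom hMφ, hi.of_surjective hφ hMφ, ?_⟩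
    rw [eq_bot_iff]
    intro a ham
    obtain ⟨a, rfl⟩ := hφ a
    rw [Submodule.mem_bot, Ideal.Quotient.eq_zero_iff_mem, ← ha, Module.mem_annihilator]
    intro m
    rw [← hMφ]
    exact Module.mem_annihilator.1 ham m

theorem NoShortCycles.finitelyManyIsoClasses (K : Type w) [Field K] [Algebra K R]
    [FiniteDimensional K R] (h : NoShortCycles.{v, v} R) :
    FinitelyManyIsoClasses fun M : ModuleCat.{v} R =>
      Module.Finite R M ∧ IsIndecomposable R M := by
  obtain ⟨ι, _, S, hS, hT⟩ := exists_simple_family K R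
  refine FinitelyManyIsoClasses.of_finite_cover (α := Set ι)
    (r := fun s M => s = {i | IsSubfactor R (S i) M}) (fun M _ => ⟨_, rfl⟩) fun s => ?_
  have hle : ∀ M N : ModuleCat.{v} R, Module.Finite R M → Module.Finite R N →
      IsIndecomposable R M → s = {i | IsSubfactor R (S i) M} →
      s = {i | IsSubfactor R (S i) N} → Module.annihilator R M ≤ Module.annihilator R N := by
    intro M N hMf hNf hMi hMs hNs
    let := Module.compHom M (algebraMap K R)
    have : IsScalarTower K R M := ⟨fun a b c => by rw [Algebra.smul_def, mul_smul]; rfl⟩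
    refine h.annihilator_le (K := K) hMi fun T _ _ hTs hTN => ?_
    obtain ⟨i, ⟨e⟩⟩ := hT T hTs
    have hi : i ∈ s := by
      rw [hNs]
      exact hTN.of_linearEquiv e.symm
    rw [hMs] at hi
    exact hi.of_linearEquiv e
  by_cases hex : ∃ M : ModuleCat.{v} R,
      (Module.Finite R M ∧ IsIndecomposable R M) ∧ s = {i | IsSubfactor R (S i) M}
  swap
  · exact ⟨Empty, inferInstance, Empty.elim, fun M hM => (hex ⟨M, hM⟩).elim⟩
  obtain ⟨M₁, ⟨hf₁, hi₁⟩, hs₁⟩ := hex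
  refine (h.finitelyManyIsoClasses_annihilator K (Module.annihilator R M₁)).mono ?_
  rintro M ⟨⟨hf, hi⟩, hs⟩
  exact ⟨hf, hi, le_antisymm (hle M M₁ hf hf₁ hi hs hs₁) (hle M₁ M hf₁ hf hi₁ hs₁ hs)⟩

theorem NoShortCycles.finitelyManyIsoClasses_of_small (K : Type*) (R : Type*) [Field K] [Ring R]
    [Algebra K R] [FiniteDimensional K R] [Small.{v} R] (h : NoShortCycles.{_, v} R) :
    FinitelyManyIsoClasses fun M : ModuleCat.{v} R =>
      Module.Finite R M ∧ IsIndecomposable R M := by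
  have : FiniteDimensional K (Shrink.{v} R) :=
    Module.Finite.equiv (Shrink.algEquiv K R).symm.toLinearEquiv
  let φ : R →+* Shrink.{v} R := (Shrink.ringEquiv R).symm
  have hφ : Function.Bijective φ := (Shrink.ringEquiv R).symm.bijective
  refine FinitelyManyIsoClasses.of_surjective hφ.2
    ((h.of_surjective hφ.2).finitelyManyIsoClasses K) ?_ ?_
  · rintro M -
    rw [(RingHom.injective_iff_ker_eq_bot φ).1 hφ.1]
    exact bot_le
  · rintro M _ hMφ ⟨hf, hi⟩
    exact ⟨hf.of_surjective_ringHom hMφ, hi.of_surjective hφ.2 hMφ⟩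

theorem small_of_nontrivial_module (K : Type*) (R : Type*) [Field K] [Ring R] [Algebra K R]
    [FiniteDimensional K R] (M : Type v) [AddCommGroup M] [Module R M] [Nontrivial M] :
    Small.{v} R := by
  let := Module.compHom M (algebraMap K R)
  obtain ⟨m, hm⟩ := exists_ne (0 : M)
  have : Small.{v} K := small_of_injective (smul_left_injective K hm)
  exact small_map (Module.finBasis K R).equivFun.toEquiv

theorem NoShortCycles.finitelyManyIsoClasses_of_finiteDimensional (K : Type*) (R : Type*) [Field K]
    [Ring R] [Algebra K R] [FiniteDimensional K R] (h : NoShortCycles.{_, v} R) :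
    FinitelyManyIsoClasses fun M : ModuleCat.{v} R =>
      Module.Finite R M ∧ IsIndecomposable R M := by
  by_cases hR : Small.{v} R
  · exact h.finitelyManyIsoClasses_of_small K R
  · refine ⟨Empty, inferInstance, Empty.elim, fun M hM => (hR ?_).elim⟩
    have := hM.2.1
    exact small_of_nontrivial_module K R M

end Assembly

end

/-- A finite-dimensional algebra over a field whose module category
`mod A` (finite-dimensional right `A`-modules) admits no short cycles is of finite
representation type. -/
theorem finite_representation_type_of_no_short_cycles
    {K : Type*} (A : Type*) [Field K] [Ring A] [Algebra K A] [FiniteDimensional K A]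
    (hnsc : ∀ (M : Type v) [AddCommGroup M] [Module Aᵐᵒᵖ M],
      Module.Finite Aᵐᵒᵖ M → IsIndecomposable Aᵐᵒᵖ M → ¬LiesOnShortCycle Aᵐᵒᵖ M) :
    ∃ (n : ℕ) (V : Fin n → ModuleCat.{v} Aᵐᵒᵖ),
      ∀ (M : Type v) [AddCommGroup M] [Module Aᵐᵒᵖ M],
        Module.Finite Aᵐᵒᵖ M → IsIndecomposable Aᵐᵒᵖ M →
          ∃ i, Nonempty (M ≃ₗ[Aᵐᵒᵖ] V i) := by
  have h : NoShortCycles.{_, v} Aᵐᵒᵖ := hnsc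
  obtain ⟨κ, _, V, hV⟩ := h.finitelyManyIsoClasses_of_finiteDimensional K Aᵐᵒᵖ
  obtain ⟨n, ⟨e⟩⟩ := Finite.exists_equiv_fin κ
  refine ⟨n, fun i => V (e.symm i), fun M _ _ hf hi => ?_⟩
  obtain ⟨k, hk⟩ := hV (ModuleCat.of _ M) ⟨hf, hi⟩
  refine ⟨e k, ?_⟩
  beta_reduce
  rw [e.symm_apply_apply]
  exact hk
end

section
/- Let A be a finite-dimensional selfinjective algebra over a field K and I an ideal of A contained in the socle soc(A) with I² = 0, such that soc(A) ⊆ I implies nothing further (i.e., assume only I ⊆ soc A). Then the quotient map A → A/I induces a bijection between the sets of isomorphism classes of indecomposable non-projective A-modules and indecomposable A/I-modules that are not projective A-modules; in particular, if A and A' are socle equivalent selfinjective algebras (A/soc A ≅ A'/soc A') and neither has a simple projective module, then A and A' have the same number of isomorphism classes of simple modules. -/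
universe v u
/-- The socle of `A` as a right `A`-module. -/
def rightSocle (A : Type*) [Ring A] : Submodule Aᵐᵒᵖ A :=
  sSup {m : Submodule Aᵐᵒᵖ A | IsAtom m}

section Restrict

variable {A : Type*} [Ring A] (c : RingCon A)

/-- The right `A`-module structure on a right `A/I`-module obtained by restriction of
scalars along the quotient map `A → A/I`. -/
def restrModule (N : Type*) [AddCommGroup N] [Module c.Quotientᵐᵒᵖ N] :
    Module Aᵐᵒᵖ N :=
  Module.compHom N (RingHom.op c.mk')

/-- The restriction of a right `A/I`-module along `A → A/I` is isomorphic (as a right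
`A`-module) to `M`. -/
def RestrIsoTo (N : Type v) [AddCommGroup N] [Module c.Quotientᵐᵒᵖ N]
    (M : Type v) [AddCommGroup M] [Module Aᵐᵒᵖ M] : Prop :=
  letI := restrModule c N
  Nonempty (N ≃ₗ[Aᵐᵒᵖ] M)

/-- The restrictions of two right `A/I`-modules along `A → A/I` are isomorphic as right
`A`-modules. -/
def RestrIso₂ (N N' : Type v) [AddCommGroup N] [Module c.Quotientᵐᵒᵖ N]
    [AddCommGroup N'] [Module c.Quotientᵐᵒᵖ N'] : Prop :=
  letI := restrModule c N
  letI := restrModule c N'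
  Nonempty (N ≃ₗ[Aᵐᵒᵖ] N')

/-- The restriction of `N` along `A → A/I` is not a projective right `A`-module. -/
def RestrNotProj (N : Type*) [AddCommGroup N] [Module c.Quotientᵐᵒᵖ N] : Prop :=
  letI := restrModule c N
  ¬Module.Projective Aᵐᵒᵖ N

/-- The restriction of `N` along `A → A/I` is an indecomposable right `A`-module. -/
def RestrIndec (N : Type*) [AddCommGroup N] [Module c.Quotientᵐᵒᵖ N] : Prop :=
  letI := restrModule c N
  IsIndecomposable Aᵐᵒᵖ N

/-- The restriction of `N` along `A → A/I` is a finite-dimensional right `A`-module. -/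
def RestrFinite (N : Type*) [AddCommGroup N] [Module c.Quotientᵐᵒᵖ N] : Prop :=
  letI := restrModule c N
  Module.Finite Aᵐᵒᵖ N

end Restrict

/-- `A` has exactly `m` isomorphism classes of simple right modules. -/
def HasNSimples (A : Type*) [Ring A] (m : ℕ) : Prop :=
  ∃ S : Fin m → ModuleCat.{v} Aᵐᵒᵖ,
    (∀ i, IsSimpleModule Aᵐᵒᵖ (S i)) ∧
    (∀ i j, Nonempty ((S i : Type v) ≃ₗ[Aᵐᵒᵖ] (S j : Type v)) → i = j) ∧
    (∀ (T : Type v) [AddCommGroup T] [Module Aᵐᵒᵖ T], IsSimpleModule Aᵐᵒᵖ T →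
      ∃ i, Nonempty (T ≃ₗ[Aᵐᵒᵖ] (S i : Type v)))

section SurjectiveRingHom

variable {R S : Type*} [Ring R] [Ring S] {φ : R →+* S} (hφ : Function.Surjective φ)
variable {M N : Type*} [AddCommGroup M] [Module R M] [Module S M]
  [AddCommGroup N] [Module R N] [Module S N]
  (hM : ∀ (r : R) (m : M), φ r • m = r • m) (hN : ∀ (r : R) (n : N), φ r • n = r • n)

/-- The identity of `M`, semilinear along `φ : R →+* S`, when the `R`-module structure is
restricted from the `S`-module structure. -/
def semilinearId : M →ₛₗ[φ] M where
  toFun := id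
  map_add' _ _ := rfl
  map_smul' r m := (hM r m).symm

include hφ hM

/-- Submodules over `R` and over `S` agree when `R →+* S` is surjective. -/
def submoduleOrderIso : Submodule R M ≃o Submodule S M :=
  haveI : RingHomSurjective φ := ⟨hφ⟩
  Submodule.orderIsoMapComapOfBijective (semilinearId hM) Function.bijective_id

theorem isSimpleModule_iff_of_surjective : IsSimpleModule R M ↔ IsSimpleModule S M := by
  rw [isSimpleModule_iff, isSimpleModule_iff, (submoduleOrderIso hφ hM).isSimpleOrder_iff]

theorem isIndecomposable_iff_of_surjective : IsIndecomposable R M ↔ IsIndecomposable S M := by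
  set e := submoduleOrderIso hφ hM
  refine and_congr_right fun _ => ⟨fun h p q hpq => ?_, fun h p q hpq => ?_⟩
  · simpa using h _ _ (e.symm.isCompl hpq)
  · simpa using h _ _ (e.isCompl hpq)

theorem finite_iff_of_surjective : Module.Finite R M ↔ Module.Finite S M := by
  constructor
  · rintro ⟨s, hs⟩
    refine ⟨s, eq_top_iff.2 fun x _ => ?_⟩
    have hx : x ∈ Submodule.span R (s : Set M) := hs ▸ Submodule.mem_top
    induction hx using Submodule.span_induction with
    | mem x hx => exact Submodule.subset_span hx
    | zero => exact zero_mem _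
    | add x y _ _ hx hy => exact add_mem (hx trivial) (hy trivial)
    | smul r x _ hx => exact hM r x ▸ Submodule.smul_mem _ _ (hx trivial)
  · rintro ⟨s, hs⟩
    refine ⟨s, eq_top_iff.2 fun x _ => ?_⟩
    have hx : x ∈ Submodule.span S (s : Set M) := hs ▸ Submodule.mem_top
    induction hx using Submodule.span_induction with
    | mem x hx => exact Submodule.subset_span hx
    | zero => exact zero_mem _
    | add x y _ _ hx hy => exact add_mem (hx trivial) (hy trivial)
    | smul r x _ hx =>
      obtain ⟨r, rfl⟩ := hφ r
      exact hM r x ▸ Submodule.smul_mem _ _ (hx trivial)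

include hN

theorem nonempty_linearEquiv_iff_of_surjective :
    Nonempty (M ≃ₗ[R] N) ↔ Nonempty (M ≃ₗ[S] N) := by
  constructor
  · rintro ⟨e⟩
    refine ⟨{ e.toAddEquiv with map_smul' := fun s x => ?_ }⟩
    obtain ⟨r, rfl⟩ := hφ s
    change e (φ r • x) = φ r • e x
    rw [hM, hN, map_smul]
  · rintro ⟨e⟩
    refine ⟨{ e.toAddEquiv with map_smul' := fun r x => ?_ }⟩
    change e (r • x) = r • e x
    rw [← hM, ← hN, map_smul]

end SurjectiveRingHom

/-- A module killed by the kernel of a surjective ring homomorphism descends along it. -/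
theorem exists_module_of_surjective {R S : Type*} [Ring R] [Ring S] {φ : R →+* S}
    (hφ : Function.Surjective φ) (M : Type*) [AddCommGroup M] [Module R M]
    (hker : ∀ r, φ r = 0 → ∀ m : M, r • m = 0) :
    ∃ _ : Module S M, ∀ (r : R) (m : M), φ r • m = r • m := by
  have hle : RingHom.ker φ ≤ RingHom.ker (Module.toAddMonoidEnd R M) := fun r hr => by
    ext m
    exact hker r hr m
  let g : S →+* AddMonoid.End M :=
    φ.liftOfRightInverse _ (Function.rightInverse_surjInv hφ) ⟨Module.toAddMonoidEnd R M, hle⟩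
  refine ⟨Module.compHom M g, fun r m => ?_⟩
  have hg : g (φ r) = Module.toAddMonoidEnd R M r :=
    RingHom.liftOfRightInverse_comp_apply φ _ _ ⟨Module.toAddMonoidEnd R M, hle⟩ r
  exact congrArg (fun f : AddMonoid.End M => f m) hg

/-- A map from a projective-injective module to a non-projective indecomposable module of finite
length vanishes on simple submodules. -/
theorem atom_le_ker {R P M : Type u} [Ring R] [AddCommGroup P] [Module R P]
    [Module.Injective R P] [Module.Projective R P] [AddCommGroup M] [Module R M]
    [IsNoetherian R M] [IsArtinian R M] (hM : IsIndecomposable R M)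
    (hproj : ¬Module.Projective R M) (f : P →ₗ[R] M) {S : Submodule R P} (hS : IsAtom S) :
    S ≤ LinearMap.ker f := by
  by_contra hle
  have hdisj : Disjoint S (LinearMap.ker f) := (IsAtom.not_le_iff_disjoint hS).1 hle
  have hinj : Function.Injective (f ∘ₗ S.subtype) := by
    rw [← LinearMap.ker_eq_bot, LinearMap.ker_comp, eq_bot_iff]
    rintro ⟨x, hx⟩ hxf
    simpa using (Submodule.disjoint_def.1 hdisj) x hx hxf
  obtain ⟨g, hg⟩ := Module.Injective.out (f ∘ₗ S.subtype) hinj S.subtype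
  replace hg : ∀ x ∈ S, g (f x) = x := fun x hx => hg ⟨x, hx⟩
  obtain ⟨x, hx, hx0⟩ := S.ne_bot_iff.1 hS.1
  let k : Module.End R M := f ∘ₗ g
  have hk : ∀ n : ℕ, (k ^ n) (f x) = f x := by
    intro n
    induction n with
    | zero => rfl
    | succ n ih => rw [pow_succ, Module.End.mul_apply, show k (f x) = f x from
        congrArg f (hg x hx), ih]
  have hfx : f x ≠ 0 := fun h => hx0 (by rw [← hg x hx, h, map_zero])
  obtain ⟨n, hn, hn0⟩ :=
    (k.eventually_isCompl_ker_pow_range_pow.and (Filter.eventually_ge_atTop 1)).exists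
  have hker : LinearMap.ker (k ^ n) = ⊥ := by
    refine (hM.2 _ _ hn).resolve_right fun h => hfx ?_
    rw [← hk n, LinearMap.range_eq_bot.1 h, LinearMap.zero_apply]
  have hrange : LinearMap.range (k ^ n) = ⊤ := by simpa [hker] using hn.sup_eq_top
  let e := LinearEquiv.ofBijective (k ^ n)
    ⟨LinearMap.ker_eq_bot.1 hker, LinearMap.range_eq_top.1 hrange⟩
  refine hproj (Module.Projective.of_split
    (g ∘ₗ (k ^ (n - 1)) ∘ₗ e.symm.toLinearMap) f ?_)
  ext y
  change k ((k ^ (n - 1)) (e.symm y)) = y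
  rw [← Module.End.mul_apply, ← pow_succ', Nat.sub_add_cancel hn0]
  exact e.apply_symm_apply y

instance projective_mulOpposite_self (A : Type*) [Ring A] : Module.Projective Aᵐᵒᵖ A :=
  let e : Aᵐᵒᵖ ≃ₗ[Aᵐᵒᵖ] A :=
    { MulOpposite.opAddEquiv.symm with map_smul' := fun _ _ => rfl }
  Module.Projective.of_equiv e

/-- The socle of a selfinjective algebra annihilates all non-projective indecomposables. -/
theorem op_smul_eq_zero_of_mem_rightSocle {A : Type u} [Ring A] [IsArtinianRing Aᵐᵒᵖ]
    [Module.Injective Aᵐᵒᵖ A] {M : Type u} [AddCommGroup M] [Module Aᵐᵒᵖ M]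
    [Module.Finite Aᵐᵒᵖ M] (hM : IsIndecomposable Aᵐᵒᵖ M) (hproj : ¬Module.Projective Aᵐᵒᵖ M)
    {x : A} (hx : x ∈ rightSocle A) (m : M) : MulOpposite.op x • m = 0 := by
  let f : A →ₗ[Aᵐᵒᵖ] M :=
    { toFun := fun a => MulOpposite.op a • m
      map_add' := fun a b => by rw [MulOpposite.op_add, add_smul]
      map_smul' := fun r a => mul_smul r (MulOpposite.op a) m }
  have hle : rightSocle A ≤ LinearMap.ker f := sSup_le fun _ hS => atom_le_ker hM hproj f hS
  exact hle hx

theorem IsSimpleModule.isIndecomposable {R M : Type*} [Ring R] [AddCommGroup M] [Module R M]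
    (h : IsSimpleModule R M) : IsIndecomposable R M :=
  ⟨IsSimpleModule.nontrivial R M, fun p q hpq =>
    (eq_bot_or_eq_top p).imp_right fun hp => by simpa [hp] using hpq.inf_eq_bot⟩

theorem mul_mem_rightSocle {A : Type*} [Ring A] (a : A) {x : A} (hx : x ∈ rightSocle A) :
    a * x ∈ rightSocle A := by
  let f : A →ₗ[Aᵐᵒᵖ] A :=
    { toFun := fun b => a * b
      map_add' := mul_add a
      map_smul' := fun r b => (mul_assoc a b r.unop).symm }
  have hle : rightSocle A ≤ (rightSocle A).comap f := by
    refine sSup_le fun S hS => ?_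
    have : IsSimpleModule Aᵐᵒᵖ S := isSimpleModule_iff_isAtom.2 hS
    rcases LinearMap.injective_or_eq_zero (f ∘ₗ S.subtype) with hinj | h0
    · have e := LinearEquiv.ofInjective _ hinj
      have hat : IsAtom (LinearMap.range (f ∘ₗ S.subtype)) :=
        isSimpleModule_iff_isAtom.1 (IsSimpleModule.congr e.symm)
      exact fun y hy => (le_sSup hat : _ ≤ rightSocle A) ⟨⟨y, hy⟩, rfl⟩
    · intro y hy
      have : f y = 0 := LinearMap.congr_fun h0 ⟨y, hy⟩
      simp [this]
  exact hle hx

/-- The right socle as a two-sided ideal. -/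
def rightSocleIdeal (A : Type*) [Ring A] : TwoSidedIdeal A :=
  .mk' (rightSocle A) (zero_mem _) add_mem neg_mem (mul_mem_rightSocle _)
    (fun {_ y} hx => (rightSocle A).smul_mem (MulOpposite.op y) hx)

theorem mem_rightSocleIdeal {A : Type*} [Ring A] {x : A} :
    x ∈ rightSocleIdeal A ↔ x ∈ rightSocle A :=
  TwoSidedIdeal.mem_mk' ..

/-- `R` has exactly `m` isomorphism classes of simple left modules. -/
def HasNLeftSimples (R : Type*) [Ring R] (m : ℕ) : Prop :=
  ∃ S : Fin m → ModuleCat.{v} R,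
    (∀ i, IsSimpleModule R (S i)) ∧
    (∀ i j, Nonempty ((S i : Type v) ≃ₗ[R] (S j : Type v)) → i = j) ∧
    (∀ (T : Type v) [AddCommGroup T] [Module R T], IsSimpleModule R T →
      ∃ i, Nonempty (T ≃ₗ[R] (S i : Type v)))

theorem HasNLeftSimples.of_surjective {R S : Type*} [Ring R] [Ring S] {φ : R →+* S}
    (hφ : Function.Surjective φ) {n : ℕ}
    (hker : ∀ (T : Type v) [AddCommGroup T] [Module R T], IsSimpleModule R T →
      ∀ r, φ r = 0 → ∀ t : T, r • t = 0)
    (h : HasNLeftSimples.{v} S n) : HasNLeftSimples.{v} R n := by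
  obtain ⟨F, hsimple, hinj, hall⟩ := h
  let (i : Fin n) : Module R (F i) := Module.compHom (F i) φ
  refine ⟨fun i => ModuleCat.of R (F i), fun i => ?_, fun i j hij => hinj i j ?_, ?_⟩
  · exact (isSimpleModule_iff_of_surjective hφ fun _ _ => rfl).2 (hsimple i)
  · exact (nonempty_linearEquiv_iff_of_surjective hφ (fun _ _ => rfl) fun _ _ => rfl).1 hij
  · intro T _ _ hT
    obtain ⟨_, hφT⟩ := exists_module_of_surjective hφ T (hker T hT)
    obtain ⟨i, hi⟩ := hall T ((isSimpleModule_iff_of_surjective hφ hφT).1 hT)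
    exact ⟨i, (nonempty_linearEquiv_iff_of_surjective hφ hφT fun _ _ => rfl).2 hi⟩

theorem exists_hasNLeftSimples_of_isSemisimpleRing (R : Type u) [Ring R] [IsSemisimpleRing R] :
    ∃ n, HasNLeftSimples.{u} R n := by
  obtain ⟨n, ⟨e⟩⟩ := Finite.exists_equiv_fin (isotypicComponents R R)
  choose F hsimple hF using fun i : Fin n => (e.symm i).2
  refine ⟨n, fun i => ModuleCat.of R (F i), hsimple, ?_, fun T _ _ hT => ?_⟩
  · rintro i j ⟨f⟩
    apply e.symm.injective
    rw [Subtype.ext_iff, hF i, hF j]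
    exact f.isotypicComponent_eq
  · obtain ⟨I, ⟨f⟩⟩ := IsSemisimpleRing.exists_linearEquiv_ideal_of_isSimpleModule R T
    have : IsSimpleModule R I := IsSimpleModule.congr f.symm
    let i : Fin n := e ⟨isotypicComponent R R I, I, this, rfl⟩
    have hi : isotypicComponent R R I = isotypicComponent R R (F i) := by
      rw [← hF i]
      simp [i]
    have := hsimple i
    have hle : I ≤ isotypicComponent R R (F i) := hi ▸ I.le_isotypicComponent
    obtain ⟨g⟩ := isIsotypicOfType_submodule_iff.1
      (IsIsotypicOfType.isotypicComponent R R (F i)) I hle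
    exact ⟨i, ⟨f.trans g⟩⟩

theorem exists_hasNLeftSimples (R : Type u) [Ring R] [IsArtinianRing R] :
    ∃ n, HasNLeftSimples.{u} R n := by
  obtain ⟨n, hn⟩ := exists_hasNLeftSimples_of_isSemisimpleRing (R ⧸ Ring.jacobson R)
  refine ⟨n, hn.of_surjective (φ := Ideal.Quotient.mk (Ring.jacobson R))
    Ideal.Quotient.mk_surjective fun T _ _ _ r hr t => ?_⟩
  exact Module.mem_annihilator.1 (IsSemisimpleModule.jacobson_le_annihilator R T
    (Ideal.Quotient.eq_zero_iff_mem.1 hr)) t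

theorem HasNSimples.of_surjective {A B : Type u} [Ring A] [IsArtinianRing Aᵐᵒᵖ]
    [Module.Injective Aᵐᵒᵖ A] [Ring B]
    (hnsp : ∀ (S : Type u) [AddCommGroup S] [Module Aᵐᵒᵖ S],
      IsSimpleModule Aᵐᵒᵖ S → ¬Module.Projective Aᵐᵒᵖ S)
    {φ : A →+* B} (hφ : Function.Surjective φ) (hker : ∀ a, φ a = 0 → a ∈ rightSocle A)
    {n : ℕ} (h : HasNLeftSimples.{u} Bᵐᵒᵖ n) : HasNSimples.{u} A n := by
  refine HasNLeftSimples.of_surjective (φ := RingHom.op φ) (fun b => ?_)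
    (fun T _ _ hT r hr t => ?_) h
  · obtain ⟨a, ha⟩ := hφ b.unop
    exact ⟨MulOpposite.op a, congrArg MulOpposite.op ha⟩
  · exact op_smul_eq_zero_of_mem_rightSocle hT.isIndecomposable (hnsp T hT)
      (hker r.unop (congrArg MulOpposite.unop hr)) t

/-- Let `A` be a finite-dimensional selfinjective algebra over `K` and
`I` a two-sided ideal of `A` contained in `soc A` with `I² = 0`.  Then the quotient map
`A → A/I` induces a bijection between the isomorphism classes of indecomposable
non-projective right `A`-modules and of indecomposable right `A/I`-modules that are not
projective as `A`-modules.  In particular, if `A` and `A'` are socle equivalent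
selfinjective algebras without simple projective modules, then `A` and `A'` have the same
number of isomorphism classes of simple modules. -/
theorem socle_deformation_module_correspondence
    {K : Type u} [Field K] {A A' : Type u}
    [Ring A] [Algebra K A] [FiniteDimensional K A] [Module.Injective Aᵐᵒᵖ A]
    [Ring A'] [Algebra K A'] [FiniteDimensional K A'] [Module.Injective A'ᵐᵒᵖ A']
    -- `I` is a two-sided ideal of `A`, realised as a congruence `c` on `A`
    (I : Submodule Aᵐᵒᵖ A) (hleft : ∀ a : A, ∀ x ∈ I, a * x ∈ I)
    (c : RingCon A) (hc : ∀ a b : A, c a b ↔ a - b ∈ I)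
    (hsoc : I ≤ rightSocle A)
    (hsq : ∀ x ∈ I, ∀ y ∈ I, x * y = 0)
    -- socle equivalence of `A` and `A'`, expressed by a map lifting an isomorphism
    -- `A / soc A ≃ A' / soc A'`
    (ψ : A → A')
    (hψadd : ∀ a b : A, ψ (a + b) - ψ a - ψ b ∈ rightSocle A')
    (hψmul : ∀ a b : A, ψ (a * b) - ψ a * ψ b ∈ rightSocle A')
    (hψsmul : ∀ (k : K) (a : A), ψ (k • a) - k • ψ a ∈ rightSocle A')
    (hψone : ψ 1 - 1 ∈ rightSocle A')
    (hψsurj : ∀ a' : A', ∃ a : A, ψ a - a' ∈ rightSocle A')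
    (hψker : ∀ a : A, (ψ a ∈ rightSocle A' ↔ a ∈ rightSocle A))
    -- neither `A` nor `A'` has a simple projective module
    (hnspA : ∀ (S : Type u) [AddCommGroup S] [Module Aᵐᵒᵖ S],
      IsSimpleModule Aᵐᵒᵖ S → ¬Module.Projective Aᵐᵒᵖ S)
    (hnspA' : ∀ (S : Type u) [AddCommGroup S] [Module A'ᵐᵒᵖ S],
      IsSimpleModule A'ᵐᵒᵖ S → ¬Module.Projective A'ᵐᵒᵖ S) :
    -- restriction along `A → A/I` preserves the relevant properties ...
    (∀ N : ModuleCat.{u} c.Quotientᵐᵒᵖ,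
      Module.Finite c.Quotientᵐᵒᵖ N → IsIndecomposable c.Quotientᵐᵒᵖ N →
      RestrNotProj c N → RestrFinite c N ∧ RestrIndec c N) ∧
    -- ... it is injective on isomorphism classes ...
    (∀ N N' : ModuleCat.{u} c.Quotientᵐᵒᵖ,
      Module.Finite c.Quotientᵐᵒᵖ N → IsIndecomposable c.Quotientᵐᵒᵖ N →
        RestrNotProj c N →
      Module.Finite c.Quotientᵐᵒᵖ N' → IsIndecomposable c.Quotientᵐᵒᵖ N' →
        RestrNotProj c N' →
      RestrIso₂ c N N' → Nonempty ((N : Type u) ≃ₗ[c.Quotientᵐᵒᵖ] (N' : Type u))) ∧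
    -- ... and surjective: every indecomposable non-projective `A`-module comes from an
    -- `A/I`-module (in particular it is annihilated by `I`)
    (∀ (M : Type u) [AddCommGroup M] [Module Aᵐᵒᵖ M],
      Module.Finite Aᵐᵒᵖ M → IsIndecomposable Aᵐᵒᵖ M → ¬Module.Projective Aᵐᵒᵖ M →
      (∀ x ∈ I, ∀ m : M, (MulOpposite.op x) • m = 0) ∧
      ∃ N : ModuleCat.{u} c.Quotientᵐᵒᵖ,
        Module.Finite c.Quotientᵐᵒᵖ N ∧ IsIndecomposable c.Quotientᵐᵒᵖ N ∧
        RestrNotProj c N ∧ RestrIsoTo c N M) ∧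
    -- in particular: `A` and `A'` have the same number of simple modules
    (∃ m : ℕ, HasNSimples.{u} A m ∧ HasNSimples.{u} A' m) := by
  have : IsArtinianRing Aᵐᵒᵖ := IsArtinianRing.of_finite K Aᵐᵒᵖ
  have : IsArtinianRing A'ᵐᵒᵖ := IsArtinianRing.of_finite K A'ᵐᵒᵖ
  have hop : Function.Surjective (RingHom.op c.mk') := fun b => by
    obtain ⟨a, ha⟩ := c.mk'_surjective b.unop
    exact ⟨MulOpposite.op a, congrArg MulOpposite.op ha⟩
  refine ⟨fun N hfin hind _ => ?_, fun N N' _ _ _ _ _ _ hiso => ?_, ?_, ?_⟩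
  · let := restrModule c N
    exact ⟨(finite_iff_of_surjective hop fun _ _ => rfl).2 hfin,
      (isIndecomposable_iff_of_surjective hop fun _ _ => rfl).2 hind⟩
  · let := restrModule c N
    let := restrModule c N'
    exact (nonempty_linearEquiv_iff_of_surjective hop (fun _ _ => rfl) fun _ _ => rfl).1 hiso
  · intro M _ _ hfin hind hproj
    have hann : ∀ x ∈ I, ∀ m : M, MulOpposite.op x • m = 0 := fun x hx m =>
      op_smul_eq_zero_of_mem_rightSocle hind hproj (hsoc hx) m
    refine ⟨hann, ?_⟩
    obtain ⟨inst, hcM⟩ := exists_module_of_surjective hop M fun r hr m => by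
      have h0 : c r.unop 0 := (RingCon.eq c).1 (congrArg MulOpposite.unop hr)
      exact hann r.unop (by simpa using (hc _ _).1 h0) m
    have heq : restrModule c M = ‹Module Aᵐᵒᵖ M› := Module.ext' _ _ hcM
    refine ⟨ModuleCat.of c.Quotientᵐᵒᵖ M, (finite_iff_of_surjective hop hcM).1 hfin,
      (isIndecomposable_iff_of_surjective hop hcM).1 hind, ?_, ?_⟩
    · change ¬@Module.Projective Aᵐᵒᵖ _ M _ (restrModule c M)
      rwa [heq]
    · change Nonempty (@LinearEquiv Aᵐᵒᵖ Aᵐᵒᵖ _ _ _ _ _ _ M M _ _ (restrModule c M) _)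
      rw [heq]
      exact ⟨LinearEquiv.refl _ _⟩
  · let J := rightSocleIdeal A'
    let π : A' →+* J.ringCon.Quotient := J.ringCon.mk'
    have hπ : ∀ x y, π x = π y ↔ x - y ∈ rightSocle A' := fun x y =>
      (RingCon.eq _).trans ((J.rel_iff x y).trans mem_rightSocleIdeal)
    have hπ0 : ∀ x, π x = 0 ↔ x ∈ rightSocle A' := fun x => by
      rw [← map_zero π, hπ, sub_zero]
    have hπsurj : Function.Surjective π := J.ringCon.mk'_surjective
    have hadd : ∀ a b, π (ψ (a + b)) = π (ψ a) + π (ψ b) := fun a b => by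
      rw [← map_add, hπ, ← sub_sub]
      exact hψadd a b
    let φ : A →+* J.ringCon.Quotient :=
      { toFun := fun a => π (ψ a)
        map_one' := by rw [← map_one π]; exact (hπ _ _).2 hψone
        map_mul' := fun a b => by rw [← map_mul]; exact (hπ _ _).2 (hψmul a b)
        map_zero' := by simpa using hadd 0 0
        map_add' := hadd }
    have hφsurj : Function.Surjective φ := fun b => by
      obtain ⟨a', rfl⟩ := hπsurj b
      obtain ⟨a, ha⟩ := hψsurj a'
      exact ⟨a, (hπ _ _).2 ha⟩
    have hπop : Function.Surjective (RingHom.op π) := fun b => by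
      obtain ⟨a, ha⟩ := hπsurj b.unop
      exact ⟨MulOpposite.op a, congrArg MulOpposite.op ha⟩
    have : IsArtinianRing J.ringCon.Quotientᵐᵒᵖ := hπop.isArtinianRing
    obtain ⟨n, hn⟩ := exists_hasNLeftSimples J.ringCon.Quotientᵐᵒᵖ
    exact ⟨n, HasNSimples.of_surjective hnspA hφsurj
        (fun a ha => (hψker a).1 ((hπ0 _).1 ha)) hn,
      HasNSimples.of_surjective hnspA' hπsurj (fun a ha => (hπ0 a).1 ha) hn⟩
end
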